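/- Let K be a number field with ring of integers 𝓞_K and let φ = p/q be a rational function of degree d ≥ 2, where p, q ∈ 𝓞_K[x] are coprime over K with max(deg p, deg q) = d. Assume the Wronskian W = p′q − pq′ has degree exactly 2d − 2 (so that all critical points of φ are finite), let K̄ be an algebraic closure of K, and let Φ : ℙ¹(K̄) → ℙ¹(K̄) be the map [x:y] ↦ [P(x,y):Q(x,y)] induced by the degree-d homogenizations P, Q of p, q. Assume: (1) for any roots α₁, α₂ of W in K̄ and any integers m, n ≥ 1, Φ^{∘m}([α₁:1]) = Φ^{∘n}([α₂:1]) implies m = n and α₁ = α₂; and (2) K is algebraically closed in a splitting field of p(x) − t q(x) over K(t). For a nonzero prime 𝔭 of 𝓞_K, say φ has good reduction at 𝔭 if the reductions P̄, Q̄ ∈ κ(𝔭)[X,Y] of P, Q modulo 𝔭 have no common zero in ℙ¹ over an algebraic closure of κ(𝔭); in that case let φ_𝔭 : ℙ¹(κ(𝔭)) → ℙ¹(κ(𝔭)) be the induced map [x:y] ↦ [P̄(x,y):Q̄(x,y)] and Per(φ_𝔭) its set of periodic points. Then for every ε > 0 there exists M such that every prime 𝔭 of good reduction with N(𝔭) >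 M satisfies #Per(φ_𝔭) ≤ ε·(N(𝔭) + 1). -/

import Mathlib

open NumberField Polynomial

/-- Evaluation of the degree-`d` homogenization of `p` at a pair `(x, y)`:
`P(x,y) = Σ_i p_i x^i y^{d-i}`. -/
noncomputable def homEval2 {R : Type*} [CommRing R] (p : Polynomial R) (d : ℕ)
    (x y : R) : R :=
  ∑ i ∈ Finset.range (d + 1), p.coeff i * x ^ i * y ^ (d - i)

/-- Evaluation of the degree-`d` homogenization of `p` at a pair of polynomials
`(A, B)`: `Σ_i p_i A^i B^{d-i}`. -/
noncomputable def homEvalPoly {k : Type*} [CommRing k] (p : Polynomial k) (d : ℕ)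
    (A B : Polynomial k) : Polynomial k :=
  ∑ i ∈ Finset.range (d + 1), Polynomial.C (p.coeff i) * A ^ i * B ^ (d - i)

/-- The pair `(p_n, q_n)` of numerator and denominator of the `n`-th iterate of the
rational function `p/q` of degree `d`: `p₀ = X`, `q₀ = 1`. -/
noncomputable def iterPQ {k : Type*} [CommRing k] (p q : Polynomial k) (d : ℕ) :
    ℕ → Polynomial k × Polynomial k
  | 0 => (Polynomial.X, 1)
  | n + 1 => (homEvalPoly p d (iterPQ p q d n).1 (iterPQ p q d n).2,
              homEvalPoly q d (iterPQ p q d n).1 (iterPQ p q d n).2)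

/-- The polynomial `p(x) − t·q(x)` over `K(t)`. -/
noncomputable def phiMinusT {k : Type*} [Field k] (p q : Polynomial k) :
    Polynomial (RatFunc k) :=
  p.map (algebraMap k (RatFunc k)) -
    Polynomial.C RatFunc.X * (q.map (algebraMap k (RatFunc k)))

/-- `φ = p/q` has good reduction at the (maximal) prime `𝔭` of `𝓞_K`: the reductions
mod `𝔭` of the degree-`d` homogenizations of `p` and `q` have no common zero in `ℙ¹`
over an algebraic closure of `κ(𝔭)`. -/
def goodReduction {K : Type*} [Field K] [NumberField K] (p q : Polynomial (𝓞 K))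
    (d : ℕ) (𝔭 : Ideal (𝓞 K)) (hp : 𝔭.IsMaximal) : Prop :=
  letI := hp
  letI := Ideal.Quotient.field 𝔭
  ∀ x y : AlgebraicClosure (𝓞 K ⧸ 𝔭), ¬(x = 0 ∧ y = 0) →
    ¬(homEval2 (p.map ((algebraMap (𝓞 K ⧸ 𝔭) (AlgebraicClosure (𝓞 K ⧸ 𝔭))).comp
          (Ideal.Quotient.mk 𝔭))) d x y = 0 ∧
      homEval2 (q.map ((algebraMap (𝓞 K ⧸ 𝔭) (AlgebraicClosure (𝓞 K ⧸ 𝔭))).comp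
          (Ideal.Quotient.mk 𝔭))) d x y = 0)

set_option synthInstance.maxHeartbeats 1000000 in
/-- The number of periodic points of the reduction `φ_𝔭 : ℙ¹(κ(𝔭)) → ℙ¹(κ(𝔭))` of the
rational map `φ = p/q`: a point of `ℙ¹(κ(𝔭))` is `φ_𝔭`-periodic iff some lift
`v ∈ κ(𝔭)² \ {0}` satisfies `F^{∘m}(v) = c • v` with `m ≥ 1`, `c ≠ 0`, where
`F(x,y) = (P̄(x,y), Q̄(x,y))` is the induced self-map of `κ(𝔭)²`. -/
noncomputable def projPerCount {K : Type*} [Field K] [NumberField K]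
    (p q : Polynomial (𝓞 K)) (d : ℕ) (𝔭 : Ideal (𝓞 K)) (hp : 𝔭.IsMaximal) : ℕ :=
  letI := hp
  letI := Ideal.Quotient.field 𝔭
  Set.ncard {x : Projectivization (𝓞 K ⧸ 𝔭) ((𝓞 K ⧸ 𝔭) × (𝓞 K ⧸ 𝔭)) |
    ∃ (v : (𝓞 K ⧸ 𝔭) × (𝓞 K ⧸ 𝔭)) (hv : v ≠ 0),
      Projectivization.mk (𝓞 K ⧸ 𝔭) v hv = x ∧
      ∃ m : ℕ, 0 < m ∧ ∃ c : 𝓞 K ⧸ 𝔭, c ≠ 0 ∧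
        (fun w => (homEval2 (p.map (Ideal.Quotient.mk 𝔭)) d w.1 w.2,
                   homEval2 (q.map (Ideal.Quotient.mk 𝔭)) d w.1 w.2))^[m] v = c • v}

section ModS1
open Polynomial

namespace PerProp

/-- polynomials in `k[t][X]` of bidegree at most `(T, N)` -/
def bideg (k : Type*) [Field k] (T N : ℕ) : Submodule k k[X][X] where
  carrier := {P | ∀ a b : ℕ, (T < a ∨ N < b) → (P.coeff b).coeff a = 0}
  add_mem' := by
    intro P Q hP hQ a b h
    simp [hP a b h, hQ a b h]
  zero_mem' := by intro a b h; simp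
  smul_mem' := by
    intro r P hP a b h
    simp [hP a b h]

section bideg
variable {k : Type*} [Field k]

theorem mem_bideg {T N : ℕ} {P : k[X][X]} :
    P ∈ bideg k T N ↔ ∀ a b : ℕ, (T < a ∨ N < b) → (P.coeff b).coeff a = 0 := Iff.rfl

theorem bideg_mono {T N T' N' : ℕ} (hT : T ≤ T') (hN : N ≤ N') : bideg k T N ≤ bideg k T' N' := by
  intro P hP a b h
  exact hP a b (by omega)

theorem bideg_mul {T N T' N' : ℕ} {P Q : k[X][X]} (hP : P ∈ bideg k T N) (hQ : Q ∈ bideg k T' N') :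
    P * Q ∈ bideg k (T + T') (N + N') := by
  intro a b h
  rw [coeff_mul, finsetSum_coeff]
  refine Finset.sum_eq_zero fun x hx => ?_
  rw [coeff_mul]
  refine Finset.sum_eq_zero fun y hy => ?_
  have hx := Finset.HasAntidiagonal.mem_antidiagonal.1 hx
  have hy := Finset.HasAntidiagonal.mem_antidiagonal.1 hy
  by_cases h1 : T < y.1 ∨ N < x.1
  · rw [hP _ _ h1, zero_mul]
  · rw [hQ y.2 x.2 (by omega), mul_zero]

theorem bideg_one : (1 : k[X][X]) ∈ bideg k 0 0 := by
  intro a b h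
  rw [coeff_one]
  split_ifs with h1
  · rw [coeff_one, if_neg (by omega)]
  · simp

theorem bideg_pow {T N : ℕ} {P : k[X][X]} (hP : P ∈ bideg k T N) (n : ℕ) :
    P ^ n ∈ bideg k (n * T) (n * N) := by
  induction n with
  | zero => simpa using bideg_one
  | succ n ih =>
    rw [pow_succ]
    refine bideg_mono ?_ ?_ (bideg_mul ih hP) <;> simp [add_mul]

theorem bideg_C {T : ℕ} {g : k[X]} (hg : g.natDegree ≤ T) : (C g : k[X][X]) ∈ bideg k T 0 := by
  intro a b h
  rw [coeff_C]
  split_ifs with h1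
  · exact coeff_eq_zero_of_natDegree_lt (by omega)
  · simp

theorem bideg_X : (X : k[X][X]) ∈ bideg k 0 1 := by
  intro a b h
  rw [coeff_X]
  split_ifs with h1
  · rw [coeff_one, if_neg (by omega)]
  · simp

theorem bideg_natDegree {T N : ℕ} {P : k[X][X]} (hP : P ∈ bideg k T N) : P.natDegree ≤ N := by
  rw [natDegree_le_iff_coeff_eq_zero]
  intro b hb
  ext a
  simpa using hP a b (Or.inr hb)

theorem bideg_coeff_natDegree {T N : ℕ} {P : k[X][X]} (hP : P ∈ bideg k T N) (b : ℕ) :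
    (P.coeff b).natDegree ≤ T := by
  rw [natDegree_le_iff_coeff_eq_zero]
  intro a ha
  exact hP a b (Or.inl ha)

theorem exists_bideg (P : k[X][X]) : ∃ T N, P ∈ bideg k T N := by
  refine ⟨P.support.sup (fun b => (P.coeff b).natDegree), P.natDegree, ?_⟩
  intro a b h
  by_cases hb : b ∈ P.support
  · rcases h with h | h
    · refine coeff_eq_zero_of_natDegree_lt (lt_of_le_of_lt ?_ h)
      exact Finset.le_sup (f := fun b => (P.coeff b).natDegree) hb
    · rw [coeff_eq_zero_of_natDegree_lt h]; simp
  · simp only [mem_support_iff, not_not] at hb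
    simp [hb]

/-- coordinates on `bideg` -/
noncomputable def bidegEquiv (T N : ℕ) : bideg k T N ≃ₗ[k] (Fin (N + 1) × Fin (T + 1) → k) where
  toFun P := fun x => ((P : k[X][X]).coeff x.1).coeff x.2
  map_add' := by intro P Q; ext x; simp
  map_smul' := by intro r P; ext x; simp
  invFun v := ⟨∑ b : Fin (N + 1), ∑ a : Fin (T + 1), monomial (b : ℕ) (monomial (a : ℕ) (v (b, a))), by
    refine Submodule.sum_mem _ fun b _ => Submodule.sum_mem _ fun a _ => ?_
    intro a' b' h
    rw [coeff_monomial]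
    split_ifs with h1
    · rw [coeff_monomial, if_neg (by omega)]
    · simp⟩
  left_inv := by
    intro P
    apply Subtype.ext
    ext b a
    simp only [finsetSum_coeff, coeff_monomial]
    by_cases h : T < a ∨ N < b
    · rw [P.2 a b h]
      refine Finset.sum_eq_zero fun i _ => Finset.sum_eq_zero fun j _ => ?_
      split_ifs with h1
      · rw [coeff_monomial, if_neg (by omega)]
      · simp
    · rw [Finset.sum_eq_single (⟨b, by omega⟩ : Fin (N + 1)), Finset.sum_eq_single (⟨a, by omega⟩ : Fin (T + 1))]
      · simp
      · intro j _ hj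
        have : (j : ℕ) ≠ a := fun h => hj (Fin.ext h)
        simp [coeff_monomial, this]
      · simp
      · intro i _ hi
        have : (i : ℕ) ≠ b := fun h => hi (Fin.ext h)
        simp [this]
      · simp
  right_inv := by
    intro v
    ext ⟨b, a⟩
    simp only [finsetSum_coeff, coeff_monomial]
    rw [Finset.sum_eq_single b, Finset.sum_eq_single a]
    · simp
    · intro j _ hj
      have : (j : ℕ) ≠ a := fun h => hj (Fin.ext h)
      simp [coeff_monomial, this]
    · simp
    · intro i _ hi
      have : (i : ℕ) ≠ b := fun h => hi (Fin.ext h)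
      simp [this]
    · simp

instance (T N : ℕ) : FiniteDimensional k (bideg k T N) :=
  Module.Finite.equiv (bidegEquiv T N).symm

theorem finrank_bideg (T N : ℕ) : Module.finrank k (bideg k T N) = (N + 1) * (T + 1) := by
  rw [(bidegEquiv T N).finrank_eq]; simp

theorem bideg_modByMonic {F : k[X][X]} {c δ : ℕ} (hF : F.Monic) (hdeg : F.natDegree = δ + 1)
    (hFb : F ∈ bideg k c (δ + 1)) (j : ℕ) : ∀ (T : ℕ) (P : k[X][X]), P ∈ bideg k T (δ + j) →
    P %ₘ F ∈ bideg k (T + j * c) δ := by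
  induction j with
  | zero =>
    intro T P hP
    rw [(modByMonic_eq_self_iff hF).2]
    · simpa using hP
    · rw [degree_eq_natDegree hF.ne_zero, hdeg]
      refine lt_of_le_of_lt degree_le_natDegree ?_
      have := bideg_natDegree hP
      exact_mod_cast (by omega)
  | succ j ih =>
    intro T P hP
    set l := P.coeff (δ + (j + 1)) with hl
    have h1 : C l * X ^ j * F ∈ bideg k (T + c) (δ + (j + 1)) := by
      have := bideg_mul (bideg_mul (bideg_C (bideg_coeff_natDegree hP (δ + (j + 1)))) (bideg_pow bideg_X j)) hFb
      refine bideg_mono ?_ ?_ this <;> simp <;> omega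
    have h2 : P - C l * X ^ j * F ∈ bideg k (T + c) (δ + j) := by
      have h3 : P - C l * X ^ j * F ∈ bideg k (T + c) (δ + (j + 1)) :=
        Submodule.sub_mem _ (bideg_mono (by omega) le_rfl hP) h1
      intro a b h
      by_cases hb : b = δ + (j + 1)
      · subst hb
        have : (C l * X ^ j * F).coeff (δ + (j + 1)) = l := by
          rw [show δ + (j + 1) = (δ + 1) + j by ring, mul_assoc, coeff_C_mul, mul_comm (X ^ j) F, coeff_mul_X_pow,
            ← hdeg, hF.coeff_natDegree, mul_one]
        rw [coeff_sub, this, ← hl]; simp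
      · exact h3 a b (by omega)
    have h4 := ih (T + c) _ h2
    have h5 : (P - C l * X ^ j * F) %ₘ F = P %ₘ F := by
      rw [sub_modByMonic, (modByMonic_eq_zero_iff_dvd hF).2 (Dvd.intro_left _ rfl), sub_zero]
    rw [h5] at h4
    refine bideg_mono ?_ le_rfl h4
    rw [add_mul]; omega

end bideg

end PerProp
end ModS1

section ModS2
open Polynomial

namespace PerProp

section loc
variable {k : Type*} [Field k]

/-- `i` is a local expansion homomorphism at the point `(t0, θ0)` of the curve `F = 0`. -/
structure IsLoc (F : k[X][X]) (t0 θ0 : k) (i : k[X][X] →ₐ[k] PowerSeries k) : Prop where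
  hX : i (C X) = PowerSeries.C t0 + PowerSeries.X
  hF : i F = 0
  hev : ∀ P : k[X][X], PowerSeries.constantCoeff (i P) = P.evalEval t0 θ0

theorem evalEval_C_X (t0 θ0 : k) : (C X : k[X][X]).evalEval t0 θ0 = t0 := by
  simp [evalEval]

theorem exists_isLoc {F : k[X][X]} (hF : F.Monic) (t0 θ0 : k) (h0 : F.evalEval t0 θ0 = 0)
    (h1 : (derivative F).evalEval t0 θ0 ≠ 0) : ∃ i, IsLoc F t0 θ0 i := by
  let e : k[X] →ₐ[k] PowerSeries k := aeval (PowerSeries.C t0 + PowerSeries.X)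
  have key : ∀ P : k[X][X], ∀ y : PowerSeries k,
      PowerSeries.constantCoeff (eval₂ (e : k[X] →+* PowerSeries k) y P)
        = P.evalEval t0 (PowerSeries.constantCoeff y) := by
    intro P y
    rw [hom_eval₂, evalEval, ← coe_evalRingHom t0, ← eval₂_id (p := P), hom_eval₂]
    simp only [coe_evalRingHom, eval_C]
    congr 1
    ext
    · simp [e]
    · simp [e]
  have hH := HenselianRing.is_henselian (I := Ideal.span {(PowerSeries.X : PowerSeries k)})
    (F.map (e : k[X] →+* PowerSeries k)) (hF.map _) (PowerSeries.C θ0)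
    (by rw [Ideal.mem_span_singleton, PowerSeries.X_dvd_iff, eval_map, key]; simpa using h0)
    (by
      refine IsUnit.map _ ?_
      rw [PowerSeries.isUnit_iff_constantCoeff, derivative_map, eval_map, key]
      simpa using h1)
  obtain ⟨θ, hθ, hθ0⟩ := hH
  have hc : PowerSeries.constantCoeff θ = θ0 := by
    rw [Ideal.mem_span_singleton, PowerSeries.X_dvd_iff] at hθ0
    simpa [sub_eq_zero] using hθ0
  have hi : ∀ P, (aevalTower e θ : k[X][X] →ₐ[k] PowerSeries k) P = eval₂ (e : k[X] →+* PowerSeries k) θ P := by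
    intro P; rfl
  refine ⟨aevalTower e θ, ?_, ?_, ?_⟩
  · simp [e]
  · rw [hi, ← eval_map]; exact hθ
  · intro P
    rw [hi, key, hc]

variable {F : k[X][X]} {c δ : ℕ}

theorem IsLoc.modByMonic {t0 θ0 : k} {i : k[X][X] →ₐ[k] PowerSeries k} (h : IsLoc F t0 θ0 i)
    (P : k[X][X]) : i (P %ₘ F) = i P := by
  conv_rhs => rw [← modByMonic_add_div P F]
  simp [h.hF]

theorem exists_sep {t0 θ0 t1 θ1 : k} (h : (t0, θ0) ≠ (t1, θ1)) :
    ∃ P : k[X][X], P.evalEval t0 θ0 ≠ 0 ∧ P.evalEval t1 θ1 = 0 := by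
  by_cases ht : t0 = t1
  · have : θ0 ≠ θ1 := fun h' => h (by rw [ht, h'])
    exact ⟨X - C (C θ1), by simp [evalEval, sub_eq_zero, this], by simp [evalEval]⟩
  · exact ⟨C (X - C t1), by simp [evalEval, sub_eq_zero, ht], by simp [evalEval]⟩

theorem IsLoc.approx {t0 θ0 : k} {i : k[X][X] →ₐ[k] PowerSeries k} (h : IsLoc F t0 θ0 i)
    (M : ℕ) (w : PowerSeries k) : ∃ P : k[X][X], PowerSeries.X ^ M ∣ i P - w := by
  refine ⟨aeval (C X - C (C t0)) (PowerSeries.trunc M w), ?_⟩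
  have h1 : i (aeval (C X - C (C t0)) (PowerSeries.trunc M w)) = (PowerSeries.trunc M w : PowerSeries k) := by
    have : i (C X - C (C t0)) = PowerSeries.X := by
      rw [map_sub, h.hX, show (C (C t0) : k[X][X]) = algebraMap k k[X][X] t0 from rfl, AlgHom.commutes]
      rw [show algebraMap k (PowerSeries k) t0 = PowerSeries.C t0 from rfl]
      ring
    rw [← aeval_algHom_apply, this]
    conv_rhs => rw [Polynomial.as_sum_range (PowerSeries.trunc M w)]
    rw [aeval_eq_sum_range, ← Polynomial.coeToPowerSeries.ringHom_apply, map_sum]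
    refine Finset.sum_congr rfl fun j _ => ?_
    rw [Polynomial.coeToPowerSeries.ringHom_apply, ← C_mul_X_pow_eq_monomial, PowerSeries.smul_eq_C_mul]
    simp
  rw [h1, PowerSeries.X_pow_dvd_iff]
  intro m hm
  rw [map_sub, Polynomial.coeff_coe, PowerSeries.coeff_trunc, if_pos hm, sub_self]

theorem exists_interp {I : Type*} [Fintype I] [DecidableEq I] {t0 θ0 : I → k}
    {ι : I → (k[X][X] →ₐ[k] PowerSeries k)} (hι : ∀ i, IsLoc F (t0 i) (θ0 i) (ι i))
    (hinj : ∀ i j, (t0 i, θ0 i) = (t0 j, θ0 j) → i = j) (M : ℕ) (v : I → PowerSeries k) :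
    ∃ P : k[X][X], ∀ i, PowerSeries.X ^ M ∣ ι i P - v i := by
  have hs : ∀ i j : I, ∃ P : k[X][X], i ≠ j → P.evalEval (t0 i) (θ0 i) ≠ 0 ∧ P.evalEval (t0 j) (θ0 j) = 0 := by
    intro i j
    by_cases hij : i = j
    · exact ⟨0, fun h => (h hij).elim⟩
    · obtain ⟨P, hP⟩ := exists_sep (fun h => hij (hinj i j h))
      exact ⟨P, fun _ => hP⟩
  choose e he using hs
  let E : I → k[X][X] := fun i => ∏ j ∈ Finset.univ.erase i, e i j ^ M
  have hE1 : ∀ i j, i ≠ j → PowerSeries.X ^ M ∣ ι j (E i) := by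
    intro i j hij
    have h1 : e i j ^ M ∣ E i :=
      Finset.dvd_prod_of_mem (fun j => e i j ^ M) (Finset.mem_erase.2 ⟨hij.symm, Finset.mem_univ j⟩)
    refine dvd_trans ?_ (map_dvd (ι j) h1)
    rw [map_pow]
    refine pow_dvd_pow_of_dvd ?_ M
    rw [PowerSeries.X_dvd_iff, (hι j).hev]
    exact (he i j hij).2
  have hE2 : ∀ i, ∃ u : PowerSeries k, ι i (E i) * u = 1 := by
    intro i
    have : IsUnit (ι i (E i)) := by
      rw [PowerSeries.isUnit_iff_constantCoeff, isUnit_iff_ne_zero]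
      simp only [E, map_prod, map_pow]
      refine Finset.prod_ne_zero_iff.2 fun j hj => pow_ne_zero _ ?_
      rw [(hι i).hev]
      exact (he i j (Finset.ne_of_mem_erase hj).symm).1
    exact this.exists_right_inv
  choose u hu using hE2
  have hP := fun i => (hι i).approx M (u i * v i)
  choose P hP using hP
  refine ⟨∑ i, E i * P i, fun j => ?_⟩
  rw [map_sum, ← Finset.add_sum_erase _ _ (Finset.mem_univ j), add_sub_right_comm]
  refine dvd_add ?_ (Finset.dvd_sum fun i hi => ?_)
  · rw [map_mul]
    have : ι j (E j) * ι j (P j) - v j = ι j (E j) * (ι j (P j) - u j * v j) := by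
      linear_combination (v j) * hu j
    rw [this]
    exact dvd_mul_of_dvd_right (hP j) _
  · rw [map_mul]
    exact dvd_mul_of_dvd_left (hE1 i j (Finset.ne_of_mem_erase hi)) _

/-- number of zeros with multiplicity -/
theorem lemmaZ (hF : F.Monic) (hFp : Prime F) (hdeg : F.natDegree = δ + 1)
    (hFb : F ∈ bideg k c (δ + 1))
    {I : Type*} [Fintype I] {t0 θ0 : I → k}
    {ι : I → (k[X][X] →ₐ[k] PowerSeries k)} (hι : ∀ i, IsLoc F (t0 i) (θ0 i) (ι i))
    (hinj : ∀ i j, (t0 i, θ0 i) = (t0 j, θ0 j) → i = j) (M : ℕ)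
    {α β : ℕ} {f : k[X][X]} (hf : f ∈ bideg k α β) (hnd : ¬ F ∣ f)
    (hdvd : ∀ i, PowerSeries.X ^ M ∣ ι i f) :
    M * Fintype.card I ≤ (δ + 1) * (α + β * c) := by
  classical
  let Ψ : k[X][X] →ₗ[k] (I × Fin M → k) := LinearMap.pi fun x =>
    (PowerSeries.coeff (x.2 : ℕ) : PowerSeries k →ₗ[k] k) ∘ₗ (ι x.1).toLinearMap
  have hΨ : ∀ P x, Ψ P x = PowerSeries.coeff (x.2 : ℕ) (ι x.1 P) := fun P x => rfl
  have hmodb : ∀ P : k[X][X], ∃ T, P %ₘ F ∈ bideg k T δ := by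
    intro P
    obtain ⟨T, N, h⟩ := exists_bideg P
    exact ⟨_, bideg_modByMonic hF hdeg hFb N T P (bideg_mono le_rfl (by omega) h)⟩
  have hΨmod : ∀ P, Ψ (P %ₘ F) = Ψ P := by
    intro P; ext x; rw [hΨ, hΨ, (hι x.1).modByMonic]
  have hpre : ∀ x : I × Fin M, ∃ P : k[X][X], ∃ T, P ∈ bideg k T δ ∧ Ψ P = Pi.single x 1 := by
    intro x
    obtain ⟨P, hP⟩ := exists_interp hι hinj M (fun i => if i = x.1 then PowerSeries.X ^ (x.2 : ℕ) else 0)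
    obtain ⟨T, hT⟩ := hmodb P
    refine ⟨_, T, hT, ?_⟩
    rw [hΨmod]
    ext y
    have := (PowerSeries.X_pow_dvd_iff.1 (hP y.1)) y.2 y.2.2
    rw [map_sub, sub_eq_zero] at this
    rw [hΨ, this]
    by_cases h1 : y.1 = x.1
    · rw [if_pos h1, PowerSeries.coeff_X_pow]
      by_cases h2 : y.2 = x.2
      · rw [if_pos (by rw [h2]), show y = x from Prod.ext h1 h2, Pi.single_eq_same]
      · rw [if_neg (fun h => h2 (Fin.ext h)), Pi.single_eq_of_ne]
        intro h; exact h2 (by rw [h])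
    · rw [if_neg h1, map_zero, Pi.single_eq_of_ne]
      intro h; exact h1 (by rw [h])
  choose B Tx hB hBΨ using hpre
  let T := Finset.univ.sup Tx
  set e := α + β * c with he
  have hsurj : ∀ v, ∃ P ∈ bideg k (T + e) δ, Ψ P = v := by
    intro v
    refine ⟨∑ x, v x • B x, Submodule.sum_mem _ fun x _ => Submodule.smul_mem _ _ ?_, ?_⟩
    · refine bideg_mono ?_ le_rfl (hB x)
      have : Tx x ≤ T := Finset.le_sup (Finset.mem_univ x)
      omega
    · rw [map_sum]
      simp only [map_smul, hBΨ]
      ext y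
      simp [Finset.sum_apply, Pi.single_apply]
  let Ψ' : bideg k (T + e) δ →ₗ[k] (I × Fin M → k) := Ψ ∘ₗ (bideg k (T + e) δ).subtype
  have hr : LinearMap.range Ψ' = ⊤ := by
    rw [LinearMap.range_eq_top]
    intro v
    obtain ⟨P, hP, h⟩ := hsurj v
    exact ⟨⟨P, hP⟩, h⟩
  have hmul : ∀ a ∈ bideg k T δ, (f * a) %ₘ F ∈ bideg k (T + e) δ := by
    intro a ha
    have := bideg_modByMonic hF hdeg hFb β (α + T) (f * a) (bideg_mono le_rfl (by omega) (bideg_mul hf ha))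
    exact bideg_mono (by omega) le_rfl this
  let μ : bideg k T δ →ₗ[k] LinearMap.ker Ψ' :=
    { toFun := fun a => ⟨⟨(f * a) %ₘ F, hmul a a.2⟩, by
        rw [LinearMap.mem_ker]
        change Ψ ((f * a) %ₘ F) = 0
        rw [hΨmod]
        ext x
        rw [hΨ, map_mul]
        exact (PowerSeries.X_pow_dvd_iff.1 (dvd_mul_of_dvd_left (hdvd x.1) _)) x.2 x.2.2⟩
      map_add' := by
        intro a b
        apply Subtype.ext; apply Subtype.ext
        simp [mul_add, add_modByMonic]
      map_smul' := by
        intro r a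
        apply Subtype.ext; apply Subtype.ext
        simp only [Submodule.coe_smul, RingHom.id_apply, mul_smul_comm]
        rw [← algebraMap_smul k[X] r (f * (a : k[X][X])), smul_modByMonic, algebraMap_smul] }
  have hμ : Function.Injective μ := by
    rw [injective_iff_map_eq_zero]
    intro a ha
    have h1 : (f * (a : k[X][X])) %ₘ F = 0 := by
      have := congrArg (fun z : LinearMap.ker Ψ' => ((z : bideg k (T + e) δ) : k[X][X])) ha
      exact this
    rw [modByMonic_eq_zero_iff_dvd hF] at h1
    have h2 := (hFp.dvd_or_dvd h1).resolve_left hnd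
    apply Subtype.ext
    by_contra h3
    have h4 := Polynomial.degree_le_of_dvd h2 h3
    have h5 := natDegree_le_of_dvd h2 h3
    have := bideg_natDegree a.2
    omega
  have hfin : Module.Finite k (bideg k (T + e) δ) := inferInstance
  have : IsNoetherian k (bideg k (T + e) δ) := isNoetherian_of_isNoetherianRing_of_finite k (bideg k (T + e) δ)
  have : Module.Finite k (LinearMap.ker Ψ') :=
    Module.Finite.of_injective (LinearMap.ker Ψ').subtype (Submodule.subtype_injective _)
  have h1 := LinearMap.finrank_le_finrank_of_injective hμ
  have h2 := LinearMap.finrank_range_add_finrank_ker (K := k) (V := bideg k (T + e) δ) Ψ'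
  rw [hr, finrank_top, finrank_bideg] at h2
  rw [finrank_bideg] at h1
  have h3 : Module.finrank k (I × Fin M → k) = M * Fintype.card I := by
    rw [Module.finrank_fintype_fun_eq_card]; simp [mul_comm]
  rw [h3] at h2
  have h6 : (δ + 1) * (T + e + 1) = (δ + 1) * (T + 1) + (δ + 1) * e := by ring
  omega

end loc
end PerProp
end ModS2

section ModS3
open Polynomial

namespace PerProp

section der
variable {k : Type*} [Field k]

/-- the derivative with respect to the inner variable -/
noncomputable def dt : Derivation k k[X][X] k[X][X] where
  toFun P := Bivariate.swap (derivative (Bivariate.swap P))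
  map_add' := by intro P Q; simp
  map_smul' := by
    intro r P
    rw [map_smul, RingHom.id_apply, ← algebraMap_smul k[X] r (Bivariate.swap P), derivative_smul,
      algebraMap_smul, map_smul]
  map_one_eq_zero' := by simp
  leibniz' := by intro P Q; simp [derivative_mul, Bivariate.swap_swap_apply]; ring

theorem dt_apply (P : k[X][X]) : dt P = Bivariate.swap (derivative (Bivariate.swap P)) := rfl

theorem dt_C (a : k[X]) : dt (C a : k[X][X]) = C (derivative a) := by
  rw [dt_apply]
  simp [Bivariate.swap_C, derivative_map, Bivariate.swap_map_C]

theorem dt_X : dt (X : k[X][X]) = 0 := by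
  rw [dt_apply]
  simp [Bivariate.swap_Y]

theorem dt_coeff (P : k[X][X]) (b : ℕ) : (dt P).coeff b = derivative (P.coeff b) := by
  induction P using Polynomial.induction_on' with
  | add P Q hP hQ => simp [hP, hQ]
  | monomial n a =>
    rw [← C_mul_X_pow_eq_monomial, Derivation.leibniz, Derivation.leibniz_pow, dt_X, dt_C]
    simp [coeff_X_pow]
    rw [apply_ite derivative]; simp

theorem dt_bideg {T N : ℕ} {P : k[X][X]} (hP : P ∈ bideg k T N) : dt P ∈ bideg k T N := by
  intro a b h
  rw [dt_coeff, coeff_derivative, hP (a + 1) b (by omega), zero_mul]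

theorem derivative_bideg {T N : ℕ} {P : k[X][X]} (hP : P ∈ bideg k T (N + 1)) :
    derivative P ∈ bideg k T N := by
  intro a b h
  rw [coeff_derivative]
  have := hP a (b + 1) (by omega)
  rw [show ((b : k[X]) + 1) = C ((b : k) + 1) by simp, coeff_mul_C, this, zero_mul]

/-- the derivation along the curve `F = 0` -/
noncomputable def DD (F P : k[X][X]) : k[X][X] := derivative F * dt P - dt F * derivative P

theorem DD_add (F P Q : k[X][X]) : DD F (P + Q) = DD F P + DD F Q := by
  simp [DD]; ring

theorem DD_smul (F : k[X][X]) (r : k) (P : k[X][X]) : DD F (r • P) = r • DD F P := by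
  have : derivative (r • P) = r • derivative P := by
    rw [← algebraMap_smul k[X] r P, derivative_smul, algebraMap_smul]
  have h2 : dt (r • P) = r • dt P := dt.map_smul r P
  simp only [DD, this, h2, smul_sub, mul_smul_comm]

/-- `DD F` as a linear map -/
noncomputable def DDl (F : k[X][X]) : k[X][X] →ₗ[k] k[X][X] where
  toFun := DD F
  map_add' := DD_add F
  map_smul' := DD_smul F

theorem DDl_apply (F P : k[X][X]) : DDl F P = DD F P := rfl

theorem DD_mul_pow (F a v : k[X][X]) {n : ℕ} (hn : (n : k) = 0) :
    DD F (a * v ^ n) = DD F a * v ^ n := by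
  have hn' : ((n : ℕ) : k[X][X]) = 0 := by
    have : ((n : ℕ) : k[X][X]) = C (C (n : k)) := by simp
    rw [this, hn]; simp
  have h1 : derivative (a * v ^ n) = derivative a * v ^ n := by
    rw [derivative_mul, derivative_pow]
    have : (C (n : k[X]) : k[X][X]) = 0 := by simpa using hn'
    simp [this]
  have h2 : dt (a * v ^ n) = dt a * v ^ n := by
    rw [Derivation.leibniz, Derivation.leibniz_pow]
    have h3 : ∀ z : k[X][X], n • z = 0 := by
      intro z; rw [nsmul_eq_mul, hn', zero_mul]
    rw [h3]; simp [mul_comm]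
  rw [DD, h1, h2, DD]; ring

theorem DDl_iter_mul_pow (F a v : k[X][X]) {n : ℕ} (hn : (n : k) = 0) (i : ℕ) :
    ((DDl F) ^ i) (a * v ^ n) = ((DDl F) ^ i) a * v ^ n := by
  induction i with
  | zero => simp
  | succ i ih => rw [pow_succ', Module.End.mul_apply, ih, DDl_apply, DD_mul_pow F _ _ hn, Module.End.mul_apply, DDl_apply]

theorem DDl_bideg {F : k[X][X]} {c δ : ℕ} (hFb : F ∈ bideg k c (δ + 1)) {T N : ℕ} {P : k[X][X]}
    (hP : P ∈ bideg k T N) (i : ℕ) :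
    ((DDl F) ^ i) P ∈ bideg k (T + i * c) (N + i * (δ + 1)) := by
  induction i with
  | zero => simpa using hP
  | succ i ih =>
    rw [pow_succ', Module.End.mul_apply, DDl_apply]
    refine Submodule.sub_mem _ ?_ ?_
    · refine bideg_mono ?_ ?_ (bideg_mul (derivative_bideg hFb) (dt_bideg ih))
      · rw [add_mul]; omega
      · rw [add_mul]; omega
    · refine bideg_mono ?_ ?_ (bideg_mul (dt_bideg hFb) (derivative_bideg (bideg_mono le_rfl (Nat.le_succ _) ih)))
      · rw [add_mul]; omega
      · rw [add_mul]; omega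

theorem chain_rule (i : k[X][X] →ₐ[k] PowerSeries k) {t0 : k} (hX : i (C X) = PowerSeries.C t0 + PowerSeries.X)
    (P : k[X][X]) : PowerSeries.derivative k (i P) =
      i (dt P) + i (derivative P) * PowerSeries.derivative k (i X) := by
  have hC : ∀ a : k[X], PowerSeries.derivative k (i (C a)) = i (C (derivative a)) := by
    intro a
    induction a using Polynomial.induction_on' with
    | add P Q hP hQ => simp [hP, hQ]
    | monomial n a =>
      rw [← C_mul_X_pow_eq_monomial]
      have ha : i (C (C a)) = PowerSeries.C a := i.commutes a
      have hn : i (C (C (n : k))) = (n : PowerSeries k) := by simp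
      simp only [map_mul, map_pow, hX, ha, derivative_mul, derivative_C, derivative_X_pow, hn, map_zero, zero_mul, zero_add]
      rw [Derivation.leibniz, Derivation.leibniz_pow, map_add]
      simp
  induction P using Polynomial.induction_on' with
  | add P Q hP hQ => simp only [map_add, hP, hQ, add_mul]; ring
  | monomial n a =>
    rw [← C_mul_X_pow_eq_monomial, map_mul, Derivation.leibniz, hC, map_pow, Derivation.leibniz_pow, Derivation.leibniz,
      Derivation.leibniz_pow, dt_X, dt_C, derivative_mul, derivative_X_pow, derivative_C]
    simp only [smul_eq_mul, nsmul_eq_mul, map_add, map_mul, map_pow, mul_zero, smul_zero, map_zero, zero_mul, zero_add, map_natCast]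
    ring

theorem IsLoc.DD {F : k[X][X]} {t0 θ0 : k} {i : k[X][X] →ₐ[k] PowerSeries k} (h : IsLoc F t0 θ0 i)
    (P : k[X][X]) : i (DD F P) = i (derivative F) * PowerSeries.derivative k (i P) := by
  have h1 := chain_rule i h.hX P
  have h2 := chain_rule i h.hX F
  rw [h.hF, map_zero] at h2
  rw [PerProp.DD, map_sub, map_mul, map_mul, h1]
  linear_combination i (derivative P) * h2

theorem dvd_of_iter (u : PowerSeries k) (hu : IsUnit u) (M : ℕ) (hM : ∀ j, 0 < j → j < M → (j : k) ≠ 0)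
    (g : PowerSeries k)
    (hg : ∀ j < M, PowerSeries.constantCoeff ((fun x => u * PowerSeries.derivative k x)^[j] g) = 0) :
    PowerSeries.X ^ M ∣ g := by
  induction M generalizing g with
  | zero => simp
  | succ M ih =>
    have h1 := ih (fun j h0 h => hM j h0 (by omega)) (u * PowerSeries.derivative k g) (by
      intro j hj
      have := hg (j + 1) (by omega)
      rwa [Function.iterate_succ_apply] at this)
    rw [hu.dvd_mul_left, PowerSeries.X_pow_dvd_iff] at h1
    rw [PowerSeries.X_pow_dvd_iff]
    intro m hm
    rcases m with _ | m
    · simpa using hg 0 (by omega)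
    · have := h1 m (by omega)
      rw [PowerSeries.coeff_derivative] at this
      have h3 := hM (m + 1) (by omega) hm
      push_cast at h3
      exact (mul_eq_zero.1 this).resolve_right h3

theorem IsLoc.dvd_of_DDl {F : k[X][X]} {t0 θ0 : k} {i : k[X][X] →ₐ[k] PowerSeries k} (h : IsLoc F t0 θ0 i)
    (hF1 : (derivative F).evalEval t0 θ0 ≠ 0) (M : ℕ) (hM : ∀ j, 0 < j → j < M → (j : k) ≠ 0)
    (f : k[X][X]) (hf : ∀ j < M, (((DDl F) ^ j) f).evalEval t0 θ0 = 0) : PowerSeries.X ^ M ∣ i f := by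
  refine dvd_of_iter (i (derivative F)) ?_ M hM _ ?_
  · rw [PowerSeries.isUnit_iff_constantCoeff, h.hev]; simpa using hF1
  · intro j hj
    have : ∀ j, (fun x => i (derivative F) * PowerSeries.derivative k x)^[j] (i f) = i (((DDl F) ^ j) f) := by
      intro j
      induction j with
      | zero => simp
      | succ j ih => rw [Function.iterate_succ_apply', ih, pow_succ', Module.End.mul_apply, DDl_apply, h.DD]
    rw [this, h.hev]
    exact hf j hj

end der
end PerProp
end ModS3

section ModS4
open Polynomial

namespace PerProp

section step
variable {k : Type*} [Field k]

instance (T N : ℕ) : Module.Free k (bideg k T N) := Module.Free.of_equiv (bidegEquiv T N).symm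

theorem exists_orders {V : Type*} [AddCommGroup V] [Module k V] (φ : V →ₗ[k] PowerSeries k)
    (hφ : Function.Injective φ) (n : ℕ) (hn : n ≤ Module.finrank k V) :
    ∃ (v : Fin n → V) (o : Fin n → ℕ), Function.Injective o ∧ ∀ j, (φ (v j)).order = (o j : ℕ∞) := by
  classical
  let S : Set ℕ := {m | ∃ v : V, (φ v).order = (m : ℕ∞)}
  have hS : ∃ s : Finset ℕ, (s : Set ℕ) ⊆ S ∧ s.card = n := by
    by_cases hfin : S.Finite
    · let s := hfin.toFinset
      have h1 : n ≤ s.card := by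
        let ψ : V →ₗ[k] (s → k) := LinearMap.pi fun x => (PowerSeries.coeff (x : ℕ) : PowerSeries k →ₗ[k] k) ∘ₗ φ
        have hψ : Function.Injective ψ := by
          rw [injective_iff_map_eq_zero]
          intro v hv
          by_contra hne
          have h2 : φ v ≠ 0 := fun h => hne (hφ (by rw [h, map_zero]))
          have h3 := PowerSeries.coeff_order h2
          refine h3 ?_
          have hmem : (φ v).order.toNat ∈ s := by
            simp only [s, Set.Finite.mem_toFinset]
            refine ⟨v, ?_⟩
            exact (ENat.coe_toNat (PowerSeries.order_finite_iff_ne_zero.2 h2).ne).symm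
          exact congrFun hv ⟨_, hmem⟩
        have := LinearMap.finrank_le_finrank_of_injective hψ
        rw [Module.finrank_fintype_fun_eq_card, Fintype.card_coe] at this
        omega
      obtain ⟨t, ht, hc⟩ := Finset.exists_subset_card_eq h1
      refine ⟨t, ?_, hc⟩
      intro x hx
      exact hfin.mem_toFinset.1 (ht hx)
    · obtain ⟨t, ht, hc⟩ := Set.Infinite.exists_subset_card_eq hfin n
      exact ⟨t, ht, hc⟩
  obtain ⟨s, hs, hc⟩ := hS
  let e := (s.equivFinOfCardEq hc).symm
  choose w hw using fun x : s => hs x.2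
  exact ⟨fun j => w (e j), fun j => (e j : ℕ), fun a b h => e.injective (Subtype.ext h), fun j => hw (e j)⟩

theorem sum_ne_zero_of_orders {J : Type*} (S : Finset J) (hS : S.Nonempty) (f : J → PowerSeries k) (o : J → ℕ)
    (ho : ∀ i ∈ S, ∀ j ∈ S, o i = o j → i = j) (hf : ∀ j ∈ S, (f j).order = (o j : ℕ∞)) :
    ∑ j ∈ S, f j ≠ 0 := by
  classical
  obtain ⟨j0, hj0, hmin⟩ := S.exists_min_image o hS
  intro h
  have h1 := congrArg (PowerSeries.coeff (o j0)) h
  rw [map_sum, Finset.sum_eq_single j0] at h1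
  · have := (PowerSeries.order_eq_nat.1 (hf j0 hj0)).1
    exact this (by simpa using h1)
  · intro j hj hne
    have h2 := hmin j hj
    have h3 : o j0 ≠ o j := fun h => hne (ho j hj j0 hj0 h.symm)
    exact (PowerSeries.order_eq_nat.1 (hf j hj)).2 _ (by omega)
  · intro h; exact (h hj0).elim

/-- constants of the Stepanov argument -/
def stB (c δ : ℕ) : ℕ := c * δ + 1
/-- constants of the Stepanov argument -/
def stM (c δ : ℕ) : ℕ := (δ + 1) * stB c δ
/-- constants of the Stepanov argument -/
def stE (c δ : ℕ) : ℕ := stM c δ * c + δ * c + (stM c δ * (δ + 1) + δ * c) * c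
/-- constants of the Stepanov argument -/
def stA (c δ : ℕ) : ℕ := stM c δ * (stB c δ + stE c δ)
/-- constants of the Stepanov argument -/
def stQ (c δ : ℕ) : ℕ := stM c δ + (δ + 1) * (stA c δ + δ * c) + 1

/-- the polynomial `g ^ δ * v ^ q` evaluated on the Stepanov points -/
noncomputable def vhat (p e : ℕ) [Fact p.Prime] [CharP k p] (δ : ℕ) (s : k[X][X]) (g : k[X]) (v : k[X][X]) : k[X][X] :=
  ∑ b ∈ Finset.range (δ + 1), C ((v.coeff b).map (iterateFrobenius k p e)) * s ^ b * C g ^ (δ - b)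

theorem vhat_bideg (p e : ℕ) [Fact p.Prime] [CharP k p] {c δ B : ℕ} {s : k[X][X]} {g : k[X]} {v : k[X][X]}
    (hs : s ∈ bideg k c c) (hg : g.natDegree ≤ c) (hv : v ∈ bideg k B δ) :
    vhat p e δ s g v ∈ bideg k (B + δ * c) (δ * c) := by
  refine Submodule.sum_mem _ fun b hb => ?_
  have hb' : b ≤ δ := by have := Finset.mem_range.1 hb; omega
  have h1 := bideg_mul (bideg_mul (bideg_C (k := k) (T := B) (g := (v.coeff b).map (iterateFrobenius k p e))
    (natDegree_map_le.trans (bideg_coeff_natDegree hv b))) (bideg_pow hs b)) (bideg_pow (bideg_C hg) (δ - b))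
  obtain ⟨r, rfl⟩ := Nat.exists_eq_add_of_le hb'
  refine bideg_mono ?_ ?_ h1
  · rw [Nat.add_sub_cancel_left]; ring_nf; rfl
  · rw [Nat.add_sub_cancel_left]; ring_nf; omega

theorem vhat_eval (p e : ℕ) [Fact p.Prime] [CharP k p] {δ B : ℕ} {s : k[X][X]} {g : k[X]} {v : k[X][X]}
    (hv : v ∈ bideg k B δ) {t0 θ0 : k} (ht : t0 ^ (p ^ e) = t0)
    (hθ : θ0 ^ (p ^ e) * g.eval t0 = s.evalEval t0 θ0) :
    (vhat p e δ s g v).evalEval t0 θ0 = (v.evalEval t0 θ0) ^ (p ^ e) * (g.eval t0) ^ δ := by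
  have h1 : v.evalEval t0 θ0 = ∑ b ∈ Finset.range (δ + 1), (v.coeff b).eval t0 * θ0 ^ b := by
    rw [evalEval, eval_eq_sum_range' (p := v) (n := δ + 1) (by have := bideg_natDegree hv; omega), eval_finsetSum]
    refine Finset.sum_congr rfl fun b _ => by simp
  have h2 : (v.evalEval t0 θ0) ^ (p ^ e) = ∑ b ∈ Finset.range (δ + 1), ((v.coeff b).map (iterateFrobenius k p e)).eval t0 * (θ0 ^ (p ^ e)) ^ b := by
    rw [h1, ← iterateFrobenius_def, map_sum]
    refine Finset.sum_congr rfl fun b _ => ?_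
    rw [map_mul, map_pow, iterateFrobenius_def p e θ0]
    congr 1
    conv_rhs => rw [← ht, ← iterateFrobenius_def]
    rw [eval_map, eval₂_hom]
  rw [h2, Finset.sum_mul, vhat, evalEval, eval_finsetSum, eval_finsetSum]
  refine Finset.sum_congr rfl fun b hb => ?_
  have hb' : b ≤ δ := by have := Finset.mem_range.1 hb; omega
  obtain ⟨r, rfl⟩ := Nat.exists_eq_add_of_le hb'
  simp only [eval_mul, eval_pow, eval_C, Nat.add_sub_cancel_left]
  rw [show eval t0 (eval (C θ0) s) = s.evalEval t0 θ0 from rfl, ← hθ]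
  ring

theorem stepanov (p e : ℕ) [Fact p.Prime] [CharP k p] (he : 1 ≤ e) {c δ : ℕ} (hp : stQ c δ ≤ p)
    {F : k[X][X]} (hF : F.Monic) (hFp : Prime F) (hdeg : F.natDegree = δ + 1)
    (hFb : F ∈ bideg k c (δ + 1)) {s : k[X][X]} (hs : s ∈ bideg k c c) {g : k[X]} (hg : g.natDegree ≤ c)
    (Z : Finset (k × k))
    (hZ : ∀ z ∈ Z, z.1 ^ (p ^ e) = z.1 ∧ F.evalEval z.1 z.2 = 0 ∧ (derivative F).evalEval z.1 z.2 ≠ 0 ∧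
      g.eval z.1 ≠ 0 ∧ z.2 ^ (p ^ e) * g.eval z.1 = s.evalEval z.1 z.2) :
    Z.card ≤ 3 * p ^ e := by
  classical
  rcases Z.eq_empty_or_nonempty with rfl | ⟨P1, hP1⟩
  · simp
  set q := p ^ e with hq
  set B := stB c δ with hB
  set M := stM c δ with hM
  set A := stA c δ with hA
  set E := stE c δ with hE
  have hpq : p ≤ q := by
    rw [hq]; exact Nat.le_self_pow (by omega) p
  have hqk : ((q : ℕ) : k) = 0 := by
    rw [CharP.cast_eq_zero_iff k p, hq]
    exact dvd_pow_self p (by omega)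
  have hMp : ∀ j, 0 < j → j < M → (j : k) ≠ 0 := by
    intro j hj hj2 h
    rw [CharP.cast_eq_zero_iff k p] at h
    have := Nat.le_of_dvd hj h
    have : M ≤ stQ c δ := by rw [stQ]; omega
    omega
  have hAq : (δ + 1) * (A + δ * c) < q := by
    have : (δ + 1) * (A + δ * c) < stQ c δ := by rw [stQ, ← hA]; omega
    omega
  -- local expansions
  have hloc : ∀ z : Z, ∃ i, IsLoc F z.1.1 z.1.2 i := fun z =>
    exists_isLoc hF _ _ (hZ z.1 z.2).2.1 (hZ z.1 z.2).2.2.1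
  choose ι hι using hloc
  -- elements of small degree are not divisible by F
  have hnd : ∀ {T : ℕ} {a : k[X][X]}, a ∈ bideg k T δ → a ≠ 0 → ¬ F ∣ a := by
    intro T a ha h0 h
    have := natDegree_le_of_dvd h h0
    have := bideg_natDegree ha
    omega
  set i1 := ι ⟨P1, hP1⟩ with hi1
  have hord : ∀ {T : ℕ} {a : k[X][X]}, a ∈ bideg k T δ → a ≠ 0 → ∃ o : ℕ, (i1 a).order = (o : ℕ∞) ∧
      o ≤ (δ + 1) * (T + δ * c) := by
    intro T a ha h0
    have hz := fun N (hN : PowerSeries.X ^ N ∣ i1 a) => lemmaZ hF hFp hdeg hFb (I := Unit) (t0 := fun _ => P1.1) (θ0 := fun _ => P1.2)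
      (ι := fun _ => i1) (fun _ => hι ⟨P1, hP1⟩) (fun _ _ _ => rfl) N ha (hnd ha h0) (fun _ => hN)
    have hne : i1 a ≠ 0 := by
      intro h
      have := hz ((δ + 1) * (T + δ * c) + 1) (by rw [h]; exact dvd_zero _)
      simp at this
    refine ⟨(i1 a).order.toNat, (ENat.coe_toNat (PowerSeries.order_finite_iff_ne_zero.2 hne).ne).symm, ?_⟩
    have := hz (i1 a).order.toNat PowerSeries.X_pow_order_dvd
    simpa using this
  -- the elements v_j
  obtain ⟨v, o, hoinj, hvo⟩ := exists_orders (V := bideg k B δ) (i1.toLinearMap ∘ₗ (bideg k B δ).subtype) (by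
      rw [injective_iff_map_eq_zero]
      intro a ha
      by_contra hne
      obtain ⟨o, ho, -⟩ := hord a.2 (fun h => hne (Subtype.ext h))
      have ha' : i1 a = 0 := ha
      rw [ha', PowerSeries.order_zero] at ho
      exact absurd ho (by simp)) (M + 1) (by
      rw [finrank_bideg, hM, stM, ← hB]
      nlinarith)
  have hvo' : ∀ j, (i1 (v j)).order = (o j : ℕ∞) := hvo
  -- the linear system
  have hmem : ∀ (i : Fin M) (a : Fin (M + 1) → bideg k A δ),
      (∑ j, ((DDl F) ^ (i : ℕ)) (a j : k[X][X]) * vhat p e δ s g (v j)) %ₘ F ∈ bideg k (A + B + E) δ := by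
    intro i a
    have h1 : (∑ j, ((DDl F) ^ (i : ℕ)) (a j : k[X][X]) * vhat p e δ s g (v j)) ∈
        bideg k (A + M * c + (B + δ * c)) (δ + (M * (δ + 1) + δ * c)) := by
      refine Submodule.sum_mem _ fun j _ => ?_
      have h2 := bideg_mul (DDl_bideg hFb (a j).2 i) (vhat_bideg p e hs hg (v j).2)
      have hi : (i : ℕ) ≤ M := i.2.le
      refine bideg_mono ?_ ?_ h2
      · have := Nat.mul_le_mul_right c hi; omega
      · have := Nat.mul_le_mul_right (δ + 1) hi; omega
    refine bideg_mono ?_ le_rfl (bideg_modByMonic hF hdeg hFb _ _ _ h1)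
    rw [hE, stE, ← hM]; omega
  let L : (Fin (M + 1) → bideg k A δ) →ₗ[k] (Fin M → bideg k (A + B + E) δ) :=
    { toFun := fun a i => ⟨_, hmem i a⟩
      map_add' := by
        intro a b
        ext1 i; apply Subtype.ext
        simp [add_mul, Finset.sum_add_distrib, add_modByMonic]
      map_smul' := by
        intro r a
        ext1 i; apply Subtype.ext
        simp only [Pi.smul_apply, Submodule.coe_smul, RingHom.id_apply, map_smul, smul_mul_assoc, ← Finset.smul_sum]
        rw [← algebraMap_smul k[X] r, smul_modByMonic, algebraMap_smul] }
  have hker : LinearMap.ker L ≠ ⊥ := by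
    refine LinearMap.ker_ne_bot_of_finrank_lt (K := k) (V := Fin (M + 1) → bideg k A δ)
      (V₂ := Fin M → bideg k (A + B + E) δ) (f := L) ?_
    rw [Module.finrank_pi_fintype, Module.finrank_pi_fintype]
    simp only [finrank_bideg, Finset.sum_const, Finset.card_univ, Fintype.card_fin, smul_eq_mul]
    have hA' : A = M * (B + E) := by rw [hA, stA]
    have h3 : M * (A + B + E + 1) < (M + 1) * (A + 1) := by rw [hA']; ring_nf; omega
    calc M * ((δ + 1) * (A + B + E + 1)) = (δ + 1) * (M * (A + B + E + 1)) := by ring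
      _ < (δ + 1) * ((M + 1) * (A + 1)) := by
        exact Nat.mul_lt_mul_of_pos_left h3 (by omega)
      _ = _ := by ring
  obtain ⟨a, haL, ha0⟩ := (Submodule.ne_bot_iff _).1 hker
  have haF : ∀ i < M, F ∣ ∑ j, ((DDl F) ^ i) (a j : k[X][X]) * vhat p e δ s g (v j) := by
    intro i hi
    rw [LinearMap.mem_ker] at haL
    have h1 := congrArg (fun z : bideg k (A + B + E) δ => (z : k[X][X])) (congrFun haL ⟨i, hi⟩)
    rw [← modByMonic_eq_zero_iff_dvd hF]
    exact h1
  set f : k[X][X] := ∑ j, (a j : k[X][X]) * (v j : k[X][X]) ^ q with hf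
  have hfb : f ∈ bideg k (A + q * B) (δ + q * δ) :=
    Submodule.sum_mem _ fun j _ => bideg_mul (a j).2 (bideg_pow (v j).2 q)
  have hfF : ¬ F ∣ f := by
    intro hdv
    have h0 : i1 f = 0 := by
      obtain ⟨w, hw⟩ := hdv
      rw [hw, map_mul, (hι ⟨P1, hP1⟩).hF, zero_mul]
    let S : Finset (Fin (M + 1)) := Finset.univ.filter fun j => (a j : k[X][X]) ≠ 0
    have hS : S.Nonempty := by
      by_contra hS
      rw [Finset.not_nonempty_iff_eq_empty, Finset.filter_eq_empty_iff] at hS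
      refine ha0 (funext fun j => Subtype.ext ?_)
      simpa using hS (Finset.mem_univ j)
    choose! oa hoa hoa2 using fun j (hj : (a j : k[X][X]) ≠ 0) => hord (a j).2 hj
    refine sum_ne_zero_of_orders S hS (fun j => i1 (a j) * i1 (v j) ^ q) (fun j => oa j + q * o j) ?_ ?_ ?_
    · intro i hi j hj hij
      have h1 := hoa2 i (Finset.mem_filter.1 hi).2
      have h2 := hoa2 j (Finset.mem_filter.1 hj).2
      have h3 : (oa i + q * o i) / q = (oa j + q * o j) / q := congrArg (· / q) hij
      rw [Nat.add_mul_div_left _ _ (by omega), Nat.add_mul_div_left _ _ (by omega), Nat.div_eq_of_lt (by omega),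
        Nat.div_eq_of_lt (by omega)] at h3
      exact hoinj (by omega)
    · intro j hj
      rw [PowerSeries.order_mul, PowerSeries.order_pow, hoa j (Finset.mem_filter.1 hj).2, hvo']
      push_cast
      simp
    · rw [← h0, hf, map_sum]
      simp only [map_mul, map_pow]
      refine Finset.sum_subset (Finset.filter_subset _ _) ?_
      intro j _ hj
      have : (a j : k[X][X]) = 0 := by
        by_contra h; exact hj (Finset.mem_filter.2 ⟨Finset.mem_univ _, h⟩)
      rw [this]; simp
  have hev : ∀ z : Z, PowerSeries.X ^ M ∣ ι z f := by
    intro z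
    obtain ⟨hz1, hz2, hz3, hz4, hz5⟩ := hZ z.1 z.2
    refine (hι z).dvd_of_DDl hz3 M hMp f ?_
    intro j hj
    have h1 : ((DDl F) ^ j) f = ∑ x, ((DDl F) ^ j) (a x : k[X][X]) * (v x : k[X][X]) ^ q := by
      rw [hf, map_sum]
      exact Finset.sum_congr rfl fun x _ => DDl_iter_mul_pow F _ _ hqk j
    obtain ⟨w, hw⟩ := haF j hj
    have h2 := congrArg (fun P : k[X][X] => evalEvalRingHom z.1.1 z.1.2 P) hw
    simp only [map_sum, map_mul, coe_evalEvalRingHom, vhat_eval p e (v _).2 hz1 hz5, hz2, zero_mul] at h2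
    have h3 : evalEvalRingHom z.1.1 z.1.2 (((DDl F) ^ j) f) * (g.eval z.1.1) ^ δ = 0 := by
      rw [h1]
      simp only [map_sum, map_mul, map_pow, coe_evalEvalRingHom]
      rw [← h2, Finset.sum_mul]
      exact Finset.sum_congr rfl fun x _ => by ring
    exact (mul_eq_zero.1 h3).resolve_right (pow_ne_zero _ hz4)
  have hfinal := lemmaZ hF hFp hdeg hFb hι (by
    intro i j h
    exact Subtype.ext h) M hfb hfF hev
  rw [Fintype.card_coe] at hfinal
  have hMpos : 0 < M := by rw [hM, stM, stB]; positivity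
  refine Nat.le_of_mul_le_mul_left ?_ hMpos
  refine hfinal.trans ?_
  have hMB : M = (δ + 1) * B := by rw [hM, stM]
  have hBc : δ * c ≤ B := by rw [hB, stB, mul_comm]; omega
  calc (δ + 1) * (A + q * B + (δ + q * δ) * c) = (δ + 1) * (A + δ * c) + q * ((δ + 1) * (B + δ * c)) := by ring
    _ ≤ q + q * ((δ + 1) * (B + B)) := by gcongr
    _ = q * 1 + q * (2 * M) := by rw [hMB]; ring
    _ ≤ q * M + q * (2 * M) := by gcongr; omega
    _ = M * (3 * q) := by ring

end step
end PerProp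
end ModS4

section ModA1
open Polynomial

namespace PerProp

section laurent
variable {k : Type*} [Field k]

/-- `z` has order at least `n` -/
def ordGE (n : ℤ) (z : LaurentSeries k) : Prop := ∀ i < n, z.coeff i = 0

theorem ordGE_iff {n : ℤ} {z : LaurentSeries k} : ordGE n z ↔ Valued.v z ≤ WithZero.exp (-n : ℤ) :=
  (LaurentSeries.valuation_le_iff_coeff_lt_eq_zero k).symm

theorem ordGE_zero_iff {z : LaurentSeries k} : ordGE 0 z ↔ ∃ w : PowerSeries k, HahnSeries.ofPowerSeries ℤ k w = z := by
  rw [ordGE_iff, ← LaurentSeries.val_le_one_iff_eq_coe]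
  simp

theorem ordGE.mul {n m : ℤ} {z w : LaurentSeries k} (hz : ordGE n z) (hw : ordGE m w) : ordGE (n + m) (z * w) := by
  rw [ordGE_iff] at *
  rw [map_mul, neg_add, WithZero.exp_add]
  exact mul_le_mul' hz hw

theorem ordGE.add {n : ℤ} {z w : LaurentSeries k} (hz : ordGE n z) (hw : ordGE n w) : ordGE n (z + w) := by
  intro i hi
  simp [hz i hi, hw i hi]

theorem ordGE.neg {n : ℤ} {z : LaurentSeries k} (hz : ordGE n z) : ordGE n (-z) := by
  intro i hi
  simp [hz i hi]

theorem ordGE.mono {n m : ℤ} {z : LaurentSeries k} (hz : ordGE n z) (h : m ≤ n) : ordGE m z :=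
  fun i hi => hz i (lt_of_lt_of_le hi h)

theorem exists_ordGE (z : LaurentSeries k) : ∃ n : ℕ, ordGE (-(n : ℤ)) z := by
  refine ⟨(-z.order).toNat, fun i hi => HahnSeries.coeff_eq_zero_of_lt_order ?_⟩
  omega

/-- Euler operator `s d/ds` -/
noncomputable def euler0 (z : LaurentSeries k) : LaurentSeries k where
  coeff i := (i : k) * z.coeff i
  isPWO_support' := z.isPWO_support.mono (by
    intro i hi
    simp only [Function.mem_support, HahnSeries.mem_support] at *
    exact fun h => hi (by rw [h, mul_zero]))

theorem euler0_coeff (z : LaurentSeries k) (i : ℤ) : (euler0 z).coeff i = (i : k) * z.coeff i := rfl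

theorem euler0_support (z : LaurentSeries k) : (euler0 z).support ⊆ z.support := by
  intro i hi
  simp only [HahnSeries.mem_support, euler0_coeff] at *
  exact fun h => hi (by rw [h, mul_zero])

theorem euler0_mul (z w : LaurentSeries k) : euler0 (z * w) = z * euler0 w + w * euler0 z := by
  ext i
  rw [HahnSeries.coeff_add, mul_comm w, HahnSeries.coeff_mul_left' z.isPWO_support (euler0_support z),
    HahnSeries.coeff_mul_right' w.isPWO_support (euler0_support w), euler0_coeff, HahnSeries.coeff_mul, Finset.mul_sum,
    ← Finset.sum_add_distrib]
  refine Finset.sum_congr rfl fun x hx => ?_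
  have h1 : x.1 + x.2 = i := by simp at hx; exact hx.2.2
  rw [euler0_coeff, euler0_coeff, ← h1]
  push_cast
  ring

theorem euler0_add (a b : LaurentSeries k) : euler0 (a + b) = euler0 a + euler0 b := by
  ext i
  rw [euler0_coeff, HahnSeries.coeff_add, HahnSeries.coeff_add, euler0_coeff, euler0_coeff, mul_add]

/-- Euler operator as an additive map -/
noncomputable def euler : LaurentSeries k →+ LaurentSeries k := AddMonoidHom.mk' euler0 euler0_add

theorem euler_mul (z w : LaurentSeries k) : euler (z * w) = z * euler w + w * euler z := euler0_mul z w

theorem euler_coeff (z : LaurentSeries k) (i : ℤ) : (euler z).coeff i = (i : k) * z.coeff i := rfl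

theorem euler_C (a : k) : euler (HahnSeries.C a : LaurentSeries k) = 0 := by
  ext i
  rw [euler_coeff, HahnSeries.C_apply, HahnSeries.coeff_single]
  split_ifs with h <;> simp [h]

theorem euler_pow (z : LaurentSeries k) (n : ℕ) : euler (z ^ n) = (n : LaurentSeries k) * z ^ (n - 1) * euler z := by
  induction n with
  | zero =>
    have := euler_C (1 : k)
    simp only [map_one] at this
    simp [this]
  | succ n ih =>
    rw [pow_succ, euler_mul, ih]
    cases n with
    | zero => simp
    | succ n => simp only [Nat.add_sub_cancel]; push_cast; ring

theorem euler_single (n : ℤ) (a : k) : euler (HahnSeries.single n a : LaurentSeries k) = (n : LaurentSeries k) * HahnSeries.single n a := by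
  ext i
  have : (n : LaurentSeries k) = HahnSeries.C (n : k) := by simp
  rw [euler_coeff, this, HahnSeries.C_mul_eq_smul, HahnSeries.coeff_smul, HahnSeries.coeff_single]
  split_ifs with h <;> simp [h]

theorem euler_eq_zero [CharZero k] {z : LaurentSeries k} (h : euler z = 0) : z = HahnSeries.C (z.coeff 0) := by
  ext i
  rw [HahnSeries.C_apply, HahnSeries.coeff_single]
  split_ifs with hi
  · rw [hi]
  · have h1 := congrArg (fun w => HahnSeries.coeff w i) h
    simp only [euler_coeff, HahnSeries.coeff_zero] at h1
    exact (mul_eq_zero.1 h1).resolve_left (by exact_mod_cast hi)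

theorem ordGE.euler {n : ℤ} {z : LaurentSeries k} (hz : ordGE n z) : ordGE n (euler z) := by
  intro i hi
  rw [euler_coeff, hz i hi, mul_zero]

theorem ordGE.euler_zero {z : LaurentSeries k} (hz : ordGE 0 z) : ordGE 1 (PerProp.euler z) := by
  intro i hi
  rw [euler_coeff]
  rcases lt_or_eq_of_le (show i ≤ 0 by omega) with h | h
  · rw [hz i h, mul_zero]
  · rw [h]; simp

/-- standard points of the projective line: `c + s` and `1 / s` -/
noncomputable def pt : Option k → LaurentSeries k
  | some c => HahnSeries.C c + HahnSeries.single 1 1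
  | none => HahnSeries.single (-1) 1

/-- power series version of `c + s` -/
theorem pt_some_eq (c : k) : (pt (some c) : LaurentSeries k) =
    HahnSeries.ofPowerSeries ℤ k (PowerSeries.C c + PowerSeries.X) := by
  rw [map_add, HahnSeries.ofPowerSeries_C, HahnSeries.ofPowerSeries_X]; rfl

theorem pt_none_mul : (pt none : LaurentSeries k) * HahnSeries.single 1 1 = 1 := by
  simp [pt]

theorem euler_pt_some (c : k) : euler (pt (some c)) = HahnSeries.single 1 1 := by
  rw [pt, map_add, euler_C, euler_single]; simp

theorem euler_pt_none : euler (pt none : LaurentSeries k) = - pt none := by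
  rw [pt, euler_single]; simp

/-- a polynomial at `c + s` -/
theorem eval_pt_some (c : k) (P : k[X]) : eval₂ (HahnSeries.C : k →+* LaurentSeries k) (pt (some c)) P
    = HahnSeries.ofPowerSeries ℤ k (eval₂ PowerSeries.C (PowerSeries.C c + PowerSeries.X) P) := by
  rw [hom_eval₂, pt_some_eq]
  congr 1
  ext a
  simp

theorem constantCoeff_eval_pt (c : k) (P : k[X]) :
    PowerSeries.constantCoeff (eval₂ PowerSeries.C (PowerSeries.C c + PowerSeries.X) P) = P.eval c := by
  rw [hom_eval₂, eval]
  have h1 : (PowerSeries.constantCoeff (R := k)).comp PowerSeries.C = RingHom.id k := by ext; simp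
  rw [h1]
  simp

theorem coeff_eval_pt_none (P : k[X]) : (eval₂ (HahnSeries.C : k →+* LaurentSeries k) (pt none) P).coeff (-(P.natDegree : ℤ)) = P.leadingCoeff := by
  rw [eval₂_eq_sum_range, HahnSeries.coeff_sum, Finset.sum_eq_single P.natDegree]
  · rw [pt, HahnSeries.single_pow, HahnSeries.C_mul_eq_smul, HahnSeries.coeff_smul]
    simp
  · intro i _ hi
    rw [pt, HahnSeries.single_pow, HahnSeries.C_mul_eq_smul, HahnSeries.coeff_smul, HahnSeries.coeff_single_of_ne]
    · simp
    · simp; omega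
  · intro h; simp at h

theorem eval_pt_ne_zero (c : Option k) {P : k[X]} (hP : P ≠ 0) :
    eval₂ (HahnSeries.C : k →+* LaurentSeries k) (pt c) P ≠ 0 := by
  cases c with
  | none =>
    intro h
    have := coeff_eval_pt_none P
    rw [h] at this
    exact hP (leadingCoeff_eq_zero.1 (by simpa using this.symm))
  | some c =>
    rw [eval_pt_some]
    intro h
    have h1 : eval₂ PowerSeries.C (PowerSeries.C c + PowerSeries.X) P = 0 :=
      HahnSeries.ofPowerSeries_injective (by rw [h, map_zero])
    have h2 : ∀ Q : k[X], eval₂ PowerSeries.C (PowerSeries.C c + PowerSeries.X) (Q.comp (X - C c)) = (Q : PowerSeries k) := by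
      intro Q
      rw [eval₂_comp]
      simp only [eval₂_sub, eval₂_X, eval₂_C, add_sub_cancel_left]
      exact Polynomial.eval₂_C_X_eq_coe
    have h3 : P = (P.comp (X + C c)).comp (X - C c) := by rw [comp_assoc]; simp
    rw [h3, h2] at h1
    have h4 : P.comp (X + C c) = 0 := by exact_mod_cast h1
    rw [h4] at h3
    exact hP (by simpa using h3)

end laurent
end PerProp
end ModA1

section ModA2
open Polynomial IntermediateField

namespace PerProp

section gen
variable {K Ω Λ : Type*} [Field K] [Field Ω] [Algebra K Ω] [Field Λ] [Algebra K Λ]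

/-- `x` is a generic parameter: transcendental, with `Ω` algebraic over `K(x)` -/
structure Gen (K : Type*) {Ω : Type*} [Field K] [Field Ω] [Algebra K Ω] (x : Ω) : Prop where
  tr : Transcendental K x
  alg : Algebra.IsAlgebraic K⟮x⟯ Ω

theorem exists_hom {x : Ω} (hx : Gen K x) [IsAlgClosed Λ] {y : Λ} (hy : Transcendental K y) :
    ∃ ψ : Ω →ₐ[K] Λ, ψ x = y := by
  let φ0 : K⟮x⟯ →ₐ[K] Λ := (K⟮y⟯.val.comp (RatFunc.algEquivOfTranscendental y hy).toAlgHom).comp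
    (RatFunc.algEquivOfTranscendental x hx.tr).symm.toAlgHom
  letI : Algebra K⟮x⟯ Λ := φ0.toRingHom.toAlgebra
  haveI : IsScalarTower K K⟮x⟯ Λ := IsScalarTower.of_algebraMap_eq fun a => (φ0.commutes a).symm
  haveI := hx.alg
  let ψ : Ω →ₐ[K⟮x⟯] Λ := IsAlgClosed.lift
  refine ⟨ψ.restrictScalars K, ?_⟩
  have h1 : (ψ.restrictScalars K) x = ψ (algebraMap K⟮x⟯ Ω (AdjoinSimple.gen K x)) := by
    simp
  rw [h1, AlgHom.commutes]
  change φ0 (AdjoinSimple.gen K x) = y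
  have h2 : (RatFunc.algEquivOfTranscendental x hx.tr).symm (AdjoinSimple.gen K x) = RatFunc.X := by
    rw [AlgEquiv.symm_apply_eq]
    apply Subtype.ext
    simp [RatFunc.algEquivOfTranscendental_X]
  simp [φ0, h2, RatFunc.algEquivOfTranscendental_X]

theorem exists_equiv [IsAlgClosed Ω] {x y : Ω} (hx : Gen K x) (hy : Gen K y) :
    ∃ ψ : Ω ≃ₐ[K] Ω, ψ x = y := by
  obtain ⟨ψ, hψ⟩ := exists_hom hx hy.tr
  have hle : K⟮y⟯ ≤ ψ.fieldRange := by
    rw [adjoin_simple_le_iff]; exact ⟨x, hψ⟩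
  have hsurj : Function.Surjective ψ := by
    haveI : IsAlgClosed ψ.fieldRange :=
      IsAlgClosed.of_ringEquiv Ω _ (AlgEquiv.ofInjectiveField ψ).toRingEquiv
    haveI : Algebra.IsAlgebraic ψ.fieldRange Ω := by
      letI := (inclusion hle).toRingHom.toAlgebra
      haveI : IsScalarTower K⟮y⟯ ψ.fieldRange Ω := IsScalarTower.of_algebraMap_eq fun a => rfl
      haveI := hy.alg
      exact Algebra.IsAlgebraic.tower_top (K := K⟮y⟯) ψ.fieldRange
    intro w
    haveI : Algebra.IsIntegral ψ.fieldRange Ω := Algebra.IsAlgebraic.isIntegral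
    obtain ⟨v, hv⟩ := (IsAlgClosed.algebraMap_bijective_of_isIntegral (k := ψ.fieldRange) (K := Ω)).2 w
    obtain ⟨u, hu⟩ := v.2
    exact ⟨u, by rw [← hv]; exact hu⟩
  exact ⟨AlgEquiv.ofBijective ψ ⟨ψ.injective, hsurj⟩, hψ⟩

theorem Gen.of_mem {x u : Ω} (hx : Gen K x) (h : x ∈ K⟮u⟯) : Gen K u := by
  have hle : K⟮x⟯ ≤ K⟮u⟯ := by rw [adjoin_simple_le_iff]; exact h
  refine ⟨?_, ?_⟩
  · intro hu
    have : Algebra.IsAlgebraic K K⟮u⟯ := isAlgebraic_adjoin_simple hu.isIntegral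
    have h2 := Algebra.IsAlgebraic.isAlgebraic (R := K) (⟨x, h⟩ : K⟮u⟯)
    exact hx.tr ((isAlgebraic_algebraMap_iff (algebraMap K⟮u⟯ Ω).injective).2 h2)
  · letI := (inclusion hle).toRingHom.toAlgebra
    haveI : IsScalarTower K⟮x⟯ K⟮u⟯ Ω := IsScalarTower.of_algebraMap_eq fun a => rfl
    haveI := hx.alg
    exact Algebra.IsAlgebraic.tower_top (K := K⟮x⟯) K⟮u⟯

theorem Gen.map {x : Ω} (hx : Gen K x) (η : Ω ≃ₐ[K] Ω) : Gen K (η x) := by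
  refine ⟨fun h => hx.tr ?_, ⟨fun z => ?_⟩⟩
  · exact (isAlgebraic_algHom_iff (η : Ω →ₐ[K] Ω) η.injective).1 h
  · have h1 := hx.alg.isAlgebraic (η.symm z)
    obtain ⟨P, hP0, hP⟩ := h1
    have hle : ∀ a ∈ K⟮x⟯, η a ∈ K⟮η x⟯ := by
      intro a ha
      have : K⟮x⟯ ≤ (K⟮η x⟯).comap (η : Ω →ₐ[K] Ω) := by
        rw [adjoin_simple_le_iff]
        exact mem_adjoin_simple_self K (η x)
      exact this ha
    let φ : K⟮x⟯ →+* K⟮η x⟯ := ((η : Ω →+* Ω).comp (algebraMap K⟮x⟯ Ω)).codRestrict (K⟮η x⟯).toSubring.toSubsemiring (fun a => hle a a.2)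
    refine ⟨P.map φ, ?_, ?_⟩
    · exact (Polynomial.map_ne_zero_iff φ.injective).2 hP0
    · rw [aeval_def, eval₂_map]
      have h2 : (algebraMap K⟮η x⟯ Ω).comp φ = (η : Ω →+* Ω).comp (algebraMap K⟮x⟯ Ω) := rfl
      rw [h2]
      have h3 := congrArg η hP
      rw [aeval_def, map_zero] at h3
      rw [← h3]
      change _ = (η : Ω →+* Ω) _
      rw [hom_eval₂]
      simp

/-- evaluation of a bivariate polynomial -/
noncomputable def biv (x : Ω) (f : Ω) : K[X][X] →+* Ω := eval₂RingHom (aeval x : K[X] →ₐ[K] Ω).toRingHom f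

open scoped algebraAdjoinAdjoin in
theorem exists_biv {x : Ω} (hx : Gen K x) (f : Ω) : ∃ F : K[X][X], F ≠ 0 ∧ biv x f F = 0 := by
  have h1 := hx.alg.isAlgebraic f
  have h2 : IsAlgebraic (Algebra.adjoin K {x}) f :=
    (IsFractionRing.isAlgebraic_iff (Algebra.adjoin K {x}) K⟮x⟯ Ω).2 h1
  obtain ⟨P, hP0, hP⟩ := h2
  let φ : K[X] →+* Algebra.adjoin K {x} := ((aeval x : K[X] →ₐ[K] Ω).codRestrict (Algebra.adjoin K {x})
    (fun a => by rw [Algebra.adjoin_singleton_eq_range_aeval]; exact ⟨a, rfl⟩)).toRingHom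
  have hφ : Function.Surjective φ := by
    rintro ⟨a, ha⟩
    rw [Algebra.adjoin_singleton_eq_range_aeval] at ha
    obtain ⟨b, hb⟩ := ha
    exact ⟨b, Subtype.ext hb⟩
  obtain ⟨F, rfl⟩ := Polynomial.map_surjective φ hφ P
  refine ⟨F, fun h => hP0 (by rw [h, Polynomial.map_zero]), ?_⟩
  rw [aeval_def, eval₂_map] at hP
  exact hP

theorem biv_C (x f : Ω) (a : K[X]) : biv x f (C a) = aeval x a := by
  simp [biv]

theorem exists_biv_sep [CharZero K] {x : Ω} (hx : Gen K x) (f : Ω) :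
    ∃ F : K[X][X], biv x f F = 0 ∧ biv x f (derivative F) ≠ 0 := by
  classical
  have h := exists_biv hx f
  have hex : ∃ n, ∃ F : K[X][X], F ≠ 0 ∧ biv x f F = 0 ∧ F.natDegree = n := by
    obtain ⟨F, h1, h2⟩ := h; exact ⟨_, F, h1, h2, rfl⟩
  obtain ⟨F, h1, h2, h3⟩ := Nat.find_spec hex
  refine ⟨F, h2, fun h4 => ?_⟩
  have hpos : F.natDegree ≠ 0 := by
    intro h0
    rw [eq_C_of_natDegree_eq_zero h0, biv_C] at h2
    have h5 := transcendental_iff.1 hx.tr _ h2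
    exact h1 (by rw [eq_C_of_natDegree_eq_zero h0, h5, map_zero])
  have h5 := natDegree_derivative_lt hpos
  refine Nat.find_min hex (m := (derivative F).natDegree) (by omega) ⟨_, ?_, h4, rfl⟩
  intro h6
  exact hpos (natDegree_eq_zero_of_derivative_eq_zero h6)

theorem exists_integral {x : Ω} (hx : Gen K x) (f : Ω) :
    ∃ (a : K[X]) (G : K[X][X]), a ≠ 0 ∧ G.Monic ∧ biv x (aeval x a * f) G = 0 := by
  obtain ⟨F, h1, h2⟩ := exists_biv hx f
  by_cases h0 : F.natDegree = 0
  · exfalso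
    rw [eq_C_of_natDegree_eq_zero h0, biv_C] at h2
    have h5 := transcendental_iff.1 hx.tr _ h2
    exact h1 (by rw [eq_C_of_natDegree_eq_zero h0, h5, map_zero])
  refine ⟨F.leadingCoeff, integralNormalization F, leadingCoeff_ne_zero.2 h1, monic_integralNormalization h1, ?_⟩
  have := integralNormalization_eval₂_eq_zero (p := F) (aeval x : K[X] →ₐ[K] Ω).toRingHom h2
    (fun a ha => transcendental_iff.1 hx.tr a ha)
  exact this

theorem biv_mem (E : IntermediateField K Ω) {x f : Ω} (hx : x ∈ E) (hf : f ∈ E) (F : K[X][X]) : biv x f F ∈ E := by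
  rw [biv, coe_eval₂RingHom, eval₂_eq_sum_range]
  refine sum_mem fun i _ => mul_mem ?_ (pow_mem hf i)
  change aeval x (F.coeff i) ∈ E
  rw [aeval_eq_sum_range]
  exact sum_mem fun i _ => E.smul_mem (pow_mem hx i)

end gen
end PerProp
end ModA2

section ModA3
open Polynomial IntermediateField

namespace PerProp

section simply
variable {K k Ω Λ : Type*} [Field K] [Field k] [Algebra K k] [Field Ω] [Algebra K Ω]
  [Field Λ] [Algebra K Λ]

/-- evaluation of polynomials at the place `c` -/
noncomputable def ev (K : Type*) {k : Type*} [Field K] [Field k] [Algebra K k] (c : Option k) :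
    K[X] →+* LaurentSeries k :=
  eval₂RingHom ((HahnSeries.C : k →+* LaurentSeries k).comp (algebraMap K k)) (pt c)

theorem ev_eq (c : Option k) (P : K[X]) :
    ev K c P = eval₂ (HahnSeries.C : k →+* LaurentSeries k) (pt c) (P.map (algebraMap K k)) := by
  rw [eval₂_map]; rfl

/-- evaluation of bivariate polynomials -/
noncomputable def evb (c : Option k) (z : LaurentSeries k) : K[X][X] →+* LaurentSeries k :=
  eval₂RingHom (ev K c) z

theorem ev_ne_zero (c : Option k) {P : K[X]} (hP : P ≠ 0) : ev K c P ≠ 0 := by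
  rw [ev_eq]
  exact eval_pt_ne_zero c ((Polynomial.map_ne_zero_iff (algebraMap K k).injective).2 hP)

theorem map_aeval {j : LaurentSeries k →+* Λ}
    (hj : ∀ a : K, algebraMap K Λ a = j (HahnSeries.C (algebraMap K k a)))
    {x : Ω} {c : Option k} {ψ : Ω →ₐ[K] Λ} (hψ : ψ x = j (pt c)) (P : K[X]) :
    ψ (aeval x P) = j (ev K c P) := by
  rw [← aeval_algHom_apply, hψ, ev, coe_eval₂RingHom, hom_eval₂, aeval_def]
  congr 1
  ext a; exact hj a

theorem map_biv {j : LaurentSeries k →+* Λ}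
    (hj : ∀ a : K, algebraMap K Λ a = j (HahnSeries.C (algebraMap K k a)))
    {x f : Ω} {c : Option k} {z : LaurentSeries k} {ψ : Ω →ₐ[K] Λ} (hψ : ψ x = j (pt c))
    (hf : ψ f = j z) (P : K[X][X]) :
    ψ (biv x f P) = j (evb c z P) := by
  rw [biv, coe_eval₂RingHom, evb, coe_eval₂RingHom, hom_eval₂]
  change (ψ : Ω →+* Λ) _ = _
  rw [hom_eval₂]
  congr 1
  apply RingHom.ext
  intro a
  exact map_aeval hj hψ a

theorem euler_ev (c : Option k) (P : K[X]) : euler (ev K c P) = ev K c (derivative P) * euler (pt c) := by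
  induction P using Polynomial.induction_on' with
  | add P Q hP hQ => simp only [map_add, hP, hQ, add_mul]
  | monomial n a =>
    have h : ∀ (m : ℕ) (b : K), ev K c (monomial m b) = HahnSeries.C (algebraMap K k b) * pt c ^ m := by
      intro m b; simp [ev, eval₂_monomial]
    rw [derivative_monomial, h, h, euler_mul, euler_C, euler_pow]
    simp only [map_mul, map_natCast]
    ring

theorem evb_C (c : Option k) (z : LaurentSeries k) (a : K[X]) : evb c z (C a) = ev K c a := by
  simp [evb]

theorem evb_X (c : Option k) (z : LaurentSeries k) : evb c z (X : K[X][X]) = z := by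
  simp [evb]

theorem euler_evb (c : Option k) (z : LaurentSeries k) (P : K[X][X]) :
    euler (evb c z P) = evb c z (dt P) * euler (pt c) + evb c z (derivative P) * euler z := by
  induction P using Polynomial.induction_on' with
  | add P Q hP hQ => simp only [map_add, hP, hQ]; ring
  | monomial n a =>
    rw [← C_mul_X_pow_eq_monomial, Derivation.leibniz, Derivation.leibniz_pow, dt_X, dt_C,
      derivative_C_mul_X_pow]
    simp only [map_mul, map_pow, evb_C, evb_X, euler_mul, euler_pow, euler_ev, smul_zero,
      map_add, map_zero, smul_eq_mul, map_natCast]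
    rw [mul_zero, smul_zero, map_zero (evb c z)]
    ring

theorem exists_deriv [CharZero K] {j : LaurentSeries k →+* Λ}
    (hj : ∀ a : K, algebraMap K Λ a = j (HahnSeries.C (algebraMap K k a)))
    {x : Ω} (hx : Gen K x) (E : IntermediateField K Ω) (hxE : x ∈ E) {f : Ω} (hf : f ∈ E) :
    ∃ f' ∈ E, ∀ c (ψ : Ω →ₐ[K] Λ) z, ψ x = j (pt c) → ψ f = j z →
      ∃ z', ψ f' = j z' ∧ z' * euler (pt c) = euler z := by
  obtain ⟨F, hF, hF'⟩ := exists_biv_sep hx f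
  refine ⟨-(biv x f (dt F)) / biv x f (derivative F), div_mem (neg_mem (biv_mem E hxE hf _)) (biv_mem E hxE hf _), ?_⟩
  intro c ψ z hψ hz
  have hne : evb c z (derivative F) ≠ 0 := by
    intro h
    apply hF'
    apply ψ.injective
    change ψ _ = ψ 0
    rw [map_biv hj hψ hz, h, map_zero, map_zero]
  refine ⟨-(evb c z (dt F)) / evb c z (derivative F), ?_, ?_⟩
  · rw [map_div₀, map_div₀, map_neg, map_neg, map_biv hj hψ hz, map_biv hj hψ hz]
  · have h0 : evb c z F = 0 := by
      apply j.injective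
      rw [← map_biv hj hψ hz, hF, map_zero, map_zero]
    have h1 := euler_evb c z F
    rw [h0, map_zero] at h1
    field_simp
    linear_combination (1 : LaurentSeries k) * h1

/-- order bounds -/
def bd (k : Type*) (n : ℕ) : Option k → ℤ
  | some _ => 0
  | none => 1 - n

theorem pt_tr {j : LaurentSeries k →+* Λ}
    (hj : ∀ a : K, algebraMap K Λ a = j (HahnSeries.C (algebraMap K k a))) (c : Option k) :
    Transcendental K (j (pt c)) := by
  rw [transcendental_iff]
  intro P hP
  by_contra h
  apply ev_ne_zero (K := K) c h
  apply j.injective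
  rw [map_zero, ← hP, ev, coe_eval₂RingHom, hom_eval₂, aeval_def]
  congr 1
  ext a; exact (hj a).symm

theorem exists_antideriv [CharZero K] (P : K[X]) : ∃ g : K[X], derivative g = P := by
  induction P using Polynomial.induction_on' with
  | add P Q hP hQ =>
    obtain ⟨a, rfl⟩ := hP
    obtain ⟨b, rfl⟩ := hQ
    exact ⟨a + b, by simp⟩
  | monomial n a =>
    refine ⟨monomial (n + 1) (a / (n + 1)), ?_⟩
    rw [derivative_monomial]
    have : (n : K) + 1 ≠ 0 := Nat.cast_add_one_ne_zero n
    simp [this]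

theorem ev_some (c : k) (P : K[X]) : ∃ w : PowerSeries k, ev K (some c) P = HahnSeries.ofPowerSeries ℤ k w
    ∧ PowerSeries.constantCoeff w = aeval c P := by
  refine ⟨_, by rw [ev_eq, eval_pt_some], ?_⟩
  rw [constantCoeff_eval_pt, eval_map_algebraMap]

theorem ordGE_ps (w : PowerSeries k) : ordGE 0 (HahnSeries.ofPowerSeries ℤ k w) :=
  ordGE_zero_iff.2 ⟨w, rfl⟩

theorem ordGE_one_ps (w : PowerSeries k) : ordGE 1 (HahnSeries.ofPowerSeries ℤ k w) ↔ PowerSeries.constantCoeff w = 0 := by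
  have h : (HahnSeries.ofPowerSeries ℤ k w).coeff 0 = PowerSeries.constantCoeff w := by
    have := HahnSeries.ofPowerSeries_apply_coeff (Γ := ℤ) w 0
    simpa using this
  constructor
  · intro h1
    rw [← h]; exact h1 0 (by norm_num)
  · intro h1 i hi
    rcases lt_or_eq_of_le (show i ≤ 0 by omega) with h2 | h2
    · exact ordGE_ps w i h2
    · rw [h2, h, h1]

theorem ordGE_prod_zero (s : Multiset (LaurentSeries k)) (h : ∀ z ∈ s, ordGE 0 z) : ordGE 0 s.prod := by
  induction s using Multiset.induction_on with
  | empty =>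
    rw [Multiset.prod_zero]
    have := ordGE_ps (1 : PowerSeries k)
    rwa [map_one] at this
  | cons a s ih =>
    rw [Multiset.prod_cons]
    have := (h a (by simp)).mul (ih fun z hz => h z (by simp [hz]))
    simpa using this

theorem ordGE_prod_one (s : Multiset (LaurentSeries k)) (h0 : s ≠ 0) (h : ∀ z ∈ s, ordGE 1 z) : ordGE 1 s.prod := by
  obtain ⟨a, ha⟩ := Multiset.exists_mem_of_ne_zero h0
  obtain ⟨t, rfl⟩ := Multiset.exists_cons_of_mem ha
  rw [Multiset.prod_cons]
  have := (h a (by simp)).mul (ordGE_prod_zero t fun z hz => (h z (by simp [hz])).mono (by norm_num))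
  simpa using this

end simply
end PerProp
end ModA3

section ModA4
open Polynomial IntermediateField

namespace PerProp

section simply
variable {K k Ω Λ : Type*} [Field K] [Field k] [Algebra K k] [Field Ω] [Algebra K Ω]
  [Field Λ] [Algebra K Λ]

theorem V0 [CharZero K] [IsAlgClosed k] [IsAlgClosed Ω] [IsAlgClosed Λ] {j : LaurentSeries k →+* Λ}
    (hj : ∀ a : K, algebraMap K Λ a = j (HahnSeries.C (algebraMap K k a)))
    {x : Ω} (hx : Gen K x) (E : IntermediateField K Ω)
    (hpl : ∀ c (ψ : Ω →ₐ[K] Λ), ψ x = j (pt c) → ∀ e ∈ E, ψ e ∈ j.range)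
    {f : Ω} (hf : f ∈ E)
    (hb : ∀ c (ψ : Ω →ₐ[K] Λ) z, ψ x = j (pt c) → ψ f = j z → ordGE (bd k 0 c) z) : f = 0 := by
  haveI := hx.alg
  haveI : IsAlgClosure K⟮x⟯ Ω := ⟨inferInstance, inferInstance⟩
  haveI : Normal K⟮x⟯ Ω := IsAlgClosure.normal _ _
  have hIntg : IsIntegral K⟮x⟯ f := (hx.alg.isAlgebraic f).isIntegral
  set m := (minpoly K⟮x⟯ f).map (algebraMap K⟮x⟯ Ω) with hm
  have hmm : m.Monic := (minpoly.monic hIntg).map _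
  have hroot : ∀ r ∈ m.roots, ∀ c (ψ : Ω →ₐ[K] Λ), ψ x = j (pt c) → ∃ z, ψ r = j z ∧ ordGE (bd k 0 c) z := by
    intro r hr c ψ hψ
    rw [mem_roots hmm.ne_zero, hm, IsRoot, eval_map_algebraMap] at hr
    obtain ⟨σ, hσ⟩ := minpoly.exists_algEquiv_of_root' hIntg.isAlgebraic hr
    let ψ' : Ω →ₐ[K] Λ := ψ.comp ((σ : Ω →ₐ[K⟮x⟯] Ω).restrictScalars K)
    have h1 : ψ' x = j (pt c) := by
      have : σ x = x := σ.commutes (AdjoinSimple.gen K x)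
      change ψ (σ x) = _
      rw [this, hψ]
    obtain ⟨z, hz⟩ := hpl c ψ' h1 f hf
    refine ⟨z, ?_, hb c ψ' z h1 hz.symm⟩
    rw [hz, ← hσ]; rfl
  have hprod : ∀ c (ψ : Ω →ₐ[K] Λ), ψ x = j (pt c) → ∃ z, ψ m.roots.prod = j z ∧ ordGE (bd k 0 c) z := by
    intro c ψ hψ
    choose! g hg1 hg2 using fun r hr => hroot r hr c ψ hψ
    refine ⟨(m.roots.map g).prod, ?_, ?_⟩
    · rw [map_multiset_prod, map_multiset_prod, Multiset.map_map]
      congr 1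
      exact Multiset.map_congr rfl fun r hr => hg1 r hr
    · have hall : ∀ z ∈ m.roots.map g, ordGE (bd k 0 c) z := by
        intro z hz
        obtain ⟨r, hr, rfl⟩ := Multiset.mem_map.1 hz
        exact hg2 r hr
      cases c with
      | some c => exact ordGE_prod_zero _ hall
      | none =>
        refine ordGE_prod_one _ ?_ hall
        intro h0
        have hfm : f ∈ m.roots := by
          rw [mem_roots hmm.ne_zero, hm, IsRoot, eval_map_algebraMap, minpoly.aeval]
        rw [Multiset.map_eq_zero] at h0
        rw [h0] at hfm
        exact absurd hfm (Multiset.notMem_zero f)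
  set N := (minpoly K⟮x⟯ f).coeff 0 with hN
  have hNr : (N : Ω) = (-1) ^ m.natDegree * m.roots.prod := by
    rw [← (IsAlgClosed.splits m).coeff_zero_eq_prod_roots_of_monic hmm, hm, coeff_map]; rfl
  have hNz : ∀ c (ψ : Ω →ₐ[K] Λ), ψ x = j (pt c) → ∃ z, ψ N = j z ∧ ordGE (bd k 0 c) z := by
    intro c ψ hψ
    obtain ⟨z, h1, h2⟩ := hprod c ψ hψ
    rcases neg_one_pow_eq_or Ω m.natDegree with h | h
    · exact ⟨z, by rw [hNr, h, one_mul, h1], h2⟩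
    · exact ⟨-z, by rw [hNr, h, neg_one_mul, map_neg, h1, map_neg], h2.neg⟩
  set u := (RatFunc.algEquivOfTranscendental x hx.tr).symm N with hu
  have huN : (N : Ω) = aeval x u.num / aeval x u.denom := by
    rw [← RatFunc.algEquivOfTranscendental_apply x hx.tr, hu, AlgEquiv.apply_symm_apply]
  have hden : aeval x u.denom ≠ 0 := fun h => u.denom_ne_zero (transcendental_iff.1 hx.tr _ h)
  have huN' : (N : Ω) * aeval x u.denom = aeval x u.num := by
    rw [huN, div_mul_cancel₀ _ hden]
  have key : ∀ c, ∃ z, ordGE (bd k 0 c) z ∧ z * ev K c u.denom = ev K c u.num := by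
    intro c
    obtain ⟨ψ, hψ⟩ := exists_hom hx (pt_tr hj c)
    obtain ⟨z, h1, h2⟩ := hNz c ψ hψ
    refine ⟨z, h2, j.injective ?_⟩
    rw [map_mul, ← h1, ← map_aeval hj hψ, ← map_aeval hj hψ, ← map_mul, huN']
  have hd1 : u.denom = 1 := by
    have hmon := RatFunc.monic_denom u
    by_contra hne
    have hdeg : ((u.denom).map (algebraMap K k)).degree ≠ 0 := by
      rw [degree_map]
      intro h0
      exact hne (eq_one_of_monic_natDegree_zero hmon (natDegree_eq_of_degree_eq_some h0))
    obtain ⟨c, hc⟩ := IsAlgClosed.exists_root _ hdeg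
    rw [IsRoot, eval_map_algebraMap] at hc
    obtain ⟨z, h1, h2⟩ := key (some c)
    obtain ⟨w1, h3, h4⟩ := ev_some c u.denom
    obtain ⟨w2, h5, h6⟩ := ev_some c u.num
    have h7 : ordGE 1 (ev K (some c) u.num) := by
      rw [← h2]
      have : ordGE 1 (ev K (some c) u.denom) := by rw [h3, ordGE_one_ps, h4, hc]
      have h8 := h1.mul this
      simpa [bd] using h8
    rw [h5, ordGE_one_ps, h6] at h7
    obtain ⟨a, b, hab⟩ := RatFunc.isCoprime_num_denom u
    have := congrArg (aeval c) hab
    simp [h7, hc] at this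
  have hnum : u.num = 0 := by
    obtain ⟨z, h1, h2⟩ := key none
    rw [hd1, map_one, mul_one] at h2
    rw [h2] at h1
    have h3 := coeff_eval_pt_none (u.num.map (algebraMap K k))
    rw [← ev_eq, h1 _ (by simp [bd]; omega)] at h3
    exact (Polynomial.map_eq_zero (algebraMap K k)).1 (leadingCoeff_eq_zero.1 h3.symm)
  have hN0 : N = 0 := by
    apply Subtype.ext
    rw [huN, hnum]; simp
  exact (minpoly.coeff_zero_eq_zero hIntg).1 hN0

theorem Vn [CharZero K] [IsAlgClosed k] [Algebra.IsAlgebraic K k] [IsAlgClosed Ω] [IsAlgClosed Λ] {j : LaurentSeries k →+* Λ}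
    (hj : ∀ a : K, algebraMap K Λ a = j (HahnSeries.C (algebraMap K k a)))
    {x : Ω} (hx : Gen K x) (E : IntermediateField K Ω) (hxE : x ∈ E)
    (hconst : ∀ e ∈ E, IsAlgebraic K e → e ∈ (⊥ : IntermediateField K Ω))
    (hpl : ∀ c (ψ : Ω →ₐ[K] Λ), ψ x = j (pt c) → ∀ e ∈ E, ψ e ∈ j.range) (n : ℕ) :
    ∀ f ∈ E, (∀ c (ψ : Ω →ₐ[K] Λ) z, ψ x = j (pt c) → ψ f = j z → ordGE (bd k n c) z) →
      ∃ P : K[X], f = aeval x P := by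
  haveI : CharZero k := charZero_of_injective_algebraMap (algebraMap K k).injective
  induction n with
  | zero =>
    intro f hf hb
    exact ⟨0, by rw [V0 hj hx E hpl hf hb, map_zero]⟩
  | succ n ih =>
    intro f hf hb
    obtain ⟨f', hf', hd⟩ := exists_deriv hj hx E hxE hf
    obtain ⟨P, hP⟩ := ih f' hf' (by
      intro c ψ z' hψ hz'
      obtain ⟨z, hz⟩ := hpl c ψ hψ f hf
      obtain ⟨z'', h1, h2⟩ := hd c ψ z hψ hz.symm
      have : z'' = z' := j.injective (by rw [← h1, hz'])
      subst this
      have hz1 := hb c ψ z hψ hz.symm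
      cases c with
      | some c =>
        have h3 : ordGE 1 (euler z) := ordGE.euler_zero hz1
        rw [← h2, euler_pt_some] at h3
        intro i hi
        have h4 := h3 (i + 1) (by simp [bd] at hi; omega)
        rw [add_comm] at h4
        rwa [mul_comm, add_comm, HahnSeries.coeff_single_mul_add, one_mul] at h4
      | none =>
        have h3 : ordGE (-n) (euler z) := by
          have := ordGE.euler hz1
          simpa [bd] using this
        have h4 : z'' = - (HahnSeries.single 1 1 * euler z) := by
          rw [← h2, euler_pt_none]
          linear_combination (-z'') * pt_none_mul (k := k)
        have h5 : ordGE 1 (HahnSeries.single 1 1 : LaurentSeries k) := by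
          intro i hi
          rw [HahnSeries.coeff_single_of_ne (by omega)]
        rw [h4]
        have := (h5.mul h3).neg
        simpa [bd, sub_eq_add_neg] using this)
    obtain ⟨g, hg⟩ := exists_antideriv P
    obtain ⟨ψ, hψ⟩ := exists_hom hx (pt_tr hj none)
    obtain ⟨z, hz⟩ := hpl none ψ hψ f hf
    obtain ⟨z', h1, h2⟩ := hd none ψ z hψ hz.symm
    have h3 : z' = ev K none P := j.injective (by rw [← h1, hP, map_aeval hj hψ])
    have h4 : euler (z - ev K none g) = 0 := by
      rw [map_sub, euler_ev, hg, ← h2, h3, sub_self]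
    have h5 := euler_eq_zero h4
    set a := (z - ev K none g).coeff 0
    have h6 : ψ (f - aeval x g) = j (HahnSeries.C a) := by
      rw [map_sub, ← hz, map_aeval hj hψ, ← map_sub, h5]
    have h7 : IsAlgebraic K (ψ (f - aeval x g)) := by
      rw [h6]
      obtain ⟨Q, hQ0, hQ⟩ := Algebra.IsAlgebraic.isAlgebraic (R := K) a
      refine ⟨Q, hQ0, ?_⟩
      have h8 := congrArg (j.comp HahnSeries.C) hQ
      rw [aeval_def, hom_eval₂, map_zero] at h8
      rw [aeval_def, ← h8]
      have : algebraMap K Λ = (j.comp HahnSeries.C).comp (algebraMap K k) := by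
        ext a; exact hj a
      rw [this]; rfl
    have h8 : IsAlgebraic K (f - aeval x g) := (isAlgebraic_algHom_iff ψ ψ.injective).1 h7
    have hgE : aeval x g ∈ E := by
      have := biv_mem E hxE hxE (C g)
      rwa [biv_C] at this
    obtain ⟨b, hb⟩ := IntermediateField.mem_bot.1 (hconst _ (sub_mem hf hgE) h8)
    refine ⟨g + C b, ?_⟩
    rw [map_add, aeval_C, hb]; ring

theorem simply_connected [CharZero K] [IsAlgClosed k] [Algebra.IsAlgebraic K k] [IsAlgClosed Ω] [IsAlgClosed Λ] {j : LaurentSeries k →+* Λ}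
    (hj : ∀ a : K, algebraMap K Λ a = j (HahnSeries.C (algebraMap K k a)))
    {x : Ω} (hx : Gen K x) (E : IntermediateField K Ω) (hxE : x ∈ E)
    (hconst : ∀ e ∈ E, IsAlgebraic K e → e ∈ (⊥ : IntermediateField K Ω))
    (hpl : ∀ c (ψ : Ω →ₐ[K] Λ), ψ x = j (pt c) → ∀ e ∈ E, ψ e ∈ j.range) : E ≤ K⟮x⟯ := by
  classical
  intro e he
  obtain ⟨a, G, ha, hG, haG⟩ := exists_integral hx e
  have haE : ∀ g : K[X], aeval x g ∈ E := by
    intro g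
    have := biv_mem E hxE hxE (C g)
    rwa [biv_C] at this
  have hax : ∀ g : K[X], aeval x g ∈ K⟮x⟯ := by
    intro g
    have := biv_mem K⟮x⟯ (mem_adjoin_simple_self K x) (mem_adjoin_simple_self K x) (C g)
    rwa [biv_C] at this
  have hroots : ∀ c (ψ : Ω →ₐ[K] Λ) z, ψ x = j (pt c) → ψ (aeval x a * e) = j z → evb c z G = 0 := by
    intro c ψ z hψ hz
    apply j.injective
    rw [← map_biv hj hψ hz, haG, map_zero, map_zero]
  obtain ⟨n, hn⟩ : ∃ n : ℕ, ∀ z ∈ (G.map (ev K (none : Option k))).roots.toFinset, ordGE (-(n:ℤ)) z := by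
    choose g hg using fun z : LaurentSeries k => exists_ordGE z
    refine ⟨(G.map (ev K (none : Option k))).roots.toFinset.sup g, fun z hz => (hg z).mono ?_⟩
    have := Finset.le_sup (f := g) hz
    simp only [neg_le_neg_iff]
    exact_mod_cast this
  obtain ⟨P, hP⟩ := Vn hj hx E hxE hconst hpl (n + 1) (aeval x a * e) (mul_mem (haE a) he) (by
    intro c ψ z hψ hz
    have h1 := hroots c ψ z hψ hz
    cases c with
    | none =>
      have := hn z (by
        rw [Multiset.mem_toFinset, mem_roots (hG.map _).ne_zero, IsRoot, eval_map]
        exact h1)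
      simpa [bd] using this
    | some c =>
      have hi : IsIntegral (PowerSeries k) z := by
        choose w hw1 hw2 using fun P : K[X] => ev_some c P
        let φ : K[X] →+* PowerSeries k := eval₂RingHom (PowerSeries.C.comp (algebraMap K k)) (PowerSeries.C c + PowerSeries.X)
        have hφ : (HahnSeries.ofPowerSeries ℤ k).comp φ = ev K (some c) := by
          apply RingHom.ext
          intro P
          rw [ev_eq, eval_pt_some, eval₂_map]; rfl
        refine ⟨G.map φ, hG.map _, ?_⟩
        rw [eval₂_map]
        have : (algebraMap (PowerSeries k) (LaurentSeries k)).comp φ = ev K (some c) := by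
          rw [← hφ]; rfl
        rw [this]; exact h1
      obtain ⟨w, hw⟩ := IsIntegrallyClosed.isIntegral_iff.1 hi
      exact ordGE_zero_iff.2 ⟨w, hw⟩)
  have ha0 : aeval x a ≠ 0 := fun h => ha (transcendental_iff.1 hx.tr _ h)
  have : e = aeval x P / aeval x a := by
    rw [← hP]; field_simp
  rw [this]
  exact div_mem (hax _) (hax _)

end simply
end PerProp
end ModA4

section ModH1
open Polynomial

namespace PerProp

theorem hensel_nonmonic {R : Type*} [CommRing R] (I : Ideal R) [IsAdicComplete I R] (f : R[X]) (a₀ : R)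
    (h₁ : f.eval a₀ ∈ I) (h₂ : IsUnit (Ideal.Quotient.mk I ((derivative f).eval a₀))) :
    ∃ a, f.IsRoot a ∧ a - a₀ ∈ I := by
    classical
      let f' := derivative f
      let c : ℕ → R := fun n => Nat.recOn n a₀ fun _ b => b - f.eval b * Ring.inverse (f'.eval b)
      have hc : ∀ n, c (n + 1) = c n - f.eval (c n) * Ring.inverse (f'.eval (c n)) := by
        intro n
        simp only [c]
      have hc_mod : ∀ n, c n ≡ a₀ [SMOD I] := by
        intro n
        induction n with
        | zero => rfl
        | succ n ih => ?_
        rw [hc, sub_eq_add_neg, ← add_zero a₀]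
        refine ih.add ?_
        rw [SModEq.zero, Ideal.neg_mem_iff]
        refine I.mul_mem_right _ ?_
        rw [← SModEq.zero] at h₁ ⊢
        exact (ih.eval f).trans h₁
      have hf'c : ∀ n, IsUnit (f'.eval (c n)) := by
        intro n
        have := isLocalHom_of_le_jacobson_bot I (IsAdicComplete.le_jacobson_bot I)
        apply IsUnit.of_map (Ideal.Quotient.mk I)
        convert! h₂ using 1
        exact SModEq.def.mp ((hc_mod n).eval _)
      have hfcI : ∀ n, f.eval (c n) ∈ I ^ (n + 1) := by
        intro n
        induction n with
        | zero => simpa only [Nat.rec_zero, zero_add, pow_one] using! h₁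
        | succ n ih => ?_
        rw [← taylor_eval_sub (c n), hc, sub_eq_add_neg, sub_eq_add_neg,
          add_neg_cancel_comm]
        rw [eval_eq_sum, sum_over_range' _ _ _ (lt_add_of_pos_right _ zero_lt_two), ←
          Finset.sum_range_add_sum_Ico _ (Nat.le_add_left _ _)]
        swap
        · intro i
          rw [zero_mul]
        refine Ideal.add_mem _ ?_ ?_
        · rw [← one_add_one_eq_two, Finset.sum_range_succ, Finset.range_one, Finset.sum_singleton,
            taylor_coeff_zero, taylor_coeff_one, pow_zero, pow_one, mul_one, mul_neg,
            mul_left_comm, Ring.mul_inverse_cancel _ (hf'c n), mul_one, add_neg_cancel]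
          exact Ideal.zero_mem _
        · refine Submodule.sum_mem _ ?_
          simp only [Finset.mem_Ico]
          rintro i ⟨h2i, _⟩
          have aux : n + 2 ≤ i * (n + 1) := by trans 2 * (n + 1) <;> nlinarith only [h2i]
          refine Ideal.mul_mem_left _ _ (Ideal.pow_le_pow_right aux ?_)
          rw [pow_mul']
          exact Ideal.pow_mem_pow ((Ideal.neg_mem_iff _).2 <| Ideal.mul_mem_right _ _ ih) _
      have aux : ∀ m n, m ≤ n → c m ≡ c n [SMOD (I ^ m • ⊤ : Ideal R)] := by
        intro m n hmn
        rw [← Ideal.one_eq_top, Ideal.smul_eq_mul, mul_one]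
        obtain ⟨k, rfl⟩ := Nat.exists_eq_add_of_le hmn
        clear hmn
        induction k with
        | zero => rw [add_zero]
        | succ k ih => ?_
        rw [← add_assoc, hc, ← add_zero (c m), sub_eq_add_neg]
        refine ih.add ?_
        symm
        rw [SModEq.zero, Ideal.neg_mem_iff]
        refine Ideal.mul_mem_right _ _ (Ideal.pow_le_pow_right ?_ (hfcI _))
        rw [add_assoc]
        exact le_self_add
      obtain ⟨a, ha⟩ := IsPrecomplete.prec' c (aux _ _)
      refine ⟨a, ?_, ?_⟩
      · show f.IsRoot a
        suffices ∀ n, f.eval a ≡ 0 [SMOD (I ^ n • ⊤ : Ideal R)] by exact IsHausdorff.haus' _ this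
        intro n
        specialize ha n
        rw [← Ideal.one_eq_top, Ideal.smul_eq_mul, mul_one] at ha ⊢
        refine (ha.symm.eval f).trans ?_
        rw [SModEq.zero]
        exact Ideal.pow_le_pow_right le_self_add (hfcI _)
      · show a - a₀ ∈ I
        specialize ha (0 + 1)
        rw [hc, pow_one, ← Ideal.one_eq_top, Ideal.smul_eq_mul, mul_one, sub_eq_add_neg] at ha
        rw [← SModEq.sub_mem, ← add_zero a₀]
        refine ha.symm.trans (SModEq.rfl.add ?_)
        rw [SModEq.zero, Ideal.neg_mem_iff]
        exact Ideal.mul_mem_right _ _ h₁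

section proj
variable {k : Type*} [Field k]

open Classical in
/-- the point `[a:b]` of the projective line -/
noncomputable def prj (a b : k) : Option k := if b = 0 then none else some (a / b)

theorem prj_eq {a b a' b' : k} (h : a ≠ 0 ∨ b ≠ 0) (h' : a' ≠ 0 ∨ b' ≠ 0) :
    prj a b = prj a' b' ↔ a * b' = a' * b := by
  unfold prj
  by_cases hb : b = 0
  · by_cases hb' : b' = 0
    · simp [hb, hb']
    · have : a ≠ 0 := by tauto
      simp [hb, hb', this]
  · by_cases hb' : b' = 0
    · have : a' ≠ 0 := by tauto
      simp [hb, hb', this]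
    · simp only [hb, hb', if_false, Option.some.injEq]
      rw [div_eq_div_iff hb hb']

theorem homEval2_smul {R : Type*} [CommRing R] (p : R[X]) (d : ℕ) (l a b : R) :
    homEval2 p d (l * a) (l * b) = l ^ d * homEval2 p d a b := by
  unfold homEval2
  rw [Finset.mul_sum]
  refine Finset.sum_congr rfl fun i hi => ?_
  have : d = i + (d - i) := by simp at hi; omega
  rw [mul_pow, mul_pow]
  conv_rhs => rw [this]
  rw [pow_add, ← this]; ring

theorem homEval2_one {R : Type*} [CommRing R] {p : R[X]} {d : ℕ} (hp : p.natDegree ≤ d) (a : R) :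
    homEval2 p d a 1 = p.eval a := by
  unfold homEval2
  rw [eval_eq_sum_range' (Nat.lt_succ_of_le hp)]
  simp

theorem homEval2_zero {R : Type*} [CommRing R] {p : R[X]} {d : ℕ} :
    homEval2 p d 1 0 = p.coeff d := by
  unfold homEval2
  rw [Finset.sum_range_succ, Finset.sum_eq_zero]
  · simp
  · intro i hi
    rw [zero_pow (by simp at hi; omega), mul_zero]

theorem homEval2_map {R S : Type*} [CommRing R] [CommRing S] (φ : R →+* S) (p : R[X]) (d : ℕ) (a b : R) :
    homEval2 (p.map φ) d (φ a) (φ b) = φ (homEval2 p d a b) := by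
  unfold homEval2
  rw [map_sum]
  simp

/-- no common zeros -/
def NoZ (p q : k[X]) (d : ℕ) : Prop := ∀ a b : k, (a ≠ 0 ∨ b ≠ 0) →
  (homEval2 p d a b ≠ 0 ∨ homEval2 q d a b ≠ 0)

/-- the induced map of the projective line -/
noncomputable def phih (p q : k[X]) (d : ℕ) : Option k → Option k
  | some c => prj (homEval2 p d c 1) (homEval2 q d c 1)
  | none => prj (homEval2 p d 1 0) (homEval2 q d 1 0)

theorem prj_zero (a : k) : prj a 0 = none := by simp [prj]
theorem prj_ne {a b : k} (hb : b ≠ 0) : prj a b = some (a / b) := by simp [prj, hb]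

theorem prj_smul {l : k} (hl : l ≠ 0) (a b : k) : prj (l * a) (l * b) = prj a b := by
  by_cases hb : b = 0
  · simp [hb, prj_zero]
  · rw [prj_ne hb, prj_ne (mul_ne_zero hl hb), mul_div_mul_left _ _ hl]

theorem phih_prj (p q : k[X]) (d : ℕ) {a b : k} (h : a ≠ 0 ∨ b ≠ 0) :
    phih p q d (prj a b) = prj (homEval2 p d a b) (homEval2 q d a b) := by
  by_cases hb : b = 0
  · subst hb
    have ha : a ≠ 0 := by tauto
    rw [prj_zero, phih]
    have h1 : ∀ r : k[X], homEval2 r d a 0 = a ^ d * homEval2 r d 1 0 := by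
      intro r; rw [← homEval2_smul, mul_one, mul_zero]
    rw [h1, h1, prj_smul (pow_ne_zero _ ha)]
  · rw [prj_ne hb, phih]
    have h1 : ∀ r : k[X], homEval2 r d a b = b ^ d * homEval2 r d (a / b) 1 := by
      intro r; rw [← homEval2_smul, mul_one, mul_div_cancel₀ _ hb]
    rw [h1, h1, prj_smul (pow_ne_zero _ hb)]

/-- the data of a good rational function -/
structure RatData (p q : k[X]) (d : ℕ) : Prop where
  hd : 2 ≤ d
  cop : IsCoprime p q
  hp : p.natDegree ≤ d
  hq : q.natDegree ≤ d
  top : p.coeff d ≠ 0 ∨ q.coeff d ≠ 0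
  hW : (derivative p * q - p * derivative q).degree = ((2 * d - 2 : ℕ) : WithBot ℕ)

variable {p q : k[X]} {d : ℕ}

theorem RatData.noZ (h : RatData p q d) : NoZ p q d := by
  intro a b hab
  by_contra hcon
  simp only [not_or, not_not] at hcon
  by_cases hb : b = 0
  · subst hb
    have ha : a ≠ 0 := by tauto
    have h1 : ∀ r : k[X], homEval2 r d a 0 = a ^ d * r.coeff d := by
      intro r; rw [← homEval2_zero, ← homEval2_smul, mul_one, mul_zero]
    rw [h1, h1] at hcon
    have := pow_ne_zero d ha
    have h2 := h.top
    simp only [mul_eq_zero, this, false_or] at hcon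
    tauto
  · have h1 : ∀ r : k[X], r.natDegree ≤ d → homEval2 r d a b = b ^ d * r.eval (a / b) := by
      intro r hr; rw [← homEval2_one hr, ← homEval2_smul, mul_one, mul_div_cancel₀ _ hb]
    rw [h1 p h.hp, h1 q h.hq] at hcon
    have := pow_ne_zero d hb
    simp only [mul_eq_zero, this, false_or] at hcon
    obtain ⟨u, v, huv⟩ := h.cop
    have := congrArg (eval (a / b)) huv
    simp [hcon.1, hcon.2] at this

theorem RatData.degree_pencil (h : RatData p q d) {b0 b1 : k} (hb : b0 ≠ 0 ∨ b1 ≠ 0) :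
    d - 1 ≤ (C b1 * p - C b0 * q).natDegree := by
  by_contra hlt
  push Not at hlt
  set g := C b1 * p - C b0 * q with hg
  have hd := h.hd
  have key : ∀ r : k[X], r.natDegree ≤ d → (derivative g * r - g * derivative r).degree < ((2 * d - 2 : ℕ) : WithBot ℕ) := by
    intro r hr
    refine lt_of_le_of_lt degree_le_natDegree ?_
    norm_cast
    have h1 : (derivative g * r).natDegree ≤ 2 * d - 3 := by
      by_cases hg0 : derivative g = 0
      · simp [hg0]
      · refine natDegree_mul_le.trans ?_
        have := natDegree_derivative_lt (p := g) (fun h0 => hg0 (derivative_of_natDegree_zero h0))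
        omega
    have h2 : (g * derivative r).natDegree ≤ 2 * d - 3 := by
      refine natDegree_mul_le.trans ?_
      have := natDegree_derivative_le r
      omega
    have := natDegree_sub_le_of_le h1 h2
    simp only [max_self] at this
    omega
  rcases hb with hb | hb
  · have h1 := key p h.hp
    have h2 : derivative g * p - g * derivative p = C b0 * (derivative p * q - p * derivative q) := by
      rw [hg]; simp only [derivative_sub, derivative_mul, derivative_C]; ring
    rw [h2, degree_C_mul hb, h.hW] at h1
    exact lt_irrefl _ h1
  · have h1 := key q h.hq
    have h2 : derivative g * q - g * derivative q = C b1 * (derivative p * q - p * derivative q) := by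
      rw [hg]; simp only [derivative_sub, derivative_mul, derivative_C]; ring
    rw [h2, degree_C_mul hb, h.hW] at h1
    exact lt_irrefl _ h1

open Classical in
/-- reduction of a Laurent series -/
noncomputable def red (z : LaurentSeries k) : Option k := if ordGE 0 z then some (z.coeff 0) else none

theorem coeff_ps (w : PowerSeries k) : (HahnSeries.ofPowerSeries ℤ k w).coeff 0 = PowerSeries.constantCoeff w := by
  have := HahnSeries.ofPowerSeries_apply_coeff (Γ := ℤ) w 0
  simpa using this

theorem red_ps (w : PowerSeries k) : red (HahnSeries.ofPowerSeries ℤ k w) = some (PowerSeries.constantCoeff w) := by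
  rw [red, if_pos (ordGE_zero_iff.2 ⟨w, rfl⟩), coeff_ps]

theorem red_pt (c : Option k) : red (pt c) = c := by
  cases c with
  | some c => rw [pt_some_eq, red_ps]; simp
  | none =>
    rw [red, if_neg]
    intro h
    have := h (-1) (by norm_num)
    simp [pt] at this

theorem exists_inv_ps {z : LaurentSeries k} (hz : ¬ ordGE 0 z) : ∃ y : PowerSeries k, y ≠ 0 ∧
    PowerSeries.constantCoeff y = 0 ∧ z * HahnSeries.ofPowerSeries ℤ k y = 1 := by
  have hz0 : z ≠ 0 := by rintro rfl; exact hz fun i _ => rfl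
  rw [ordGE_iff] at hz
  push Not at hz
  have h1 : Valued.v z⁻¹ ≤ WithZero.exp (-0 : ℤ) := by
    rw [map_inv₀]
    simp only [neg_zero, WithZero.exp_zero] at *
    exact (inv_le_one₀ (lt_trans zero_lt_one hz)).2 hz.le
  obtain ⟨y, hy⟩ := ordGE_zero_iff.1 (ordGE_iff.2 h1)
  refine ⟨y, ?_, ?_, ?_⟩
  · rintro rfl
    rw [map_zero] at hy
    exact inv_ne_zero hz0 hy.symm
  · by_contra hne
    have hu : IsUnit y := PowerSeries.isUnit_iff_constantCoeff.2 (isUnit_iff_ne_zero.2 hne)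
    obtain ⟨v, hv⟩ := hu.exists_right_inv
    have h2 : HahnSeries.ofPowerSeries ℤ k v = z := by
      have := congrArg (HahnSeries.ofPowerSeries ℤ k) hv
      rw [map_mul, hy, map_one] at this
      field_simp at this
      exact this
    have h3 : ordGE 0 z := ordGE_zero_iff.2 ⟨v, h2⟩
    exact absurd (ordGE_iff.1 h3) (not_le.2 hz)
  · rw [hy, mul_inv_cancel₀ hz0]

theorem exists_rep (z : LaurentSeries k) : ∃ z0 z1 : PowerSeries k, z1 ≠ 0 ∧
    z * HahnSeries.ofPowerSeries ℤ k z1 = HahnSeries.ofPowerSeries ℤ k z0 ∧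
    (PowerSeries.constantCoeff z0 ≠ 0 ∨ PowerSeries.constantCoeff z1 ≠ 0) ∧
    red z = prj (PowerSeries.constantCoeff z0) (PowerSeries.constantCoeff z1) := by
  by_cases h : ordGE 0 z
  · obtain ⟨w, rfl⟩ := ordGE_zero_iff.1 h
    refine ⟨w, 1, one_ne_zero, by simp, by simp, ?_⟩
    rw [red_ps]; simp [prj]
  · obtain ⟨y, h1, h2, h3⟩ := exists_inv_ps h
    refine ⟨1, y, h1, by rw [h3, map_one], by simp, ?_⟩
    rw [red, if_neg h, h2, prj_zero]

end proj
end PerProp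
end ModH1

section ModH2
open Polynomial

namespace PerProp
section H
variable {k : Type*} [Field k] {p q : k[X]} {d : ℕ}

local notation "ps" => HahnSeries.ofPowerSeries ℤ k
local notation "cc" => PowerSeries.constantCoeff (R := k)

/-- `p(w) = z q(w)` -/
def Rel (p q : k[X]) (w z : LaurentSeries k) : Prop :=
  eval₂ (HahnSeries.C : k →+* LaurentSeries k) w p = z * eval₂ (HahnSeries.C : k →+* LaurentSeries k) w q

theorem homEval2_ps {r : k[X]} (hr : r.natDegree ≤ d) {w : LaurentSeries k} {a b : PowerSeries k}
    (hb : b ≠ 0) (hw : w * ps b = ps a) :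
    ps (homEval2 (r.map PowerSeries.C) d a b) = ps b ^ d * eval₂ (HahnSeries.C : k →+* LaurentSeries k) w r := by
  rw [← homEval2_map, map_map]
  have h1 : (ps).comp (PowerSeries.C (R := k)) = HahnSeries.C := by
    ext x; simp
  rw [h1, ← hw, mul_comm w, ← mul_one (ps b), mul_assoc, one_mul, homEval2_smul, mul_one,
    homEval2_one (natDegree_map_le.trans hr), eval_map]

theorem phih_red (h : RatData p q d) {w z : LaurentSeries k} (hr : Rel p q w z) :
    phih p q d (red w) = red z := by
  obtain ⟨a, b, hb, hab, hab0, hredw⟩ := exists_rep w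
  obtain ⟨z0, z1, hz1, hz, hz0, hredz⟩ := exists_rep z
  have h1 := homEval2_ps h.hp hb hab
  have h2 := homEval2_ps h.hq hb hab
  have h3 : z1 * homEval2 (p.map PowerSeries.C) d a b = z0 * homEval2 (q.map PowerSeries.C) d a b := by
    apply HahnSeries.ofPowerSeries_injective (Γ := ℤ)
    rw [map_mul, map_mul, h1, h2, hr, ← hz]; ring
  have hm : ∀ r : k[X], cc (homEval2 (r.map PowerSeries.C) d a b) = homEval2 r d (cc a) (cc b) := by
    intro r
    rw [← homEval2_map, map_map]
    congr 1
    have : (cc).comp PowerSeries.C = RingHom.id k := by ext; simp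
    rw [this, map_id]
  have h4 := congrArg cc h3
  rw [map_mul, map_mul, hm, hm] at h4
  rw [hredw, hredz, phih_prj p q d hab0, prj_eq (h.noZ _ _ hab0) hz0, mul_comm, h4]

/-- the critical values avoid `b` -/
def NonCrit (p q : k[X]) (d : ℕ) (b : Option k) : Prop :=
  ∀ α : k, (derivative p * q - p * derivative q).eval α = 0 → phih p q d (some α) ≠ b

theorem simple_root (h : RatData p q d) {b0 b1 : k} (hb : b0 ≠ 0 ∨ b1 ≠ 0) (hnc : NonCrit p q d (prj b0 b1))
    {α : k} (hα : (C b1 * p - C b0 * q).eval α = 0) : (derivative (C b1 * p - C b0 * q)).eval α ≠ 0 := by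
  intro h0
  simp only [eval_sub, eval_mul, eval_C, derivative_sub, derivative_mul, derivative_C, zero_mul, zero_add] at hα h0
  refine hnc α ?_ ?_
  · simp only [eval_sub, eval_mul]
    rcases hb with hb | hb
    · apply mul_left_cancel₀ hb
      rw [mul_zero]
      linear_combination (-eval α (derivative p)) * hα + eval α p * h0
    · apply mul_left_cancel₀ hb
      rw [mul_zero]
      linear_combination (-eval α (derivative q)) * hα + eval α q * h0
  · have := h.noZ α 1 (by simp)
    rw [phih, prj_eq this hb, homEval2_one h.hp, homEval2_one h.hq]
    linear_combination hα

theorem root_unique (f : (PowerSeries k)[X]) {a b : PowerSeries k} (ha : f.eval a = 0) (hb : f.eval b = 0)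
    (hab : cc a = cc b) (hf : cc ((derivative f).eval a) ≠ 0) : a = b := by
  obtain ⟨c, hc⟩ := f.binomExpansion a (b - a)
  rw [add_sub_cancel, ha, hb, zero_add] at hc
  have h1 : (b - a) * ((derivative f).eval a + c * (b - a)) = 0 := by rw [hc]; ring
  rcases mul_eq_zero.1 h1 with h | h
  · exact (sub_eq_zero.1 h).symm
  · exfalso
    apply hf
    have := congrArg cc h
    simpa [hab] using this

theorem hensel_ps (f : (PowerSeries k)[X]) {α : k} (h1 : (f.map cc).eval α = 0)
    (h2 : (derivative (f.map cc)).eval α ≠ 0) : ∃ a, f.eval a = 0 ∧ cc a = α := by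
  have hev : ∀ r : (PowerSeries k)[X], cc (r.eval (PowerSeries.C α)) = (r.map cc).eval α := by
    intro r
    rw [eval_map, eval, hom_eval₂]; simp
  obtain ⟨a, ha, hd⟩ := hensel_nonmonic (Ideal.span {(PowerSeries.X : PowerSeries k)}) f (PowerSeries.C α)
    (by rw [Ideal.mem_span_singleton, PowerSeries.X_dvd_iff, hev, h1])
    (by
      apply IsUnit.map
      rw [PowerSeries.isUnit_iff_constantCoeff, hev, ← derivative_map]
      exact isUnit_iff_ne_zero.2 h2)
  refine ⟨a, ha, ?_⟩
  rw [Ideal.mem_span_singleton, PowerSeries.X_dvd_iff, map_sub, sub_eq_zero] at hd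
  rw [hd]; simp

variable [IsAlgClosed k]

/-- all solutions are Laurent series -/
theorem splits_of_nonCrit (h : RatData p q d) {z : LaurentSeries k} (hnc : NonCrit p q d (red z)) :
    (p.map (HahnSeries.C : k →+* LaurentSeries k) - C z * q.map HahnSeries.C).Splits ∧
    p.map (HahnSeries.C : k →+* LaurentSeries k) - C z * q.map HahnSeries.C ≠ 0 := by
  classical
  obtain ⟨z0, z1, hz1, hz, hz0, hredz⟩ := exists_rep z
  rw [hredz] at hnc
  set f : (PowerSeries k)[X] := C z1 * p.map PowerSeries.C - C z0 * q.map PowerSeries.C with hf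
  have hcomp : (ps).comp (PowerSeries.C (R := k)) = HahnSeries.C := by
    ext x; simp
  have hfm : f.map ps = C (ps z1) * (p.map (HahnSeries.C : k →+* LaurentSeries k) - C z * q.map HahnSeries.C) := by
    rw [hf, Polynomial.map_sub, Polynomial.map_mul, Polynomial.map_mul, map_C, map_C, map_map, map_map, hcomp, ← hz,
      C_mul]
    ring
  have hz1' : ps z1 ≠ 0 := fun h0 => hz1 (HahnSeries.ofPowerSeries_injective (Γ := ℤ) (by rw [h0, map_zero]))
  have hcc : (cc).comp (PowerSeries.C (R := k)) = RingHom.id k := by ext; simp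
  have hfb : f.map cc = C (cc z1) * p - C (cc z0) * q := by
    rw [hf, Polynomial.map_sub, Polynomial.map_mul, Polynomial.map_mul, map_C, map_C, map_map, map_map, hcc, map_id, map_id]
  have hdegb := h.degree_pencil hz0
  rw [← hfb] at hdegb
  have hfb0 : f.map cc ≠ 0 := by
    intro h0
    rw [h0] at hdegb
    have := h.hd
    simp at hdegb
    omega
  have hf0 : f ≠ 0 := by rintro h0; rw [h0] at hfb0; simp at hfb0
  have hsimple : ∀ α, (f.map cc).eval α = 0 → (derivative (f.map cc)).eval α ≠ 0 := by
    intro α hα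
    rw [hfb] at hα ⊢
    exact simple_root h hz0 hnc hα
  choose! w hw1 hw2 using fun α (hα : (f.map cc).eval α = 0) => hensel_ps f hα (hsimple α hα)
  set S := (f.map cc).roots.toFinset with hS
  have hSr : ∀ α ∈ S, (f.map cc).eval α = 0 := by
    intro α hα
    rw [hS, Multiset.mem_toFinset, mem_roots hfb0] at hα
    exact hα
  have hcard : S.card = (f.map cc).natDegree := by
    rw [hS, Multiset.toFinset_card_of_nodup, (IsAlgClosed.splits (f.map cc)).natDegree_eq_card_roots]
    apply nodup_roots
    have hsep : ∀ α, (f.map cc).IsRoot α → ¬ (derivative (f.map cc)).IsRoot α := fun α h1 => hsimple α h1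
    rw [Separable, isCoprime_iff_aeval_ne_zero_of_isAlgClosed k k]
    intro a
    by_cases ha : (f.map cc).eval a = 0
    · right; simpa using hsimple a ha
    · left; simpa using ha
  have hfm0 : f.map ps ≠ 0 := (Polynomial.map_ne_zero_iff (HahnSeries.ofPowerSeries_injective (Γ := ℤ))).2 hf0
  have hdvd : ∏ α ∈ S, (X - C (ps (w α))) ∣ f.map ps := by
    refine Finset.prod_dvd_of_coprime ?_ ?_
    · intro α hα β hβ hne
      apply isCoprime_X_sub_C_of_isUnit_sub
      rw [isUnit_iff_ne_zero, sub_ne_zero]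
      intro h0
      have := HahnSeries.ofPowerSeries_injective (Γ := ℤ) h0
      apply hne
      rw [← hw2 α (hSr α hα), this, hw2 β (hSr β hβ)]
    · intro α hα
      rw [dvd_iff_isRoot, IsRoot, eval_map, eval₂_at_apply, hw1 α (hSr α hα), map_zero]
  obtain ⟨r, hr⟩ := hdvd
  have hr0 : r ≠ 0 := by rintro rfl; rw [mul_zero] at hr; exact hfm0 hr
  have hfd : (f.map ps).natDegree ≤ d := by
    refine natDegree_map_le.trans ?_
    rw [hf]
    refine (natDegree_sub_le_of_le (natDegree_C_mul_le _ _ |>.trans (natDegree_map_le.trans h.hp))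
      (natDegree_C_mul_le _ _ |>.trans (natDegree_map_le.trans h.hq))).trans ?_
    simp
  have hr1 : r.natDegree ≤ 1 := by
    have h1 := congrArg natDegree hr
    rw [natDegree_mul (Finset.prod_ne_zero_iff.2 fun α _ => X_sub_C_ne_zero _) hr0, natDegree_finsetProd_X_sub_C_eq_card, hcard] at h1
    omega
  have hsp : (f.map ps).Splits := by
    rw [hr]
    exact (Splits.prod fun α _ => Splits.X_sub_C _).mul (Splits.of_natDegree_le_one hr1)
  rw [hfm] at hsp hfm0
  refine ⟨?_, right_ne_zero_of_mul hfm0⟩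
  exact hsp.of_dvd hfm0 (dvd_mul_left _ _)

theorem mem_range_of_nonCrit (h : RatData p q d) {z : LaurentSeries k} (hnc : NonCrit p q d (red z))
    {Λ : Type*} [Field Λ] (j : LaurentSeries k →+* Λ) {w : Λ}
    (hw : eval₂ (j.comp HahnSeries.C) w p = j z * eval₂ (j.comp HahnSeries.C) w q) :
    ∃ w0, w = j w0 ∧ Rel p q w0 z := by
  obtain ⟨h1, h2⟩ := splits_of_nonCrit h hnc
  have h3 : ((p.map (HahnSeries.C : k →+* LaurentSeries k) - C z * q.map HahnSeries.C).map j).IsRoot w := by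
    rw [IsRoot, Polynomial.map_sub, Polynomial.map_mul, map_C, map_map, map_map, eval_sub, eval_mul, eval_C, eval_map, eval_map, hw, sub_self]
  obtain ⟨w0, rfl⟩ := h1.mem_range_of_isRoot h2 h3
  refine ⟨w0, rfl, ?_⟩
  apply j.injective
  rw [map_mul, hom_eval₂, hom_eval₂]
  exact hw

theorem red_injective (h : RatData p q d) {z w w' : LaurentSeries k} (hnc : NonCrit p q d (red z))
    (hw : Rel p q w z) (hw' : Rel p q w' z) (hred : red w = red w') : w = w' := by
  obtain ⟨z0, z1, hz1, hz, hz0, hredz⟩ := exists_rep z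
  have hph := phih_red h hw
  rw [hredz] at hnc hph
  set f : (PowerSeries k)[X] := C z1 * p.map PowerSeries.C - C z0 * q.map PowerSeries.C with hf
  have hcomp : (ps).comp (PowerSeries.C (R := k)) = HahnSeries.C := by
    ext x; simp
  have hcc : (cc).comp (PowerSeries.C (R := k)) = RingHom.id k := by ext; simp
  have hfb : f.map cc = C (cc z1) * p - C (cc z0) * q := by
    rw [hf, Polynomial.map_sub, Polynomial.map_mul, Polynomial.map_mul, map_C, map_C, map_map, map_map, hcc, map_id, map_id]
  have hroot : ∀ w, Rel p q w z → eval₂ ps w f = 0 := by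
    intro w hw
    rw [hf, eval₂_sub, eval₂_mul, eval₂_mul, eval₂_C, eval₂_C, eval₂_map, eval₂_map, hcomp, hw, ← hz]; ring
  have hfd : f.natDegree ≤ d := by
    rw [hf]
    refine (natDegree_sub_le_of_le (natDegree_C_mul_le _ _ |>.trans (natDegree_map_le.trans h.hp))
      (natDegree_C_mul_le _ _ |>.trans (natDegree_map_le.trans h.hq))).trans ?_
    simp
  by_cases ho : ordGE 0 w
  · have ho' : ordGE 0 w' := by
      by_contra hc
      rw [red, red, if_pos ho, if_neg hc] at hred
      simp at hred
    obtain ⟨a, rfl⟩ := ordGE_zero_iff.1 ho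
    obtain ⟨a', rfl⟩ := ordGE_zero_iff.1 ho'
    have hev : ∀ a, Rel p q (ps a) z → f.eval a = 0 := by
      intro a ha
      apply HahnSeries.ofPowerSeries_injective (Γ := ℤ)
      rw [map_zero, ← hroot _ ha, eval, hom_eval₂]; simp
    rw [red_ps, red_ps, Option.some.injEq] at hred
    congr 1
    have hev2 : ∀ (r : (PowerSeries k)[X]) a, cc (r.eval a) = (r.map cc).eval (cc a) := by
      intro r a
      rw [eval_map, eval, hom_eval₂]; simp
    refine root_unique f (hev a hw) (hev a' hw') hred ?_
    rw [hev2, ← derivative_map, hfb]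
    apply simple_root h hz0 hnc
    rw [← hfb, ← hev2, hev a hw, map_zero]
  · have ho' : ¬ ordGE 0 w' := by
      intro hc
      rw [red, red, if_neg ho, if_pos hc] at hred
      simp at hred
    have hn : red w = none := by rw [red, if_neg ho]
    rw [hn, phih, homEval2_zero, homEval2_zero, prj_eq h.top hz0] at hph
    obtain ⟨y, hy0, hyc, hy⟩ := exists_inv_ps ho
    obtain ⟨y', hy0', hyc', hy'⟩ := exists_inv_ps ho'
    have hev : ∀ w y, Rel p q w z → w * ps y = 1 → (reflect d f).eval y = 0 := by
      intro w y hw hy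
      have hw0 : w ≠ 0 := left_ne_zero_of_mul (hy.trans_ne one_ne_zero)
      letI : Invertible w := ⟨ps y, by rw [mul_comm, hy], hy⟩
      have h1 := (eval₂_reflect_eq_zero_iff ps w d f hfd).2 (hroot w hw)
      apply HahnSeries.ofPowerSeries_injective (Γ := ℤ)
      rw [map_zero, ← h1]
      exact (eval₂_at_apply ps y).symm
    have hyy : y = y' := by
      refine root_unique (reflect d f) (hev w y hw hy) (hev w' y' hw' hy') (by rw [hyc, hyc']) ?_
      have h1 : cc ((derivative (reflect d f)).eval y) = cc (f.coeff (d - 1)) := by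
        rw [← eval₂_at_apply, hyc, ← eval_map, ← coeff_zero_eq_eval_zero, coeff_map, coeff_derivative,
          coeff_reflect, revAt_le (by have := h.hd; omega)]
        simp
      rw [h1]
      have h2 : (f.map cc).coeff d = 0 := by
        rw [hfb, coeff_sub, coeff_C_mul, coeff_C_mul]
        linear_combination hph
      have h3 := h.degree_pencil hz0
      rw [← hfb] at h3
      rw [← coeff_map]
      have h4 : (f.map cc).natDegree = d - 1 := by
        refine le_antisymm ?_ h3
        have h5 : (f.map cc).natDegree ≤ d := natDegree_map_le.trans hfd
        by_contra h6
        have h7 : (f.map cc).natDegree = d := by omega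
        have h8 : f.map cc = 0 := by
          rw [← leadingCoeff_eq_zero, leadingCoeff, h7, h2]
        rw [h8] at h7
        have := h.hd
        simp at h7
        omega
      rw [← h4]
      intro h5
      have h8 : f.map cc = 0 := by
          rw [← leadingCoeff_eq_zero, leadingCoeff, h5]
      rw [h8] at h4
      have := h.hd
      simp at h4
      omega
    rw [← hyy] at hy'
    have hy1 : ps y ≠ 0 := right_ne_zero_of_mul (hy.trans_ne one_ne_zero)
    exact mul_right_cancel₀ hy1 (hy.trans hy'.symm)

end H
end PerProp
end ModH2

section ModI1
open Polynomial IntermediateField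

namespace PerProp
section I
variable {K Ω : Type*} [Field K] [Field Ω] [Algebra K Ω]

theorem galois_of_alg [CharZero K] [IsAlgClosed Ω] {x : Ω} (hx : Gen K x) (B : Set Ω) :
    IsGalois (adjoin K⟮x⟯ B) Ω := by
  haveI := hx.alg
  haveI : Algebra.IsAlgebraic (adjoin K⟮x⟯ B) Ω := Algebra.IsAlgebraic.tower_top (K := K⟮x⟯) _
  haveI : IsAlgClosure (adjoin K⟮x⟯ B) Ω := ⟨inferInstance, inferInstance⟩
  haveI : CharZero (adjoin K⟮x⟯ B) := charZero_of_injective_algebraMap (algebraMap K _).injective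
  haveI : Normal (adjoin K⟮x⟯ B) Ω := IsAlgClosure.normal _ _
  exact ⟨⟩

theorem mem_adjoin_adjoin {x z : Ω} {B : Set Ω} :
    z ∈ adjoin K⟮x⟯ B ↔ z ∈ adjoin K (insert x B) := by
  have := adjoin_adjoin_left K {x} B
  rw [Set.singleton_union] at this
  rw [← this]; rfl

theorem mem_adjoin_of_fixed [CharZero K] [IsAlgClosed Ω] {x : Ω} (hx : Gen K x) (B : Set Ω) {z : Ω}
    (h : ∀ τ : Ω ≃ₐ[K] Ω, τ x = x → (∀ b ∈ B, τ b = b) → τ z = z) : z ∈ adjoin K (insert x B) := by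
  haveI := galois_of_alg hx B
  rw [← mem_adjoin_adjoin]
  have h1 : z ∈ Set.range (algebraMap (adjoin K⟮x⟯ B) Ω) := by
    rw [InfiniteGalois.mem_range_algebraMap_iff_fixed]
    intro f
    have := h ((f.restrictScalars K⟮x⟯).restrictScalars K) ?_ ?_
    · exact this
    · exact f.commutes ⟨x, mem_adjoin_adjoin.2 (subset_adjoin _ _ (Set.mem_insert _ _))⟩
    · intro b hb
      exact f.commutes ⟨b, subset_adjoin _ _ hb⟩
  obtain ⟨y, rfl⟩ := h1
  exact y.2

theorem fixed_of_mem_adjoin {B : Set Ω} {z : Ω} (hz : z ∈ adjoin K B) (τ : Ω ≃ₐ[K] Ω) (h : ∀ b ∈ B, τ b = b) :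
    τ z = z := by
  induction hz using adjoin_induction with
  | mem b hb => exact h b hb
  | algebraMap a => simp
  | add a b _ _ ha hb => simp [ha, hb]
  | inv a _ ha => simp [ha]
  | mul a b _ _ ha hb => simp [ha, hb]

theorem galois_lift [CharZero K] [IsAlgClosed Ω] {x : Ω} (hx : Gen K x) (S B : Set Ω) (hS : S.Finite)
    (hst : ∀ τ : Ω ≃ₐ[K] Ω, τ x = x → ∀ s ∈ S, τ s ∈ S)
    (hinf : adjoin K (insert x S) ⊓ adjoin K (insert x B) ≤ K⟮x⟯)
    (σ : Ω ≃ₐ[K] Ω) (hσ : σ x = x) :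
    ∃ τ : Ω ≃ₐ[K] Ω, τ x = x ∧ (∀ b ∈ B, τ b = b) ∧ ∀ s ∈ S, τ s = σ s := by
  haveI := galois_of_alg hx B
  haveI : IsGalois K⟮x⟯ Ω := by
    haveI := hx.alg
    haveI : IsAlgClosure K⟮x⟯ Ω := ⟨inferInstance, inferInstance⟩
    haveI : CharZero K⟮x⟯ := charZero_of_injective_algebraMap (algebraMap K _).injective
    haveI : Normal K⟮x⟯ Ω := IsAlgClosure.normal _ _
    exact ⟨⟩
  have hfix : ∀ f : Ω ≃ₐ[K⟮x⟯] Ω, f x = x := fun f => f.commutes (AdjoinSimple.gen K x)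
  let N : IntermediateField K⟮x⟯ Ω := adjoin K⟮x⟯ S
  let L : IntermediateField K⟮x⟯ Ω := adjoin K⟮x⟯ B
  haveI : Finite S := hS
  haveI : FiniteDimensional K⟮x⟯ N := finiteDimensional_adjoin fun s _ => Algebra.IsIntegral.isIntegral s
  haveI : Normal K⟮x⟯ N := by
    rw [normal_iff_forall_map_le']
    intro f
    change (adjoin K⟮x⟯ S).map _ ≤ adjoin K⟮x⟯ S
    rw [adjoin_map]
    apply adjoin.mono
    rintro _ ⟨s, hs, rfl⟩
    exact hst (f.restrictScalars K) (hfix f) s hs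
  have hNL : N ⊓ L = ⊥ := by
    rw [eq_bot_iff]
    rintro z ⟨h1, h2⟩
    have := hinf ⟨mem_adjoin_adjoin.1 h1, mem_adjoin_adjoin.1 h2⟩
    exact ⟨⟨z, this⟩, rfl⟩
  have hsurj : Function.Surjective (restrictRestrictAlgEquivMapHom K⟮x⟯ N L Ω) := by
    suffices fixedField (restrictRestrictAlgEquivMapHom K⟮x⟯ N L Ω).range = ⊥ from
      MonoidHom.range_eq_top.mp <|
        fixingSubgroup_fixedField (restrictRestrictAlgEquivMapHom K⟮x⟯ N L Ω).range ▸
          this ▸ fixingSubgroup_bot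
    refine eq_bot_iff.mpr fun ⟨y, hx₁⟩ hx₂ ↦ ?_
    obtain ⟨⟨y, hy⟩, rfl⟩ : y ∈ Set.range (algebraMap L Ω) := by
      refine (InfiniteGalois.mem_range_algebraMap_iff_fixed _).mpr fun φ ↦ ?_
      rw [← restrictRestrictAlgEquivMapHom_apply N L φ ⟨y, hx₁⟩]
      rw [mem_fixedField_iff] at hx₂
      exact congr_arg ((↑) : N → Ω) <| hx₂ (restrictRestrictAlgEquivMapHom K⟮x⟯ N L Ω φ) ⟨φ, rfl⟩
    obtain ⟨z, rfl⟩ : y ∈ (⊥ : IntermediateField K⟮x⟯ Ω) := hNL ▸ mem_inf.mpr ⟨hx₁, hy⟩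
    exact mem_bot.mp ⟨z, rfl⟩
  let σ' : Ω ≃ₐ[K⟮x⟯] Ω := AlgEquiv.ofRingEquiv (f := σ.toRingEquiv) (by
    rintro ⟨a, ha⟩
    exact fixed_of_mem_adjoin ha σ (by simp [hσ]))
  obtain ⟨τ, hτ⟩ := hsurj (AlgEquiv.restrictNormalHom N σ')
  have hτ2 : ∀ b ∈ L, τ b = b := fun b hb => τ.commutes ⟨b, hb⟩
  refine ⟨(τ.restrictScalars K⟮x⟯).restrictScalars K, hτ2 x (mem_adjoin_adjoin.2 (subset_adjoin _ _ (Set.mem_insert _ _))),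
    fun b hb => hτ2 b (subset_adjoin _ _ hb), fun s hs => ?_⟩
  have hs' : s ∈ N := subset_adjoin _ _ hs
  have h1 := restrictRestrictAlgEquivMapHom_apply N L τ ⟨s, hs'⟩
  rw [hτ, AlgEquiv.restrictNormalHom_apply] at h1
  exact h1.symm

end I
end PerProp
end ModI1

section ModI2
open Polynomial IntermediateField

namespace PerProp
section I
variable {K Ω : Type*} [Field K] [Field Ω] [Algebra K Ω] {p q : K[X]} {d : ℕ}

theorem RatData.map {k : Type*} [Field k] [Algebra K k] (h : RatData p q d) :
    RatData (p.map (algebraMap K k)) (q.map (algebraMap K k)) d where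
  hd := h.hd
  cop := h.cop.map (mapRingHom (algebraMap K k))
  hp := natDegree_map_le.trans h.hp
  hq := natDegree_map_le.trans h.hq
  top := by simpa using h.top
  hW := by
    rw [derivative_map, derivative_map, ← Polynomial.map_mul, ← Polynomial.map_mul, ← Polynomial.map_sub,
      degree_map, h.hW]

/-- the rational map on a field extension -/
noncomputable def fm (p q : K[X]) (u : Ω) : Ω := aeval u p / aeval u q

/-- iterated preimages -/
def TT (p q : K[X]) (n : ℕ) (x : Ω) : Set Ω := {u | (fm p q)^[n] u = x}

theorem fm_iff (h : RatData p q d) {x : Ω} (hx : Transcendental K x) {u : Ω} :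
    fm p q u = x ↔ aeval u p = x * aeval u q := by
  unfold fm
  by_cases h0 : aeval u q = 0
  · rw [h0, div_zero, mul_zero]
    constructor
    · rintro rfl
      exact absurd (isAlgebraic_zero) hx
    · intro h1
      obtain ⟨a, b, hab⟩ := h.cop
      have := congrArg (aeval u) hab
      simp [h0, h1] at this
  · rw [div_eq_iff h0]

theorem fm_mem (u : Ω) : fm p q u ∈ K⟮u⟯ := by
  have hu : u ∈ K⟮u⟯ := mem_adjoin_simple_self K u
  have h1 : ∀ r : K[X], aeval u r ∈ K⟮u⟯ := fun r => by
    have := (aeval (⟨u, hu⟩ : K⟮u⟯) r).2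
    have h2 : ((aeval (⟨u, hu⟩ : K⟮u⟯) r : K⟮u⟯) : Ω) = aeval u r := by
      rw [← IntermediateField.coe_val, ← aeval_algHom_apply]; rfl
    rwa [h2] at this
  exact div_mem (h1 p) (h1 q)

theorem fm_iter_mem (n : ℕ) (u : Ω) : (fm p q)^[n] u ∈ K⟮u⟯ := by
  induction n with
  | zero => exact mem_adjoin_simple_self K u
  | succ n ih =>
    rw [Function.iterate_succ_apply']
    exact (adjoin_simple_le_iff.2 ih) (fm_mem _)

theorem Gen.pre {x u : Ω} (hx : Gen K x) {n : ℕ} (hu : u ∈ TT p q n x) : Gen K u := by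
  apply hx.of_mem
  have := fm_iter_mem (p := p) (q := q) n u
  rwa [show (fm p q)^[n] u = x from hu] at this

theorem fm_map {Λ : Type*} [Field Λ] [Algebra K Λ] (σ : Ω →ₐ[K] Λ) (u : Ω) : fm p q (σ u) = σ (fm p q u) := by
  unfold fm
  rw [map_div₀, aeval_algHom_apply, aeval_algHom_apply]

theorem fm_iter_map (σ : Ω ≃ₐ[K] Ω) (n : ℕ) (u : Ω) : (fm p q)^[n] (σ u) = σ ((fm p q)^[n] u) := by
  have : Function.Semiconj σ (fm p q) (fm p q) := fun u => (fm_map σ.toAlgHom u).symm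
  exact ((this.iterate_right n) u).symm

theorem TT_map (σ : Ω ≃ₐ[K] Ω) {n : ℕ} {x u : Ω} (hu : u ∈ TT p q n x) : σ u ∈ TT p q n (σ x) := by
  change (fm p q)^[n] (σ u) = σ x
  rw [fm_iter_map, show (fm p q)^[n] u = x from hu]

theorem pencil_ne (h : RatData p q d) {x : Ω} (hx : Transcendental K x) :
    algebraMap K Ω (p.coeff d) - x * algebraMap K Ω (q.coeff d) ≠ 0 := by
  intro h0
  by_cases hq : q.coeff d = 0
  · rw [hq] at h0
    simp only [map_zero, mul_zero, sub_zero, map_eq_zero] at h0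
    have := h.top; tauto
  · apply hx
    have : x = algebraMap K Ω (p.coeff d / q.coeff d) := by
      rw [map_div₀, eq_div_iff (by simpa using hq)]; linear_combination -h0
    rw [this]; exact isAlgebraic_algebraMap _

/-- the polynomial `p - x q` -/
noncomputable def pen (p q : K[X]) (x : Ω) : Polynomial Ω := p.map (algebraMap K Ω) - C x * q.map (algebraMap K Ω)

theorem pen_natDegree (h : RatData p q d) {x : Ω} (hx : Transcendental K x) : (pen p q x).natDegree = d := by
  apply natDegree_eq_of_le_of_coeff_ne_zero
  · unfold pen
    refine (natDegree_sub_le_of_le (natDegree_map_le.trans h.hp)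
      ((natDegree_C_mul_le _ _).trans (natDegree_map_le.trans h.hq))).trans (by simp)
  · simpa [pen] using pencil_ne h hx

theorem pen_eval (x u : Ω) : (pen p q x).eval u = aeval u p - x * aeval u q := by
  simp [pen, aeval_def, eval_map]

theorem pen_ne (h : RatData p q d) {x : Ω} (hx : Transcendental K x) : pen p q x ≠ 0 := by
  intro h0
  have := pen_natDegree h hx
  rw [h0, natDegree_zero] at this
  have := h.hd; omega

theorem mem_TT_one (h : RatData p q d) {x : Ω} (hx : Transcendental K x) {u : Ω} :
    u ∈ TT p q 1 x ↔ (pen p q x).IsRoot u := by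
  rw [IsRoot, pen_eval, sub_eq_zero, ← fm_iff h hx]; rfl

theorem TT_succ (n : ℕ) (x : Ω) : TT p q (n + 1) x = ⋃ y ∈ TT p q 1 x, TT p q n y := by
  ext u
  simp only [TT, Set.mem_setOf_eq, Function.iterate_succ_apply', Function.iterate_zero, id, Set.mem_iUnion, exists_prop,
    exists_eq_right']

theorem TT_finite (h : RatData p q d) (n : ℕ) {x : Ω} (hx : Gen K x) : (TT p q n x).Finite := by
  induction n generalizing x with
  | zero => exact Set.finite_singleton x |>.subset (fun u hu => hu)
  | succ n ih =>
    classical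
    rw [TT_succ]
    have h1 : (TT p q 1 x).Finite := by
      refine ((pen p q x).roots.toFinset.finite_toSet).subset fun u hu => ?_
      simp only [Finset.mem_coe, Multiset.mem_toFinset]
      exact (mem_roots (pen_ne h hx.tr)).2 ((mem_TT_one h hx.tr).1 hu)
    exact h1.biUnion fun y hy => ih (hx.pre hy)

theorem pen_simple (h : RatData p q d) {x : Ω} (hx : Gen K x) {u : Ω} (hu : (pen p q x).IsRoot u) :
    (derivative (pen p q x)).eval u ≠ 0 := by
  intro h0
  have hug := hx.pre ((mem_TT_one h hx.tr).2 hu)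
  rw [IsRoot, pen_eval] at hu
  have h0' : aeval u (derivative p) - x * aeval u (derivative q) = 0 := by
    rw [← h0]; simp [pen, aeval_def, eval_map, derivative_map]
  apply hug.tr
  refine ⟨derivative p * q - p * derivative q, ?_, ?_⟩
  · intro h1
    have := h.hW
    rw [h1, degree_zero] at this
    exact absurd this.symm (WithBot.natCast_ne_bot _)
  · simp only [map_sub, map_mul]
    linear_combination aeval u q * h0' - aeval u (derivative q) * hu

theorem TT_one_ncard [IsAlgClosed Ω] (h : RatData p q d) {x : Ω} (hx : Gen K x) : (TT p q 1 x).ncard = d := by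
  classical
  have h1 : TT p q 1 x = ((pen p q x).roots.toFinset : Set Ω) := by
    ext u
    simp only [Finset.mem_coe, Multiset.mem_toFinset, mem_roots (pen_ne h hx.tr), mem_TT_one h hx.tr]
  have hnd : (pen p q x).roots.Nodup := by
    rw [Multiset.nodup_iff_count_le_one]
    intro u
    rw [count_roots]
    by_contra hcon
    push Not at hcon
    have := (one_lt_rootMultiplicity_iff_isRoot (pen_ne h hx.tr)).1 hcon
    exact pen_simple h hx this.1 this.2
  rw [h1, Set.ncard_coe_finset, Multiset.toFinset_card_of_nodup hnd, ← pen_natDegree h hx.tr]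
  exact (splits_iff_card_roots.1 (IsAlgClosed.splits _))

theorem TT_nonempty [IsAlgClosed Ω] (h : RatData p q d) (n : ℕ) {x : Ω} (hx : Gen K x) : (TT p q n x).Nonempty := by
  induction n generalizing x with
  | zero => exact ⟨x, rfl⟩
  | succ n ih =>
    have h1 : (TT p q 1 x).Nonempty := by
      apply Set.nonempty_of_ncard_ne_zero
      rw [TT_one_ncard h hx]; have := h.hd; omega
    obtain ⟨y, hy⟩ := h1
    obtain ⟨u, hu⟩ := ih (hx.pre hy)
    refine ⟨u, ?_⟩
    rw [TT_succ]
    simp only [Set.mem_iUnion]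
    exact ⟨y, hy, hu⟩

theorem TT_trans [IsAlgClosed Ω] {n : ℕ} {x u u' : Ω} (hx : Gen K x) (hu : u ∈ TT p q n x) (hu' : u' ∈ TT p q n x) :
    ∃ σ : Ω ≃ₐ[K] Ω, σ x = x ∧ σ u = u' := by
  obtain ⟨σ, hσ⟩ := exists_equiv (hx.pre hu) (hx.pre hu')
  refine ⟨σ, ?_, hσ⟩
  have := TT_map (p := p) (q := q) σ hu
  rw [hσ] at this
  change (fm p q)^[n] u' = σ x at this
  rw [← this]; exact hu'

variable {k Λ : Type*} [Field k] [Algebra K k] [Field Λ] [Algebra K Λ]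

theorem adjoin_mem_range {j : LaurentSeries k →+* Λ}
    (hj : ∀ a : K, algebraMap K Λ a = j (HahnSeries.C (algebraMap K k a))) (ψ : Ω →ₐ[K] Λ) {S : Set Ω}
    (hS : ∀ b ∈ S, ψ b ∈ j.range) {e : Ω} (he : e ∈ adjoin K S) : ψ e ∈ j.range := by
  induction he using adjoin_induction with
  | mem b hb => exact hS b hb
  | algebraMap a => rw [AlgHom.commutes, hj]; exact ⟨_, rfl⟩
  | add a b _ _ ha hb => rw [map_add]; exact add_mem ha hb
  | inv a _ ha =>
    obtain ⟨w, hw⟩ := ha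
    exact ⟨w⁻¹, by rw [map_inv₀, map_inv₀, hw]⟩
  | mul a b _ _ ha hb => rw [map_mul]; exact mul_mem ha hb

theorem const_mem_range [IsAlgClosed k] {j : LaurentSeries k →+* Λ}
    (hj : ∀ a : K, algebraMap K Λ a = j (HahnSeries.C (algebraMap K k a))) {e : Λ} (he : IsAlgebraic K e) :
    e ∈ j.range := by
  have hjc : algebraMap K Λ = (j.comp HahnSeries.C).comp (algebraMap K k) := by
    ext a; exact hj a
  have h1 : (((minpoly K e).map (algebraMap K k)).map (j.comp HahnSeries.C)).IsRoot e := by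
    rw [Polynomial.map_map, ← hjc, IsRoot, eval_map, ← aeval_def, minpoly.aeval]
  have h0 : (minpoly K e).map (algebraMap K k) ≠ 0 := (Polynomial.map_ne_zero (minpoly.ne_zero he.isIntegral))
  obtain ⟨w0, rfl⟩ := (IsAlgClosed.splits _).mem_range_of_isRoot h0 h1
  exact ⟨_, rfl⟩

theorem aeval_j {j : LaurentSeries k →+* Λ}
    (hj : ∀ a : K, algebraMap K Λ a = j (HahnSeries.C (algebraMap K k a))) (w : Λ) (r : K[X]) :
    eval₂ (j.comp HahnSeries.C) w (r.map (algebraMap K k)) = aeval w r := by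
  rw [eval₂_map, aeval_def]
  congr 1
  ext a; exact (hj a).symm

theorem Hn_one [IsAlgClosed k] (h : RatData p q d) {j : LaurentSeries k →+* Λ}
    (hj : ∀ a : K, algebraMap K Λ a = j (HahnSeries.C (algebraMap K k a))) (ψ : Ω →ₐ[K] Λ) {x y : Ω} (hx : Gen K x)
    {z : LaurentSeries k} (hz : ψ x = j z)
    (hnc : NonCrit (p.map (algebraMap K k)) (q.map (algebraMap K k)) d (red z)) (hy : fm p q y = x) :
    ∃ w, ψ y = j w ∧ Rel (p.map (algebraMap K k)) (q.map (algebraMap K k)) w z := by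
  apply mem_range_of_nonCrit h.map hnc
  rw [aeval_j hj, aeval_j hj, aeval_algHom_apply, aeval_algHom_apply, ← hz, ← map_mul, (fm_iff h hx.tr).1 hy]

theorem Hn [IsAlgClosed k] (h : RatData p q d) {j : LaurentSeries k →+* Λ}
    (hj : ∀ a : K, algebraMap K Λ a = j (HahnSeries.C (algebraMap K k a))) (ψ : Ω →ₐ[K] Λ) (n : ℕ) {x : Ω} (hx : Gen K x)
    {z : LaurentSeries k} (hz : ψ x = j z)
    (hnc : ∀ m, 1 ≤ m → m ≤ n → ∀ α : k, ((derivative p * q - p * derivative q).map (algebraMap K k)).eval α = 0 →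
      (phih (p.map (algebraMap K k)) (q.map (algebraMap K k)) d)^[m] (some α) ≠ red z) {u : Ω} (hu : u ∈ TT p q n x) :
    ψ u ∈ j.range := by
  induction n generalizing x z with
  | zero =>
    rw [show u = x from hu, hz]; exact ⟨_, rfl⟩
  | succ n ih =>
    rw [TT_succ] at hu
    simp only [Set.mem_iUnion] at hu
    obtain ⟨y, hy, hu⟩ := hu
    have hnc1 : NonCrit (p.map (algebraMap K k)) (q.map (algebraMap K k)) d (red z) := by
      intro α hα
      exact hnc 1 le_rfl (by omega) α (by simpa [derivative_map] using hα)
    obtain ⟨w, hw, hrel⟩ := Hn_one h hj ψ hx hz hnc1 hy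
    refine ih (hx.pre hy) hw ?_ hu
    intro m hm1 hm2 α hα hcon
    apply hnc (m + 1) (by omega) (by omega) α hα
    rw [Function.iterate_succ_apply', hcon]
    exact phih_red h.map hrel

theorem ind [CharZero K] [IsAlgClosed k] [Algebra.IsAlgebraic K k] [IsAlgClosed Ω] [IsAlgClosed Λ]
    (h : RatData p q d) {j : LaurentSeries k →+* Λ}
    (hj : ∀ a : K, algebraMap K Λ a = j (HahnSeries.C (algebraMap K k a)))
    (h1 : ∀ α₁ α₂ : k, ((derivative p * q - p * derivative q).map (algebraMap K k)).eval α₁ = 0 →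
      ((derivative p * q - p * derivative q).map (algebraMap K k)).eval α₂ = 0 → ∀ m n : ℕ, 1 ≤ m → 1 ≤ n →
      (phih (p.map (algebraMap K k)) (q.map (algebraMap K k)) d)^[m] (some α₁) =
      (phih (p.map (algebraMap K k)) (q.map (algebraMap K k)) d)^[n] (some α₂) → m = n ∧ α₁ = α₂)
    (n : ℕ) {x y : Ω} (hx : Gen K x) (hy : y ∈ TT p q 1 x)
    (hP : ∀ e ∈ adjoin K (insert y (TT p q n y)), IsAlgebraic K e → e ∈ (⊥ : IntermediateField K Ω))
    (σ : Ω ≃ₐ[K] Ω) (hσ : σ y = y) :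
    ∃ τ : Ω ≃ₐ[K] Ω, τ x = x ∧ (∀ u ∈ TT p q 1 x, τ u = u) ∧ (∀ y' ∈ TT p q 1 x, y' ≠ y → ∀ u ∈ TT p q n y', τ u = u) ∧
      (∀ c : Ω, IsAlgebraic K c → τ c = c) ∧ ∀ u ∈ TT p q n y, τ u = σ u := by
  have hyg := hx.pre hy
  have hxy : x ∈ K⟮y⟯ := by
    have := fm_mem (p := p) (q := q) y
    rwa [show fm p q y = x from hy] at this
  have hkey : adjoin K (insert y (TT p q n y)) ⊓ adjoin K (insert y ({c : Ω | IsAlgebraic K c} ∪ TT p q 1 x ∪ ⋃ y' ∈ TT p q 1 x \ {y}, TT p q n y')) ≤ K⟮y⟯ := by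
    apply simply_connected hj hyg
    · exact ⟨subset_adjoin _ _ (Set.mem_insert _ _), subset_adjoin _ _ (Set.mem_insert _ _)⟩
    · intro e he hea
      exact hP e he.1 hea
    intro c ψ hψ e he
    by_cases hc : ∀ m, 1 ≤ m → m ≤ n → ∀ α : k, ((derivative p * q - p * derivative q).map (algebraMap K k)).eval α = 0 →
        (phih (p.map (algebraMap K k)) (q.map (algebraMap K k)) d)^[m] (some α) ≠ red (pt c)
    · refine adjoin_mem_range hj ψ ?_ he.1
      rintro b (rfl | hb)
      · rw [hψ]; exact ⟨_, rfl⟩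
      · exact Hn h hj ψ n hyg hψ hc hb
    push Not at hc
    obtain ⟨m, hm1, hm2, α, hα, hαc⟩ := hc
    have hxr : ψ x ∈ j.range := by
      refine adjoin_mem_range hj ψ ?_ hxy
      rintro b rfl
      rw [hψ]; exact ⟨_, rfl⟩
    obtain ⟨z, hz⟩ := hxr
    have hrel : Rel (p.map (algebraMap K k)) (q.map (algebraMap K k)) (pt c) z := by
      apply j.injective
      rw [map_mul, hom_eval₂, hom_eval₂, aeval_j hj, aeval_j hj, hz, ← hψ, aeval_algHom_apply, aeval_algHom_apply,
        ← map_mul, (fm_iff h hx.tr).1 hy]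
    have hredz := phih_red h.map hrel
    have hz2 : (phih (p.map (algebraMap K k)) (q.map (algebraMap K k)) d)^[m+1] (some α) = red z := by
      rw [Function.iterate_succ_apply', hαc, hredz]
    have hnc : NonCrit (p.map (algebraMap K k)) (q.map (algebraMap K k)) d (red z) := by
      intro α' hα' hcon
      have := h1 α' α (by simpa [derivative_map] using hα') hα 1 (m + 1) le_rfl (by omega) (by rw [hz2]; exact hcon)
      omega
    have hT1 : ∀ y' ∈ TT p q 1 x, ∃ w, ψ y' = j w ∧ Rel (p.map (algebraMap K k)) (q.map (algebraMap K k)) w z :=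
      fun y' hy' => Hn_one h hj ψ hx hz.symm hnc hy'
    refine adjoin_mem_range hj ψ ?_ he.2
    rintro b (rfl | (hb | hb) | hb)
    · rw [hψ]; exact ⟨_, rfl⟩
    · exact const_mem_range hj (IsAlgebraic.algHom ψ hb)
    · obtain ⟨w, hw, _⟩ := hT1 b hb
      exact ⟨w, hw.symm⟩
    · simp only [Set.mem_iUnion] at hb
      obtain ⟨y', ⟨hy', hne⟩, hb⟩ := hb
      obtain ⟨w, hw, hrw⟩ := hT1 y' hy'
      refine Hn h hj ψ n (hx.pre hy') hw ?_ hb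
      intro m' hm1' hm2' α' hα' hcon
      have h3 : (phih (p.map (algebraMap K k)) (q.map (algebraMap K k)) d)^[m'+1] (some α') = red z := by
        rw [Function.iterate_succ_apply', hcon]; exact phih_red h.map hrw
      obtain ⟨hm, rfl⟩ := h1 α α' hα hα' (m + 1) (m' + 1) (by omega) (by omega) (by rw [hz2, h3])
      obtain rfl : m = m' := by omega
      have := red_injective h.map hnc hrel hrw (by rw [← hαc, hcon])
      apply hne
      apply ψ.injective
      change ψ y' = ψ y
      rw [hψ, hw, this]
  obtain ⟨τ, ht1, ht2, ht3⟩ := galois_lift hyg (TT p q n y)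
    ({c : Ω | IsAlgebraic K c} ∪ TT p q 1 x ∪ ⋃ y' ∈ TT p q 1 x \ {y}, TT p q n y') (TT_finite h n hyg)
    (fun τ hτ s hs => by have := TT_map τ hs; rwa [hτ] at this) hkey σ hσ
  refine ⟨τ, ?_, fun u hu => ht2 u (Or.inl (Or.inr hu)), fun y' hy' hne u hu => ht2 u (Or.inr ?_),
      fun c hc => ht2 c (Or.inl (Or.inl hc)), ht3⟩
  · exact fixed_of_mem_adjoin hxy τ (by simp [ht1])
  · simp only [Set.mem_iUnion]; exact ⟨y', ⟨hy', hne⟩, hu⟩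

end I
end PerProp
end ModI2

section ModI3
open Polynomial IntermediateField

namespace PerProp
section I
variable {K Ω : Type*} [Field K] [Field Ω] [Algebra K Ω] {p q : K[X]} {d : ℕ}

/-- the critical orbits do not collide -/
def NonColl (p q : K[X]) (d : ℕ) : Prop :=
  ∀ α₁ α₂ : AlgebraicClosure K,
    ((derivative p * q - p * derivative q).map (algebraMap K (AlgebraicClosure K))).eval α₁ = 0 →
    ((derivative p * q - p * derivative q).map (algebraMap K (AlgebraicClosure K))).eval α₂ = 0 →
    ∀ m n : ℕ, 1 ≤ m → 1 ≤ n →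
    (phih (p.map (algebraMap K (AlgebraicClosure K))) (q.map (algebraMap K (AlgebraicClosure K))) d)^[m] (some α₁) =
    (phih (p.map (algebraMap K (AlgebraicClosure K))) (q.map (algebraMap K (AlgebraicClosure K))) d)^[n] (some α₂) →
    m = n ∧ α₁ = α₂

/-- no new constants at level `n` -/
def PConst (p q : K[X]) (n : ℕ) (x : Ω) : Prop :=
  ∀ e ∈ adjoin K (insert x (TT p q n x)), IsAlgebraic K e → e ∈ (⊥ : IntermediateField K Ω)

theorem PConst.map {n : ℕ} {x : Ω} (h : PConst p q n x) (η : Ω ≃ₐ[K] Ω) : PConst p q n (η x) := by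
  intro e he hea
  have h1 : η.symm e ∈ adjoin K (insert x (TT p q n x)) := by
    have : η.symm e ∈ (adjoin K (insert (η x) (TT p q n (η x)))).map η.symm.toAlgHom := ⟨e, he, rfl⟩
    rw [adjoin_map] at this
    refine adjoin.mono K _ _ ?_ this
    rintro _ ⟨b, (rfl | hb), rfl⟩
    · left; simp
    · right
      have := TT_map η.symm hb
      simpa using this
  have h2 := h _ h1 (hea.algHom η.symm.toAlgHom)
  obtain ⟨a, ha⟩ := mem_bot.1 h2
  refine mem_bot.2 ⟨a, ?_⟩
  rw [← η.commutes, ha]; simp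

theorem eqOn_adjoin {B : Set Ω} {z : Ω} (hz : z ∈ adjoin K B) (σ τ : Ω ≃ₐ[K] Ω) (h : ∀ b ∈ B, σ b = τ b) :
    σ z = τ z := by
  have := fixed_of_mem_adjoin hz (σ.trans τ.symm) (fun b hb => by simp [h b hb])
  simp only [AlgEquiv.trans_apply] at this
  exact (AlgEquiv.symm_apply_eq τ).1 this

variable [CharZero K] [IsAlgClosed Ω]

theorem ind' (h : RatData p q d) (h1 : NonColl p q d)
    (n : ℕ) {x y : Ω} (hx : Gen K x) (hy : y ∈ TT p q 1 x) (hP : PConst p q n y)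
    (σ : Ω ≃ₐ[K] Ω) (hσ : σ y = y) :
    ∃ τ : Ω ≃ₐ[K] Ω, τ x = x ∧ (∀ u ∈ TT p q 1 x, τ u = u) ∧ (∀ y' ∈ TT p q 1 x, y' ≠ y → ∀ u ∈ TT p q n y', τ u = u) ∧
      (∀ c : Ω, IsAlgebraic K c → τ c = c) ∧ ∀ u ∈ TT p q n y, τ u = σ u := by
  let j : LaurentSeries (AlgebraicClosure K) →+* AlgebraicClosure (LaurentSeries (AlgebraicClosure K)) := algebraMap _ _
  letI : Algebra K (AlgebraicClosure (LaurentSeries (AlgebraicClosure K))) :=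
    ((j.comp HahnSeries.C).comp (algebraMap K (AlgebraicClosure K))).toAlgebra
  exact ind (k := AlgebraicClosure K) h (j := j) (fun a => rfl) h1 n hx hy hP σ hσ

theorem glue (h : RatData p q d) (h1 : NonColl p q d)
    (n : ℕ) {x : Ω} (hx : Gen K x) (hP : ∀ y ∈ TT p q 1 x, PConst p q n y)
    (σ : Ω → (Ω ≃ₐ[K] Ω)) (hσ : ∀ y ∈ TT p q 1 x, σ y y = y) :
    ∃ τ : Ω ≃ₐ[K] Ω, τ x = x ∧ (∀ u ∈ TT p q 1 x, τ u = u) ∧ (∀ c : Ω, IsAlgebraic K c → τ c = c) ∧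
      ∀ y ∈ TT p q 1 x, ∀ u ∈ TT p q n y, τ u = σ y u := by
  classical
  have key : ∀ F : Finset Ω, (F : Set Ω) ⊆ TT p q 1 x → ∃ τ : Ω ≃ₐ[K] Ω, τ x = x ∧ (∀ u ∈ TT p q 1 x, τ u = u) ∧
      (∀ c : Ω, IsAlgebraic K c → τ c = c) ∧ (∀ y ∈ F, ∀ u ∈ TT p q n y, τ u = σ y u) ∧
      ∀ y ∈ TT p q 1 x, y ∉ F → ∀ u ∈ TT p q n y, τ u = u := by
    intro F
    induction F using Finset.induction_on with
    | empty => intro _; exact ⟨AlgEquiv.refl, by simp⟩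
    | insert y F hyF ih =>
      intro hF
      obtain ⟨τ, t1, t2, t3, t4, t5⟩ := ih (fun a ha => hF (by simp only [Finset.coe_insert]; exact Or.inr ha))
      have hy : y ∈ TT p q 1 x := hF (by simp)
      obtain ⟨ρ, r1, r2, r3, r4, r5⟩ := ind' h h1 n hx hy (hP y hy) (σ y) (hσ y hy)
      refine ⟨τ.trans ρ, by simp [t1, r1], fun u hu => by simp [t2 u hu, r2 u hu],
        fun c hc => by simp [t3 c hc, r4 c hc], ?_, ?_⟩
      · intro y' hy' u hu
        rw [AlgEquiv.trans_apply]
        rcases Finset.mem_insert.1 hy' with rfl | hy'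
        · rw [t5 _ hy hyF u hu, r5 u hu]
        · rw [t4 _ hy' u hu]
          have hy1 : y' ∈ TT p q 1 x := hF (by simp [hy'])
          refine r3 y' hy1 (fun hh => hyF (hh ▸ hy')) _ ?_
          have := TT_map (σ y') hu
          rwa [hσ y' hy1] at this
      · intro y' hy' hn u hu
        rw [Finset.mem_insert, not_or] at hn
        rw [AlgEquiv.trans_apply, t5 y' hy' hn.2 u hu, r3 y' hy' hn.1 u hu]
  obtain ⟨τ, t1, t2, t3, t4, _⟩ := key (TT_finite h 1 hx).toFinset (by simp)
  exact ⟨τ, t1, t2, t3, fun y hy => t4 y (by simpa using hy)⟩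

theorem PConst_all (h : RatData p q d) (h1 : NonColl p q d) {x0 : Ω} (hx0 : Gen K x0) (hP : PConst p q 1 x0)
    (n : ℕ) {x : Ω} (hx : Gen K x) : PConst p q n x := by
  have hP1 : ∀ {x : Ω}, Gen K x → PConst p q 1 x := by
    intro x hx
    obtain ⟨η, rfl⟩ := exists_equiv hx0 hx
    exact hP.map η
  induction n generalizing x with
  | zero =>
    intro e he hea
    refine hP1 hx e (adjoin.mono K _ _ ?_ he) hea
    rintro _ (rfl | hb)
    · exact Or.inl rfl
    · exact Or.inl hb
  | succ n ih =>
    intro e he hea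
    refine hP1 hx e ?_ hea
    apply mem_adjoin_of_fixed hx
    intro τ hτ hτ1
    obtain ⟨τ', t1, t2, t3, t4⟩ := glue h h1 n hx (fun y hy => ih (hx.pre hy)) (fun _ => τ) hτ1
    rw [eqOn_adjoin he τ τ', t3 e hea]
    rintro b (rfl | hb)
    · rw [hτ, t1]
    · rw [TT_succ] at hb
      simp only [Set.mem_iUnion] at hb
      obtain ⟨y, hy, hb⟩ := hb
      exact (t4 y hy b hb).symm

end I
end PerProp
end ModI3

section ModG1
namespace PerProp
section G
variable {Γ A B : Type*} [Group Γ] [Group A] [Group B]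

/-- proportion of the image of `f` coming from `E` -/
noncomputable def dens (f : Γ →* A) (E : Set Γ) : ℚ := (f '' E).ncard / (Set.range f).ncard

/-- `E` is a union of fibres of `f` -/
def Sat (f : Γ →* A) (E : Set Γ) : Prop := ∀ σ σ', f σ = f σ' → σ ∈ E → σ' ∈ E

theorem ncard_comp [Finite A] (f : Γ →* A) (g : A →* B) {E : Set Γ}
    (hE : Sat (g.comp f) E) :
    (f '' E).ncard = (g.comp f '' E).ncard * {a | a ∈ Set.range f ∧ g a = 1}.ncard := by
  classical
  have hfin : (g.comp f '' E).Finite := by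
    rw [MonoidHom.coe_comp, Set.image_comp]; exact (Set.toFinite _).image g
  have hmap : Set.MapsTo g ((Set.toFinite (f '' E)).toFinset : Set A) (hfin.toFinset : Set B) := by
    intro a ha
    simp only [Set.Finite.coe_toFinset] at ha ⊢
    obtain ⟨σ, hσ, rfl⟩ := ha
    exact ⟨σ, hσ, rfl⟩
  have h1 := Finset.card_eq_sum_card_fiberwise hmap
  rw [Set.ncard_eq_toFinset_card (f '' E), h1, Set.ncard_eq_toFinset_card _ hfin, ← smul_eq_mul, ← Finset.sum_const]
  apply Finset.sum_congr rfl
  intro b hb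
  simp only [Set.Finite.mem_toFinset] at hb
  obtain ⟨σ, hσ, rfl⟩ := hb
  rw [← Set.ncard_coe_finset]
  have h2 : ((Finset.filter (fun a => g a = (g.comp f) σ) (Set.toFinite (f '' E)).toFinset : Finset A) : Set A)
      = (fun a => f σ * a) '' {a | a ∈ Set.range f ∧ g a = 1} := by
    ext a
    simp only [Finset.coe_filter, Set.Finite.mem_toFinset, Set.mem_setOf_eq, Set.mem_image]
    constructor
    · rintro ⟨⟨τ, hτ, rfl⟩, h3⟩
      refine ⟨f (σ⁻¹ * τ), ⟨⟨_, rfl⟩, ?_⟩, by simp⟩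
      rw [map_mul, map_mul, h3, map_inv, map_inv]; simp
    · rintro ⟨_, ⟨⟨τ, rfl⟩, h3⟩, rfl⟩
      refine ⟨⟨σ * τ, ?_, by simp⟩, by simp [h3]⟩
      exact hE σ (σ * τ) (by simp [h3]) hσ
  rw [h2, Set.ncard_image_of_injective _ (mul_right_injective _)]

theorem dens_comp [Finite A] (f : Γ →* A) (g : A →* B) {E : Set Γ}
    (hE : Sat (g.comp f) E) : dens f E = dens (g.comp f) E := by
  have h1 := ncard_comp f g hE
  have h2 := ncard_comp f g (E := Set.univ) (fun _ _ _ _ => trivial)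
  simp only [Set.image_univ] at h2
  have h3 : {a | a ∈ Set.range f ∧ g a = 1}.ncard ≠ 0 := by
    rw [← Nat.pos_iff_ne_zero, Set.ncard_pos]
    exact ⟨1, ⟨1, map_one f⟩, map_one g⟩
  unfold dens
  rw [h1, h2]
  push_cast
  rw [mul_div_mul_right]
  exact_mod_cast h3

theorem dens_unique [Finite A] [Finite B] (f : Γ →* A) (g : Γ →* B) {E : Set Γ}
    (hf : Sat f E) (hg : Sat g E) : dens f E = dens g E := by
  have h1 := dens_comp (f.prod g) (MonoidHom.fst A B) (E := E) (by rwa [MonoidHom.fst_comp_prod])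
  have h2 := dens_comp (f.prod g) (MonoidHom.snd A B) (E := E) (by rwa [MonoidHom.snd_comp_prod])
  rw [MonoidHom.fst_comp_prod] at h1
  rw [MonoidHom.snd_comp_prod] at h2
  rw [← h1, h2]

open Classical in
theorem finite_lemma {I : Type*} [Fintype I] [Fintype A] (ρ : A →* Equiv.Perm I) {d : ℕ} (hI : Fintype.card I = d)
    (hd : 2 ≤ d) (htr : ∀ i i', ∃ σ, ρ σ i = i') (Q : I → A → Prop) (a : ℚ)
    (hst : ∀ i, ((Finset.univ.filter fun σ => ρ σ i = i ∧ Q i σ).card : ℚ) = a * (Finset.univ.filter fun σ => ρ σ i = i).card)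
    {i0 i1 : I} (h01 : i0 ≠ i1)
    (hΔ : ((Finset.univ.filter fun σ => ρ σ = 1 ∧ Q i0 σ ∧ Q i1 σ).card : ℚ) = a ^ 2 * (Finset.univ.filter fun σ => ρ σ = 1).card) :
    ((Finset.univ.filter fun σ => ∃ i, ρ σ i = i ∧ Q i σ).card : ℚ) ≤ (a - a ^ 2 / d.factorial) * Fintype.card A := by
  let r : A → ℕ := fun σ => (Finset.univ.filter fun i => ρ σ i = i ∧ Q i σ).card
  have hstab : ∀ i, ((Finset.univ.filter fun σ => ρ σ i = i).card : ℚ) * d = Fintype.card A := by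
    intro i
    letI : MulAction A I := MulAction.compHom I ρ
    have h1 := MulAction.card_orbit_mul_card_stabilizer_eq_card_group A i
    have h2 : MulAction.orbit A i = Set.univ := by
      ext i'; simp only [Set.mem_univ, iff_true]
      obtain ⟨σ, hσ⟩ := htr i i'
      exact ⟨σ, hσ⟩
    have h3 : Fintype.card (MulAction.orbit A i) = d := by
      rw [← hI, ← Set.toFinset_card]; simp [h2]
    rw [h3] at h1
    have h4 : Fintype.card (MulAction.stabilizer A i) = (Finset.univ.filter fun σ => ρ σ i = i).card := by
      rw [Fintype.card_subtype]; congr 1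
    rw [← h1, h4]; push_cast; ring
  have hsum : (∑ σ, (r σ : ℚ)) = a * Fintype.card A := by
    have h1 : ∑ σ, r σ = ∑ i, (Finset.univ.filter fun σ => ρ σ i = i ∧ Q i σ).card := by
      simp only [r, Finset.card_filter]
      rw [Finset.sum_comm]
    have hd0 : (d : ℚ) ≠ 0 := by norm_cast; omega
    rw [← Nat.cast_sum, h1, Nat.cast_sum, Finset.sum_congr rfl (fun i _ => hst i), ← Finset.mul_sum]
    congr 1
    have h5 : ∀ i ∈ (Finset.univ : Finset I), ((Finset.univ.filter fun σ => ρ σ i = i).card : ℚ) = Fintype.card A / d := by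
      intro i _; rw [eq_div_iff hd0, hstab]
    rw [Finset.sum_congr rfl h5, Finset.sum_const, Finset.card_univ, hI, nsmul_eq_mul, mul_div_cancel₀ _ hd0]
  have hle : (Finset.univ.filter fun σ => ∃ i, ρ σ i = i ∧ Q i σ).card
      + (Finset.univ.filter fun σ => ρ σ = 1 ∧ Q i0 σ ∧ Q i1 σ).card ≤ ∑ σ, r σ := by
    rw [Finset.card_filter, Finset.card_filter, ← Finset.sum_add_distrib]
    apply Finset.sum_le_sum
    intro σ _
    by_cases hc : ρ σ = 1 ∧ Q i0 σ ∧ Q i1 σ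
    · rw [if_pos hc]
      have : 2 ≤ r σ := by
        rw [← Finset.card_pair h01]
        apply Finset.card_le_card
        intro i hi
        simp only [Finset.mem_insert, Finset.mem_singleton] at hi
        rcases hi with rfl | rfl <;> simp [hc.1, hc.2.1, hc.2.2]
      split_ifs <;> omega
    · rw [if_neg hc, add_zero]
      split_ifs with h
      · obtain ⟨i, hi⟩ := h
        exact Finset.card_pos.2 ⟨i, by simp [hi]⟩
      · omega
  have hker : (Fintype.card A : ℚ) ≤ (Finset.univ.filter fun σ => ρ σ = 1).card * d.factorial := by
    have h1 : Nat.card ρ.ker * Nat.card ρ.range = Nat.card A := by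
      rw [← Subgroup.index_ker, mul_comm]; rw [mul_comm]; exact Subgroup.card_mul_index _
    have h2 : Nat.card ρ.range ≤ d.factorial := by
      refine (Nat.card_le_card_of_injective _ (Subtype.val_injective)).trans ?_
      rw [Nat.card_perm, Nat.card_eq_fintype_card, hI]
    have h3 : Nat.card ρ.ker = (Finset.univ.filter fun σ => ρ σ = 1).card := by
      rw [Nat.card_eq_fintype_card, Fintype.card_subtype]; congr 1; ext σ; simp [MonoidHom.mem_ker]
    rw [← Nat.card_eq_fintype_card, ← h1, h3]
    norm_cast
    exact Nat.mul_le_mul_left _ h2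
  have hle' : (((Finset.univ.filter fun σ => ∃ i, ρ σ i = i ∧ Q i σ).card : ℚ))
      + (Finset.univ.filter fun σ => ρ σ = 1 ∧ Q i0 σ ∧ Q i1 σ).card ≤ ∑ σ, (r σ : ℚ) := by exact_mod_cast hle
  rw [hsum, hΔ] at hle'
  have hf : (0 : ℚ) < d.factorial := by exact_mod_cast d.factorial_pos
  have h6 : a ^ 2 / d.factorial * Fintype.card A ≤ a ^ 2 * (Finset.univ.filter fun σ => ρ σ = 1).card := by
    rw [div_mul_eq_mul_div, div_le_iff₀ hf, mul_assoc]
    exact mul_le_mul_of_nonneg_left hker (sq_nonneg a)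
  linarith

theorem tendsto_zero {a : ℕ → ℚ} {c : ℚ} (hc : 0 < c) (h0 : ∀ n, 0 ≤ a n)
    (h : ∀ n, a (n + 1) ≤ a n - a n ^ 2 * c) {ε : ℚ} (hε : 0 < ε) : ∃ n, a n < ε := by
  by_contra hcon
  push Not at hcon
  have key : ∀ n : ℕ, a n ≤ a 0 - n * (ε ^ 2 * c) := by
    intro n
    induction n with
    | zero => simp
    | succ n ih =>
      have h1 := h n
      have h2 : ε ^ 2 * c ≤ a n ^ 2 * c := by
        apply mul_le_mul_of_nonneg_right _ hc.le
        exact pow_le_pow_left₀ hε.le (hcon n) 2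
      push_cast
      linarith
  obtain ⟨n, hn⟩ := exists_nat_gt (a 0 / (ε ^ 2 * c))
  have h3 : 0 < ε ^ 2 * c := by positivity
  rw [div_lt_iff₀ h3] at hn
  have := key n
  have := h0 n
  linarith

end G
end PerProp
end ModG1

section ModG2
open Polynomial IntermediateField

namespace PerProp
section G
variable {K Ω : Type*} [Field K] [Field Ω] [Algebra K Ω] {p q : K[X]} {d : ℕ}

/-- the permutation action on a stable set -/
def act (H : Subgroup (Ω ≃ₐ[K] Ω)) (S : Set Ω) (hS : ∀ σ ∈ H, ∀ u ∈ S, σ u ∈ S) : H →* Equiv.Perm S where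
  toFun σ :=
    { toFun := fun u => ⟨σ.1 u, hS σ.1 σ.2 u u.2⟩
      invFun := fun u => ⟨σ.1.symm u, hS σ.1⁻¹ (H.inv_mem σ.2) u u.2⟩
      left_inv := fun u => by simp
      right_inv := fun u => by simp }
  map_one' := by ext u; rfl
  map_mul' σ τ := by ext u; rfl

theorem act_apply (H : Subgroup (Ω ≃ₐ[K] Ω)) (S : Set Ω) (hS : ∀ σ ∈ H, ∀ u ∈ S, σ u ∈ S) (σ : H) (u : S) :
    ((act H S hS σ u : S) : Ω) = σ.1 u := rfl

theorem act_eq_iff (H : Subgroup (Ω ≃ₐ[K] Ω)) (S : Set Ω) (hS : ∀ σ ∈ H, ∀ u ∈ S, σ u ∈ S) (σ τ : H) :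
    act H S hS σ = act H S hS τ ↔ ∀ u ∈ S, σ.1 u = τ.1 u := by
  constructor
  · intro h u hu
    have := congrArg (fun π => ((π ⟨u, hu⟩ : S) : Ω)) h
    exact this
  · intro h
    ext u
    exact h u u.2

/-- the stabiliser of `x` -/
def Gx (K : Type*) {Ω : Type*} [Field K] [Field Ω] [Algebra K Ω] (x : Ω) : Subgroup (Ω ≃ₐ[K] Ω) where
  carrier := {σ | σ x = x}
  mul_mem' {a b} ha hb := by
    simp only [Set.mem_setOf_eq] at *
    rw [AlgEquiv.mul_apply, hb, ha]
  one_mem' := rfl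
  inv_mem' {a} ha := by
    simp only [Set.mem_setOf_eq] at *
    nth_rewrite 1 [← ha]
    exact a.symm_apply_apply x

theorem TT_stab (n : ℕ) (x : Ω) : ∀ σ ∈ Gx K x, ∀ u ∈ TT p q n x, σ u ∈ TT p q n x := by
  intro σ hσ u hu
  have := TT_map σ hu
  rwa [show σ x = x from hσ] at this

/-- elements with a fixed point -/
def FixS (H : Subgroup (Ω ≃ₐ[K] Ω)) (S : Set Ω) : Set H := {σ | ∃ u ∈ S, σ.1 u = u}

/-- proportion of elements of the level `n` group with a fixed point -/
noncomputable def an (p q : K[X]) (n : ℕ) (x : Ω) : ℚ :=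
  dens (act (Gx K x) (TT p q n x) (TT_stab n x)) (FixS (Gx K x) (TT p q n x))

theorem an_nonneg (n : ℕ) (x : Ω) : 0 ≤ an p q n x := by unfold an dens; positivity

theorem dens_congr {Γ Γ' A A' : Type*} [Group Γ] [Group Γ'] [Group A] [Group A'] {f : Γ →* A} {f' : Γ' →* A'}
    {E : Set Γ} {E' : Set Γ'} (c : Γ → Γ') (hc : Function.Surjective c) (e : A → A') (he : Function.Injective e)
    (h : ∀ σ, f' (c σ) = e (f σ)) (hE : ∀ σ, c σ ∈ E' ↔ σ ∈ E) : dens f E = dens f' E' := by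
  unfold dens
  have h1 : ∀ F : Set Γ, ∀ F' : Set Γ', (∀ σ, c σ ∈ F' ↔ σ ∈ F) → (f '' F).ncard = (f' '' F').ncard := by
    intro F F' hF
    rw [← Set.ncard_image_of_injective (f '' F) he]
    congr 1
    ext a
    constructor
    · rintro ⟨_, ⟨σ, hσ, rfl⟩, rfl⟩
      exact ⟨c σ, (hF σ).2 hσ, h σ⟩
    · rintro ⟨σ', hσ', rfl⟩
      obtain ⟨σ, rfl⟩ := hc σ'
      exact ⟨f σ, ⟨σ, (hF σ).1 hσ', rfl⟩, (h σ).symm⟩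
  rw [h1 E E' hE, ← Set.image_univ, ← Set.image_univ, h1 Set.univ Set.univ (by simp)]

theorem an_map (n : ℕ) (x : Ω) (η : Ω ≃ₐ[K] Ω) : an p q n x = an p q n (η x) := by
  have hT : ∀ u, η u ∈ TT p q n (η x) ↔ u ∈ TT p q n x := by
    intro u
    refine ⟨fun hu => ?_, fun hu => TT_map η hu⟩
    have := TT_map η.symm hu
    simpa using this
  let ee : TT p q n x ≃ TT p q n (η x) :=
    { toFun := fun u => ⟨η u, (hT u).2 u.2⟩
      invFun := fun u => ⟨η.symm u, (hT _).1 (by simp)⟩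
      left_inv := fun u => by simp
      right_inv := fun u => by simp }
  refine dens_congr (c := fun σ : Gx K x => (⟨η * σ.1 * η⁻¹, ?_⟩ : Gx K (η x))) ?_ (fun π => ee.permCongr π)
    (ee.permCongr).injective ?_ ?_
  · change η (σ.1 (η.symm (η x))) = η x
    rw [η.symm_apply_apply, show σ.1 x = x from σ.2]
  · rintro ⟨τ, hτ⟩
    refine ⟨⟨η⁻¹ * τ * η, ?_⟩, ?_⟩
    · change η.symm (τ (η x)) = x
      rw [show τ (η x) = η x from hτ, η.symm_apply_apply]
    · apply Subtype.ext
      simp only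
      group
  · intro σ
    ext u
    rw [Equiv.permCongr_apply]
    rfl
  · intro σ
    constructor
    · rintro ⟨u, hu, h⟩
      refine ⟨η.symm u, (hT _).1 (by simpa using hu), ?_⟩
      change η (σ.1 (η.symm u)) = u at h
      rw [AlgEquiv.eq_symm_apply, h]
    · rintro ⟨u, hu, h⟩
      refine ⟨η u, (hT _).2 hu, ?_⟩
      change η (σ.1 (η.symm (η u))) = η u
      rw [η.symm_apply_apply, h]

theorem card_filter_eq {A : Type*} [Fintype A] (P : A → Prop) [DecidablePred P] :
    (Finset.univ.filter P).card = {a | P a}.ncard := by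
  rw [← Set.ncard_coe_finset]; simp

theorem dens_mul {Γ A : Type*} [Group Γ] [Group A] [Finite A] (f : Γ →* A) (E : Set Γ) :
    ((f '' E).ncard : ℚ) = dens f E * (Set.range f).ncard := by
  unfold dens
  rw [div_mul_cancel₀]
  have : (Set.range f).ncard ≠ 0 := by
    rw [← Nat.pos_iff_ne_zero, Set.ncard_pos]; exact ⟨1, 1, map_one f⟩
  exact_mod_cast this

theorem TT_one_map {x y : Ω} (hy : y ∈ TT p q 1 x) {σ : Ω ≃ₐ[K] Ω} (hσ : σ y = y) : σ x = x := by
  have := TT_map σ hy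
  rw [hσ] at this
  change fm p q y = σ x at this
  rw [← this]; exact hy

variable [CharZero K] [IsAlgClosed Ω]

theorem an_succ (h : RatData p q d) (h1 : NonColl p q d) (n : ℕ) {x : Ω} (hx : Gen K x)
    (hP : ∀ {y : Ω}, Gen K y → PConst p q n y) :
    an p q (n + 1) x ≤ an p q n x - (an p q n x) ^ 2 * (1 / d.factorial) := by
  classical
  set a := an p q n x with ha
  have hay : ∀ y : Ω, Gen K y → an p q n y = a := by
    intro y hy
    obtain ⟨η, rfl⟩ := exists_equiv hx hy
    exact (an_map n x η).symm
  haveI fin1 : Finite (TT p q 1 x) := TT_finite h 1 hx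
  haveI fin2 : Finite (TT p q (n + 1) x) := TT_finite h (n + 1) hx
  letI : Fintype (TT p q 1 x) := Fintype.ofFinite _
  let f1 := act (Gx K x) (TT p q 1 x) (TT_stab 1 x)
  let f2 := act (Gx K x) (TT p q (n + 1) x) (TT_stab (n + 1) x)
  let f := f1.prod f2
  let fr := f.rangeRestrict
  letI : Fintype f.range := Fintype.ofFinite _
  have hsurj : Function.Surjective fr := f.rangeRestrict_surjective
  let ρ : f.range →* Equiv.Perm (TT p q 1 x) := (MonoidHom.fst _ _).comp f.range.subtype
  let Q : TT p q 1 x → f.range → Prop := fun y b => ∃ u : TT p q (n + 1) x, (fm p q)^[n] u.1 = y.1 ∧ b.1.2 u = u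
  have hρ : ∀ (σ : Gx K x) (y : TT p q 1 x), ((ρ (fr σ) y : TT p q 1 x) : Ω) = σ.1 y := fun σ y => rfl
  have hρ' : ∀ (σ : Gx K x) (y : TT p q 1 x), ρ (fr σ) y = y ↔ σ.1 y = y := fun σ y => Subtype.ext_iff
  have hsub : ∀ {y u : Ω}, y ∈ TT p q 1 x → u ∈ TT p q n y → u ∈ TT p q (n + 1) x := by
    intro y u hy hu
    rw [TT_succ]; simp only [Set.mem_iUnion]; exact ⟨y, hy, hu⟩
  have hQ : ∀ (σ : Gx K x) (y : TT p q 1 x), Q y (fr σ) ↔ ∃ u ∈ TT p q n y.1, σ.1 u = u := by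
    intro σ y
    constructor
    · rintro ⟨u, hu1, hu2⟩
      exact ⟨u, hu1, Subtype.ext_iff.1 hu2⟩
    · rintro ⟨u, hu1, hu2⟩
      exact ⟨⟨u, hsub y.2 hu1⟩, hu1, Subtype.ext hu2⟩
  have hres : ∀ {σ τ : Gx K x}, fr σ = fr τ → (∀ u ∈ TT p q 1 x, σ.1 u = τ.1 u) ∧ (∀ u ∈ TT p q (n + 1) x, σ.1 u = τ.1 u) := by
    intro σ τ hst
    have h2 := congrArg Subtype.val hst
    change (f1 σ, f2 σ) = (f1 τ, f2 τ) at h2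
    rw [Prod.mk.injEq] at h2
    exact ⟨(act_eq_iff _ _ _ _ _).1 h2.1, (act_eq_iff _ _ _ _ _).1 h2.2⟩
  obtain ⟨y0, y1, hy01⟩ : ∃ y0 y1 : TT p q 1 x, y0 ≠ y1 := by
    have hc := TT_one_ncard h hx
    have : 1 < (TT p q 1 x).ncard := by rw [hc]; have := h.hd; omega
    rw [Set.one_lt_ncard_iff] at this
    obtain ⟨y0, y1, h0, h1, h01⟩ := this
    exact ⟨⟨y0, h0⟩, ⟨y1, h1⟩, fun hh => h01 (congrArg Subtype.val hh)⟩
  -- the finite group statement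
  have hfin := finite_lemma ρ (d := d) (by rw [← Nat.card_eq_fintype_card]; exact TT_one_ncard h hx) h.hd ?_ Q a ?_
    (i0 := y0) (i1 := y1) hy01 ?_
  rotate_left
  · rintro ⟨y, hy⟩ ⟨y', hy'⟩
    obtain ⟨σ, hσ, hσ'⟩ := TT_trans hx hy hy'
    exact ⟨fr ⟨σ, hσ⟩, Subtype.ext hσ'⟩
  · intro y
    have hle : Gx K y.1 ≤ Gx K x := fun σ hσ => TT_one_map y.2 hσ
    let f' := fr.comp (Subgroup.inclusion hle)
    haveI : Finite (TT p q n y.1) := TT_finite h n (hx.pre y.2)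
    have hd1 : dens f' (FixS (Gx K y.1) (TT p q n y.1)) = a := by
      rw [← hay y.1 (hx.pre y.2)]
      apply dens_unique
      · rintro σ σ' hσ ⟨u, hu, hu'⟩
        refine ⟨u, hu, ?_⟩
        have := (hres hσ).2 u (hsub y.2 hu)
        exact this.symm.trans hu'
      · rintro σ σ' hσ ⟨u, hu, hu'⟩
        refine ⟨u, hu, ?_⟩
        rw [act_eq_iff] at hσ
        rw [← hσ u hu, hu']
    have hr : Set.range f' = {b | ρ b y = y} := by
      ext b
      constructor
      · rintro ⟨σ, rfl⟩
        exact (hρ' _ _).2 σ.2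
      · intro hb
        obtain ⟨σ, rfl⟩ := hsurj b
        exact ⟨⟨σ.1, (hρ' _ _).1 hb⟩, rfl⟩
    have hE : f' '' (FixS (Gx K y.1) (TT p q n y.1)) = {b | ρ b y = y ∧ Q y b} := by
      ext b
      constructor
      · rintro ⟨σ, hσ, rfl⟩
        exact ⟨(hρ' _ _).2 σ.2, (hQ _ _).2 hσ⟩
      · rintro ⟨hb1, hb2⟩
        obtain ⟨σ, rfl⟩ := hsurj b
        exact ⟨⟨σ.1, (hρ' _ _).1 hb1⟩, (hQ _ _).1 hb2, rfl⟩
    rw [card_filter_eq, card_filter_eq, ← hr, ← hE, dens_mul, hd1]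
  · let D : Subgroup (Ω ≃ₐ[K] Ω) := ⨅ y : TT p q 1 x, Gx K y.1
    have hD : ∀ σ, σ ∈ D ↔ ∀ y ∈ TT p q 1 x, σ y = y := by
      intro σ
      simp only [D, Subgroup.mem_iInf]
      exact ⟨fun hh y hy => hh ⟨y, hy⟩, fun hh y => hh y.1 y.2⟩
    have hle : D ≤ Gx K x := fun σ hσ => TT_one_map y0.2 ((hD σ).1 hσ y0 y0.2)
    have hst : ∀ y : TT p q 1 x, ∀ σ ∈ D, ∀ u ∈ TT p q n y.1, σ u ∈ TT p q n y.1 :=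
      fun y σ hσ => TT_stab n y.1 σ ((hD σ).1 hσ y y.2)
    let f' := fr.comp (Subgroup.inclusion hle)
    haveI : ∀ y : TT p q 1 x, Finite (TT p q n y.1) := fun y => TT_finite h n (hx.pre y.2)
    let g := (act D (TT p q n y0.1) (hst y0)).prod (act D (TT p q n y1.1) (hst y1))
    let E := FixS D (TT p q n y0.1) ∩ FixS D (TT p q n y1.1)
    let G (y : TT p q 1 x) := act (Gx K y.1) (TT p q n y.1) (TT_stab n y.1)
    have hlift : ∀ (σ0 : Gx K y0.1) (σ1 : Gx K y1.1), ∃ τ : D, g τ = (G y0 σ0, G y1 σ1) ∧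
        (∀ u ∈ TT p q n y0.1, τ.1 u = σ0.1 u) ∧ (∀ u ∈ TT p q n y1.1, τ.1 u = σ1.1 u) := by
      intro σ0 σ1
      obtain ⟨τ, t1, t2, t3, t4⟩ := glue h h1 n hx (fun y hy => hP (hx.pre hy))
        (fun y => if y = y0.1 then σ0.1 else if y = y1.1 then σ1.1 else 1) (by
          intro y hy
          split_ifs with ha hb
          · rw [ha]; exact σ0.2
          · rw [hb]; exact σ1.2
          · rfl)
      have t5 : ∀ u ∈ TT p q n y0.1, τ u = σ0.1 u := by
        intro u hu
        have := t4 y0.1 y0.2 u hu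
        simpa using this
      have t6 : ∀ u ∈ TT p q n y1.1, τ u = σ1.1 u := by
        intro u hu
        have := t4 y1.1 y1.2 u hu
        rw [if_neg (fun hh => hy01 (Subtype.ext hh.symm)), if_pos rfl] at this
        exact this
      refine ⟨⟨τ, (hD τ).2 t2⟩, ?_, t5, t6⟩
      refine Prod.ext ?_ ?_
      · ext u; exact t5 u u.2
      · ext u; exact t6 u u.2
    have hd1 : dens f' E = a ^ 2 := by
      have e1 : dens f' E = dens g E := by
        apply dens_unique
        · rintro σ σ' hσ ⟨⟨u, hu, hu'⟩, ⟨v, hv, hv'⟩⟩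
          refine ⟨⟨u, hu, ?_⟩, ⟨v, hv, ?_⟩⟩
          · exact ((hres hσ).2 u (hsub y0.2 hu)).symm.trans hu'
          · exact ((hres hσ).2 v (hsub y1.2 hv)).symm.trans hv'
        · rintro σ σ' hσ ⟨⟨u, hu, hu'⟩, ⟨v, hv, hv'⟩⟩
          have hσ2 : (act D (TT p q n y0.1) (hst y0) σ, act D (TT p q n y1.1) (hst y1) σ) =
            (act D (TT p q n y0.1) (hst y0) σ', act D (TT p q n y1.1) (hst y1) σ') := hσ
          rw [Prod.mk.injEq, act_eq_iff, act_eq_iff] at hσ2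
          refine ⟨⟨u, hu, ?_⟩, ⟨v, hv, ?_⟩⟩
          · rw [← hσ2.1 u hu, hu']
          · rw [← hσ2.2 v hv, hv']
      have hr : Set.range g = Set.range (G y0) ×ˢ Set.range (G y1) := by
        ext ⟨b0, b1⟩
        constructor
        · rintro ⟨σ, hσ⟩
          rw [← hσ]
          exact ⟨⟨⟨σ.1, (hD _).1 σ.2 _ y0.2⟩, rfl⟩, ⟨⟨σ.1, (hD _).1 σ.2 _ y1.2⟩, rfl⟩⟩
        · rintro ⟨⟨σ0, h0⟩, ⟨σ1, h1⟩⟩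
          obtain ⟨τ, ht, _⟩ := hlift σ0 σ1
          exact ⟨τ, by rw [ht]; exact Prod.ext h0 h1⟩
      have hE : g '' E = (G y0 '' FixS (Gx K y0.1) (TT p q n y0.1)) ×ˢ (G y1 '' FixS (Gx K y1.1) (TT p q n y1.1)) := by
        ext ⟨b0, b1⟩
        constructor
        · rintro ⟨σ, hσ, hσ'⟩
          rw [← hσ']
          exact ⟨⟨⟨σ.1, (hD _).1 σ.2 _ y0.2⟩, hσ.1, rfl⟩, ⟨⟨σ.1, (hD _).1 σ.2 _ y1.2⟩, hσ.2, rfl⟩⟩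
        · rintro ⟨⟨σ0, ⟨u, hu, hu'⟩, h0⟩, ⟨σ1, ⟨v, hv, hv'⟩, h1⟩⟩
          obtain ⟨τ, ht, ht0, ht1⟩ := hlift σ0 σ1
          exact ⟨τ, ⟨⟨u, hu, (ht0 u hu).trans hu'⟩, ⟨v, hv, (ht1 v hv).trans hv'⟩⟩, by rw [ht]; exact Prod.ext h0 h1⟩
      have a0 := hay y0.1 (hx.pre y0.2)
      have a1 := hay y1.1 (hx.pre y1.2)
      rw [e1, sq]
      nth_rewrite 1 [← a0]
      rw [← a1]
      unfold an dens
      rw [hr, hE, Set.ncard_prod, Set.ncard_prod]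
      push_cast
      rw [mul_div_mul_comm]
    have hr : Set.range f' = {b | ρ b = 1} := by
      ext b
      constructor
      · rintro ⟨σ, rfl⟩
        apply Equiv.ext
        intro y
        exact (hρ' _ _).2 ((hD _).1 σ.2 _ y.2)
      · intro hb
        obtain ⟨σ, rfl⟩ := hsurj b
        refine ⟨⟨σ.1, (hD _).2 fun y hy => ?_⟩, rfl⟩
        have := congrArg (fun π => π ⟨y, hy⟩) hb
        exact (hρ' σ ⟨y, hy⟩).1 this
    have hE : f' '' E = {b | ρ b = 1 ∧ Q y0 b ∧ Q y1 b} := by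
      ext b
      constructor
      · rintro ⟨σ, hσ, rfl⟩
        refine ⟨?_, (hQ _ _).2 hσ.1, (hQ _ _).2 hσ.2⟩
        have : f' σ ∈ {b | ρ b = 1} := hr ▸ ⟨σ, rfl⟩
        exact this
      · rintro ⟨hb1, hb2, hb3⟩
        have : b ∈ Set.range f' := by rw [hr]; exact hb1
        obtain ⟨σ, rfl⟩ := this
        exact ⟨σ, ⟨(hQ _ _).1 hb2, (hQ _ _).1 hb3⟩, rfl⟩
    rw [card_filter_eq, card_filter_eq, ← hr, ← hE, dens_mul, hd1]
  have hd2 : an p q (n + 1) x = dens fr (FixS (Gx K x) (TT p q (n + 1) x)) := by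
    apply dens_unique
    · rintro σ σ' hσ ⟨u, hu, hu'⟩
      refine ⟨u, hu, ?_⟩
      rw [act_eq_iff] at hσ
      rw [← hσ u hu, hu']
    · rintro σ σ' hσ ⟨u, hu, hu'⟩
      exact ⟨u, hu, ((hres hσ).2 u hu).symm.trans hu'⟩
  have hE : fr '' (FixS (Gx K x) (TT p q (n + 1) x)) = {b | ∃ i, ρ b i = i ∧ Q i b} := by
    ext b
    constructor
    · rintro ⟨σ, ⟨u, hu, hu'⟩, rfl⟩
      have hy : (fm p q)^[n] u ∈ TT p q 1 x := by
        change fm p q ((fm p q)^[n] u) = x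
        exact (Function.iterate_succ_apply' (fm p q) n u).symm.trans hu
      refine ⟨⟨_, hy⟩, (hρ' _ _).2 ?_, (hQ _ _).2 ⟨u, rfl, hu'⟩⟩
      change σ.1 ((fm p q)^[n] u) = _
      rw [← fm_iter_map, hu']
    · rintro ⟨y, hy1, hy2⟩
      obtain ⟨σ, rfl⟩ := hsurj b
      obtain ⟨u, hu, hu'⟩ := (hQ _ _).1 hy2
      exact ⟨σ, ⟨u, hsub y.2 hu, hu'⟩, rfl⟩
  have hcard : 0 < (Fintype.card f.range : ℚ) := by exact_mod_cast Fintype.card_pos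
  have hr : (Set.range fr).ncard = Fintype.card f.range := by
    rw [hsurj.range_eq, Set.ncard_univ, Nat.card_eq_fintype_card]
  rw [card_filter_eq, ← hE, dens_mul, ← hd2, hr] at hfin
  have := le_of_mul_le_mul_right hfin hcard
  rw [mul_one_div]
  exact this

theorem an_small (h : RatData p q d) (h1 : NonColl p q d) {x : Ω} (hx : Gen K x)
    (hP : PConst p q 1 x) {ε : ℚ} (hε : 0 < ε) : ∃ n, an p q n x < ε :=
  tendsto_zero (c := 1 / d.factorial) (by have := d.factorial_pos; positivity) (fun n => an_nonneg n x)
    (fun n => an_succ h h1 n hx (fun hy => PConst_all h h1 hx hP n hy)) hε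

end G
end PerProp
end ModG2

section ModT1
open Polynomial

namespace PerProp
section T

theorem ext_hom {A B k : Type*} [CommRing A] [CommRing B] [IsDomain B] [Algebra A B]
    (hinj : Function.Injective (algebraMap A B))
    [Algebra.IsIntegral A B] [Field k] [IsAlgClosed k] (f : A →+* k) :
    ∃ χ : B →+* k, ∀ a, χ (algebraMap A B a) = f a := by
  classical
  have hP : (RingHom.ker f).IsPrime := RingHom.ker_isPrime f
  obtain ⟨Q, -, hQ, hQP⟩ := Ideal.exists_ideal_over_prime_of_isIntegral (S := B) (RingHom.ker f) ⊥ (by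
    intro a ha
    rw [Ideal.mem_comap, Ideal.mem_bot] at ha
    have : a = 0 := hinj (by rw [ha, map_zero])
    rw [this]; exact Ideal.zero_mem _)
  have hcomp : RingHom.ker f ≤ Q.comap (algebraMap A B) := hQP.ge
  let P := RingHom.ker f
  letI : Algebra (A ⧸ P) (B ⧸ Q) := (Ideal.quotientMap Q (algebraMap A B) hcomp).toAlgebra
  letI : Algebra (A ⧸ P) k := (RingHom.kerLift f).toAlgebra
  have hi1 : Function.Injective (algebraMap (A ⧸ P) (B ⧸ Q)) := Ideal.quotientMap_injective' hQP.le
  have hi2 : Function.Injective (algebraMap (A ⧸ P) k) := RingHom.kerLift_injective f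
  haveI : IsDomain (A ⧸ P) := Ideal.Quotient.isDomain P
  haveI : IsDomain (B ⧸ Q) := Ideal.Quotient.isDomain Q
  haveI : FaithfulSMul (A ⧸ P) (B ⧸ Q) := (faithfulSMul_iff_algebraMap_injective _ _).2 hi1
  haveI : FaithfulSMul (A ⧸ P) k := (faithfulSMul_iff_algebraMap_injective _ _).2 hi2
  haveI : Algebra.IsIntegral (A ⧸ P) (B ⧸ Q) := ⟨fun b => by
    obtain ⟨b, rfl⟩ := Ideal.Quotient.mk_surjective b
    obtain ⟨m, hm, hm0⟩ := Algebra.IsIntegral.isIntegral (R := A) b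
    refine ⟨m.map (Ideal.Quotient.mk P), hm.map _, ?_⟩
    rw [eval₂_map]
    have : (algebraMap (A ⧸ P) (B ⧸ Q)).comp (Ideal.Quotient.mk P)
      = (Ideal.Quotient.mk Q).comp (algebraMap A B) := by ext a; rfl
    rw [this, ← Polynomial.hom_eval₂, hm0, map_zero]⟩
  haveI : Algebra.IsAlgebraic (A ⧸ P) (B ⧸ Q) := Algebra.IsIntegral.isAlgebraic
  haveI : Module.IsTorsionFree (A ⧸ P) (B ⧸ Q) := .trans_faithfulSMul (A ⧸ P) (B ⧸ Q) (B ⧸ Q)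
  haveI : Module.IsTorsionFree (A ⧸ P) k := .trans_faithfulSMul (A ⧸ P) k k
  let L : (B ⧸ Q) →ₐ[A ⧸ P] k := IsAlgClosed.lift
  refine ⟨(L : (B ⧸ Q) →+* k).comp (Ideal.Quotient.mk Q), fun a => ?_⟩
  have := L.commutes (Ideal.Quotient.mk P a)
  exact this

universe w
theorem spec {A Ω : Type*} [CommRing A] [IsDomain A] [Field Ω] [Algebra A Ω] [FaithfulSMul A Ω]
    [Algebra.IsAlgebraic A Ω] (Y : Set Ω) (hY : Y.Finite) :
    ∃ g : A, g ≠ 0 ∧ ∃ (R : Subring Ω) (hR : ∀ a : A, algebraMap A Ω a ∈ R), Y ⊆ R ∧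
      (∀ σ : Ω →+* Ω, (∀ a : A, σ (algebraMap A Ω a) = algebraMap A Ω a) → ∀ r ∈ R, σ r ∈ R) ∧
      ∀ (k : Type w) [Field k] [IsAlgClosed k] (f : A →+* k), f g ≠ 0 →
        ∃ χ : R →+* k, ∀ a, χ ⟨algebraMap A Ω a, hR a⟩ = f a := by
  classical
  have hIntg : ∃ g : A, g ≠ 0 ∧ ∀ y ∈ Y, IsIntegral A (g • y) := by
    induction Y, hY using Set.Finite.induction_on with
    | empty => exact ⟨1, one_ne_zero, by simp⟩
    | @insert y Y _ _ ih =>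
      obtain ⟨g, hg, h⟩ := ih
      obtain ⟨g', hg', h'⟩ := (Algebra.IsAlgebraic.isAlgebraic (R := A) y).exists_integral_multiple
      refine ⟨g * g', mul_ne_zero hg hg', ?_⟩
      rintro z (rfl | hz)
      · rw [mul_smul]; exact h'.smul _
      · rw [mul_comm, mul_smul]; exact (h z hz).smul _
  obtain ⟨g, hg, h⟩ := hIntg
  have hinj : Function.Injective (algebraMap A Ω) := FaithfulSMul.algebraMap_injective A Ω
  have hgΩ : algebraMap A Ω g ≠ 0 := fun h0 => hg (hinj (by rw [h0, map_zero]))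
  let A1 := Localization.Away g
  letI : Algebra A1 Ω := (IsLocalization.Away.lift g (S := A1) (g := algebraMap A Ω) hgΩ.isUnit).toAlgebra
  have hA1 : ∀ a, algebraMap A1 Ω (algebraMap A A1 a) = algebraMap A Ω a :=
    fun a => IsLocalization.Away.lift_eq g _ a
  haveI : IsScalarTower A A1 Ω := IsScalarTower.of_algebraMap_eq fun a => (hA1 a).symm
  have hinj1 : Function.Injective (algebraMap A1 Ω) := by
    rw [injective_iff_map_eq_zero]
    intro z hz
    obtain ⟨⟨a, s⟩, has⟩ := IsLocalization.surj (Submonoid.powers g) z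
    have h1 := congrArg (algebraMap A1 Ω) has
    rw [map_mul, hz, zero_mul, hA1] at h1
    have : a = 0 := hinj (by rw [map_zero]; exact h1.symm)
    simp only [this, map_zero] at has
    exact (IsUnit.mul_left_eq_zero (IsLocalization.map_units A1 s)).1 has
  refine ⟨g, hg, (integralClosure A1 Ω).toSubring, fun a => ?_, ?_, ?_, ?_⟩
  · rw [← hA1]; exact (integralClosure A1 Ω).algebraMap_mem _
  · intro y hy
    have h1 : IsIntegral A1 (g • y) := (h y hy).tower_top
    have h2 : y = algebraMap A1 Ω (IsLocalization.Away.invSelf g) * (g • y) := by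
      have h3 := congrArg (algebraMap A1 Ω) (IsLocalization.Away.mul_invSelf (S := A1) g)
      rw [map_mul, hA1, map_one] at h3
      rw [Algebra.smul_def, ← mul_assoc, mul_comm _ (algebraMap A Ω g), h3, one_mul]
    have : IsIntegral A1 y := by
      rw [h2]; exact isIntegral_algebraMap.mul h1
    exact this
  · intro σ hσ r hr
    have hσ1 : ∀ a : A1, σ (algebraMap A1 Ω a) = algebraMap A1 Ω a := by
      have : σ.comp (algebraMap A1 Ω) = algebraMap A1 Ω := by
        apply IsLocalization.ringHom_ext (Submonoid.powers g)
        ext a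
        simp [hA1, hσ]
      exact fun a => congrArg (fun f => f a) this
    obtain ⟨m, hm, hm0⟩ := hr
    refine ⟨m, hm, ?_⟩
    have := congrArg σ hm0
    rw [Polynomial.hom_eval₂, map_zero] at this
    have h4 : σ.comp (algebraMap A1 Ω) = algebraMap A1 Ω := RingHom.ext hσ1
    rwa [h4] at this
  · intro k _ _ f hf
    let f1 : A1 →+* k := IsLocalization.Away.lift g (g := f) hf.isUnit
    obtain ⟨χ, hχ⟩ := ext_hom (A := A1) (B := integralClosure A1 Ω) (by
      intro a b hab
      exact hinj1 (congrArg Subtype.val hab)) f1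
    refine ⟨χ, fun a => ?_⟩
    have h5 := hχ (algebraMap A A1 a)
    have h6 : f1 (algebraMap A A1 a) = f a := IsLocalization.Away.lift_eq g _ a
    rw [h6] at h5
    rw [← h5]
    congr 1
    exact Subtype.ext (hA1 a).symm

end T
end PerProp
end ModT1

section ModT2
open Polynomial

namespace PerProp
section T2

theorem coeff_swap {R : Type*} [CommRing R] (P : R[X][X]) (i j : ℕ) :
    ((Bivariate.swap P).coeff i).coeff j = (P.coeff j).coeff i := by
  induction P using Polynomial.induction_on' with
  | add P Q hP hQ => simp only [map_add, coeff_add, hP, hQ]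
  | monomial n f =>
    induction f using Polynomial.induction_on' with
    | add P Q hP hQ => simp only [map_add, coeff_add, hP, hQ]
    | monomial m r =>
      rw [Bivariate.swap_monomial_monomial]
      simp only [coeff_monomial]
      split_ifs <;> simp_all [coeff_monomial]

theorem tdeg_of_mul {k : Type*} [Field k] {c : ℕ} {G H : k[X][X]} (h0 : G * H ≠ 0)
    (hc : ∀ j, ((G * H).coeff j).natDegree ≤ c) (j : ℕ) : (G.coeff j).natDegree ≤ c := by
  have h1 : (Bivariate.swap (G * H)).natDegree ≤ c := by
    rw [natDegree_le_iff_coeff_eq_zero]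
    intro N hN
    ext l
    rw [coeff_swap, coeff_zero]
    exact coeff_eq_zero_of_natDegree_lt ((hc l).trans_lt hN)
  rw [map_mul, natDegree_mul] at h1
  · rw [natDegree_le_iff_coeff_eq_zero]
    intro N hN
    rw [← coeff_swap, coeff_eq_zero_of_natDegree_lt (p := Bivariate.swap G) (by omega), coeff_zero]
  · intro h; apply h0; rw [(map_eq_zero_iff _ (AlgEquiv.injective _)).1 h, zero_mul]
  · intro h; apply h0; rw [(map_eq_zero_iff _ (AlgEquiv.injective _)).1 h, mul_zero]

/-- the generic monic polynomial -/
noncomputable def gnr {S : Type*} [CommRing S] (a c : ℕ) (v : ℕ → ℕ → S) : S[X][X] :=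
  X ^ a + ∑ j ∈ Finset.range a, C (∑ i ∈ Finset.range (c + 1), C (v i j) * X ^ i) * X ^ j

theorem gnr_map {S S' : Type*} [CommRing S] [CommRing S'] (f : S →+* S') (a c : ℕ) (v : ℕ → ℕ → S) :
    (gnr a c v).map (mapRingHom f) = gnr a c (fun i j => f (v i j)) := by
  simp [gnr, Polynomial.map_sum]

theorem gnr_monic {S : Type*} [CommRing S] [Nontrivial S] (a c : ℕ) (v : ℕ → ℕ → S) :
    (gnr a c v).Monic ∧ (gnr a c v).natDegree = a := by
  have h1 : (∑ j ∈ Finset.range a, C (∑ i ∈ Finset.range (c + 1), C (v i j) * X ^ i) * X ^ j : S[X][X]).degree < a := by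
    refine (degree_sum_le _ _).trans_lt ?_
    refine (Finset.sup_lt_iff (WithBot.bot_lt_coe a)).2 ?_
    intro j hj
    refine (degree_C_mul_X_pow_le _ _).trans_lt ?_
    exact WithBot.coe_lt_coe.2 (Finset.mem_range.1 hj)
  refine ⟨monic_X_pow_add h1, ?_⟩
  unfold gnr
  rw [natDegree_add_eq_left_of_degree_lt (by rwa [degree_X_pow]), natDegree_X_pow]

theorem eq_gnr {S : Type*} [CommRing S] {a c : ℕ} {G : S[X][X]} (hG : G.Monic) (ha : G.natDegree = a)
    (hc : ∀ j, (G.coeff j).natDegree ≤ c) {v : ℕ → ℕ → S}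
    (hv : ∀ i ≤ c, ∀ j < a, v i j = (G.coeff j).coeff i) : G = gnr a c v := by
  conv_lhs => rw [hG.as_sum, ha]
  unfold gnr
  congr 1
  refine Finset.sum_congr rfl fun j hj => ?_
  congr 2
  conv_lhs => rw [(G.coeff j).as_sum_range_C_mul_X_pow' (Nat.lt_succ_of_le (hc j))]
  refine Finset.sum_congr rfl fun i hi => ?_
  rw [hv i (by simpa [Nat.lt_succ_iff] using hi) j (by simpa using hj)]

universe w
theorem irr_aux {O K kb : Type*} [CommRing O] [IsDomain O] [Field K] [Algebra O K] [IsFractionRing O K]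
    [Field kb] [IsAlgClosed kb] [Algebra K kb] {F : O[X][X]}
    (hirr : Irreducible (F.map (mapRingHom ((algebraMap K kb).comp (algebraMap O K))))) (c n a b : ℕ)
    (han : a ≤ n) (hbn : b ≤ n) (ha : 0 < a) (hb : 0 < b) :
    ∃ N : O, N ≠ 0 ∧ ∀ (k : Type w) [Field k] (f : O →+* k), f N ≠ 0 →
      ∀ G H : k[X][X], G.Monic → H.Monic → G.natDegree = a → H.natDegree = b →
        (∀ j, (G.coeff j).natDegree ≤ c) → (∀ j, (H.coeff j).natDegree ≤ c) →
        G * H ≠ F.map (mapRingHom f) := by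
  classical
  let σ := Bool × Fin (c + 1) × Fin (n + 1)
  let w : Bool → ℕ → ℕ → MvPolynomial σ O := fun e i j =>
    MvPolynomial.X (e, Fin.ofNat (c + 1) i, Fin.ofNat (n + 1) j)
  let E : (MvPolynomial σ O)[X][X] := gnr a c (w false) * gnr b c (w true)
    - F.map (mapRingHom MvPolynomial.C)
  let I : Ideal (MvPolynomial σ O) := Ideal.span (Set.range fun z : ℕ × ℕ => (E.coeff z.1).coeff z.2)
  -- value of E
  have hE : ∀ {S : Type _} [CommRing S] (ψ : MvPolynomial σ O →+* S), (∀ i ∈ I, ψ i = 0) →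
      gnr a c (fun i j => ψ (w false i j)) * gnr b c (fun i j => ψ (w true i j))
        = F.map (mapRingHom (ψ.comp MvPolynomial.C)) := by
    intro S _ ψ hψ
    have h1 : E.map (mapRingHom ψ) = 0 := by
      ext j i
      simp only [coeff_map, coe_mapRingHom, coeff_zero]
      exact hψ _ (Ideal.subset_span ⟨(j, i), rfl⟩)
    simp only [E, Polynomial.map_sub, Polynomial.map_mul, gnr_map, Polynomial.map_map, sub_eq_zero,
      mapRingHom_comp] at h1
    exact h1
  have htop : I.map (MvPolynomial.map (algebraMap O K)) = ⊤ := by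
    rw [← Ideal.radical_eq_top, ← MvPolynomial.vanishingIdeal_zeroLocus_eq_radical (K := kb)]
    have : MvPolynomial.zeroLocus kb (I.map (MvPolynomial.map (algebraMap O K))) = ∅ := by
      rw [Set.eq_empty_iff_forall_notMem]
      intro x hx
      rw [MvPolynomial.mem_zeroLocus_iff] at hx
      have h1 := hE ((MvPolynomial.aeval x : MvPolynomial σ K →ₐ[K] kb).toRingHom.comp
        (MvPolynomial.map (algebraMap O K))) (fun i hi => hx _ (Ideal.mem_map_of_mem _ hi))
      have h2 : ((MvPolynomial.aeval x : MvPolynomial σ K →ₐ[K] kb).toRingHom.comp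
        (MvPolynomial.map (algebraMap O K))).comp MvPolynomial.C = (algebraMap K kb).comp (algebraMap O K) := by
        ext r; simp
      rw [h2] at h1
      obtain ⟨m1, d1⟩ := gnr_monic (S := kb) a c (fun i j => ((MvPolynomial.aeval x : MvPolynomial σ K →ₐ[K] kb).toRingHom.comp
        (MvPolynomial.map (algebraMap O K))) (w false i j))
      obtain ⟨m2, d2⟩ := gnr_monic (S := kb) b c (fun i j => ((MvPolynomial.aeval x : MvPolynomial σ K →ₐ[K] kb).toRingHom.comp
        (MvPolynomial.map (algebraMap O K))) (w true i j))
      rw [← h1] at hirr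
      rcases hirr.isUnit_or_isUnit rfl with hu | hu
      · have := m1.eq_one_of_isUnit hu
        rw [this, natDegree_one] at d1; omega
      · have := m2.eq_one_of_isUnit hu
        rw [this, natDegree_one] at d2; omega
    rw [this, MvPolynomial.vanishingIdeal_empty]
  letI : Algebra (MvPolynomial σ O) (MvPolynomial σ K) := MvPolynomial.algebraMvPolynomial
  haveI := MvPolynomial.isLocalization (σ := σ) (nonZeroDivisors O) K
  have h1 : (1 : MvPolynomial σ K) ∈ I.map (algebraMap (MvPolynomial σ O) (MvPolynomial σ K)) := by
    change (1 : MvPolynomial σ K) ∈ I.map (MvPolynomial.map (algebraMap O K))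
    rw [htop]; trivial
  rw [IsLocalization.mem_map_algebraMap_iff ((nonZeroDivisors O).map (MvPolynomial.C (σ := σ)))] at h1
  obtain ⟨⟨⟨i, hi⟩, ⟨s, N, hN, rfl⟩⟩, his⟩ := h1
  rw [one_mul] at his
  have hinj : Function.Injective (algebraMap (MvPolynomial σ O) (MvPolynomial σ K)) :=
    MvPolynomial.map_injective _ (IsFractionRing.injective O K)
  have hiN := hinj his
  simp only at hiN
  refine ⟨N, nonZeroDivisors.ne_zero hN, ?_⟩
  intro k _ f hf G H hG hH hGa hHb hGc hHc hGH
  let x : σ → k := fun z => (((if z.1 then H else G).coeff z.2.2).coeff z.2.1)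
  have hzero : ∀ i ∈ I, MvPolynomial.eval₂Hom f x i = 0 := by
    intro i hi
    have : I ≤ RingHom.ker (MvPolynomial.eval₂Hom f x) := by
      rw [Ideal.span_le]
      rintro _ ⟨⟨j, l⟩, rfl⟩
      have e1 : G = gnr a c (fun i j => MvPolynomial.eval₂Hom f x (w false i j)) := by
        apply eq_gnr hG hGa hGc
        intro i hi j hj
        simp [w, x, Nat.mod_eq_of_lt (show i < c + 1 by omega), Nat.mod_eq_of_lt (show j < n + 1 by omega)]
      have e2 : H = gnr b c (fun i j => MvPolynomial.eval₂Hom f x (w true i j)) := by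
        apply eq_gnr hH hHb hHc
        intro i hi j hj
        simp [w, x, Nat.mod_eq_of_lt (show i < c + 1 by omega), Nat.mod_eq_of_lt (show j < n + 1 by omega)]
      have e3 : E.map (mapRingHom (MvPolynomial.eval₂Hom f x)) = 0 := by
        simp only [E, Polynomial.map_sub, Polynomial.map_mul, gnr_map, Polynomial.map_map, sub_eq_zero,
          mapRingHom_comp]
        rw [← e1, ← e2, hGH]
        congr 2
        ext r; simp
      have := congrArg (fun P => (P.coeff j).coeff l) e3
      simpa only [coeff_map, coe_mapRingHom, coeff_zero, SetLike.mem_coe, RingHom.mem_ker] using this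
    exact this hi
  apply hf
  have := hzero i hi
  rw [← hiN] at this
  simpa using this


theorem irr_transfer {O K kb : Type*} [CommRing O] [IsDomain O] [Field K] [Algebra O K] [IsFractionRing O K]
    [Field kb] [IsAlgClosed kb] [Algebra K kb] {F : O[X][X]} (hF : F.Monic)
    (hirr : Irreducible (F.map (mapRingHom ((algebraMap K kb).comp (algebraMap O K))))) :
    ∃ N : O, N ≠ 0 ∧ ∀ (k : Type w) [Field k] (f : O →+* k), f N ≠ 0 →
      Prime (F.map (mapRingHom f)) := by
  classical
  obtain ⟨c, hc⟩ : ∃ c, ∀ j, (F.coeff j).natDegree ≤ c := by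
    refine ⟨F.support.sup fun j => (F.coeff j).natDegree, fun j => ?_⟩
    by_cases hj : j ∈ F.support
    · exact Finset.le_sup (f := fun j => (F.coeff j).natDegree) hj
    · rw [notMem_support_iff.1 hj]; simp
  have key : ∀ z ∈ Finset.HasAntidiagonal.antidiagonal F.natDegree, ∃ N : O, N ≠ 0 ∧
      (0 < z.1 → 0 < z.2 → ∀ (k : Type w) [Field k] (f : O →+* k), f N ≠ 0 →
      ∀ G H : k[X][X], G.Monic → H.Monic → G.natDegree = z.1 → H.natDegree = z.2 →
        (∀ j, (G.coeff j).natDegree ≤ c) → (∀ j, (H.coeff j).natDegree ≤ c) →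
        G * H ≠ F.map (mapRingHom f)) := by
    intro z hz
    have hz := Finset.HasAntidiagonal.mem_antidiagonal.1 hz
    by_cases h : 0 < z.1 ∧ 0 < z.2
    · obtain ⟨N, hN, h1⟩ := irr_aux hirr c F.natDegree z.1 z.2 (by omega) (by omega) h.1 h.2
      exact ⟨N, hN, fun _ _ => h1⟩
    · exact ⟨1, one_ne_zero, fun h1 h2 => absurd ⟨h1, h2⟩ h⟩
  choose! Nf hN0 hN using key
  refine ⟨∏ z ∈ Finset.HasAntidiagonal.antidiagonal F.natDegree, Nf z, Finset.prod_ne_zero_iff.2 hN0, ?_⟩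
  intro k _ f hf
  rw [map_prod, Finset.prod_ne_zero_iff] at hf
  have hFm : (F.map (mapRingHom f)).Monic := hF.map _
  have hdeg : (F.map (mapRingHom f)).natDegree = F.natDegree := hF.natDegree_map _
  have hc' : ∀ j, ((F.map (mapRingHom f)).coeff j).natDegree ≤ c := fun j => by
    rw [coeff_map]; exact natDegree_map_le.trans (hc j)
  have hF1 : F.map (mapRingHom f) ≠ 1 := by
    intro h
    rw [h, natDegree_one] at hdeg
    have : F = 1 := hF.natDegree_eq_zero.1 hdeg.symm
    rw [this, Polynomial.map_one] at hirr
    exact hirr.not_isUnit isUnit_one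
  rw [← irreducible_iff_prime, hFm.irreducible_iff_natDegree, and_iff_right hF1]
  intro G H hG hH hGH
  by_contra hcon
  push Not at hcon
  have hdd : G.natDegree + H.natDegree = F.natDegree := by
    rw [← hdeg, ← hGH, hG.natDegree_mul hH]
  have hm : (G.natDegree, H.natDegree) ∈ Finset.HasAntidiagonal.antidiagonal F.natDegree :=
    Finset.HasAntidiagonal.mem_antidiagonal.2 hdd
  refine hN _ hm (by simpa using Nat.pos_of_ne_zero hcon.1) (by simpa using Nat.pos_of_ne_zero hcon.2) k f (hf _ hm) G H hG hH rfl rfl ?_ ?_ hGH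
  · exact tdeg_of_mul (hGH ▸ hFm.ne_zero) (hGH ▸ hc')
  · rw [mul_comm] at hGH
    exact tdeg_of_mul (hGH ▸ hFm.ne_zero) (hGH ▸ hc')

end T2
end PerProp
end ModT2

section ModT3
open Polynomial IntermediateField

namespace PerProp
section T3
variable {K Ω : Type*} [Field K] [Field Ω] [Algebra K Ω]

theorem lift_const [CharZero K] [IsAlgClosed Ω] {t : Ω} (ht : Gen K t) {T : Set Ω} (hTf : T.Finite)
    (hst : ∀ τ : Ω ≃ₐ[K] Ω, τ t = t → ∀ u ∈ T, τ u ∈ T)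
    (hconst : ∀ e ∈ adjoin K (insert t T), IsAlgebraic K e → e ∈ (⊥ : IntermediateField K Ω))
    (σ : Ω ≃ₐ[K] Ω) (hσ : σ t = t) :
    ∃ τ : Ω ≃ₐ[K] Ω, τ t = t ∧ (∀ b : Ω, IsAlgebraic K b → τ b = b) ∧ ∀ u ∈ T, τ u = σ u := by
  refine galois_lift ht T {b | IsAlgebraic K b} hTf hst ?_ σ hσ
  let j : LaurentSeries (AlgebraicClosure K) →+* AlgebraicClosure (LaurentSeries (AlgebraicClosure K)) := algebraMap _ _
  letI : Algebra K (AlgebraicClosure (LaurentSeries (AlgebraicClosure K))) :=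
    ((j.comp HahnSeries.C).comp (algebraMap K (AlgebraicClosure K))).toAlgebra
  have hj : ∀ a : K, algebraMap K (AlgebraicClosure (LaurentSeries (AlgebraicClosure K))) a
    = j (HahnSeries.C (algebraMap K (AlgebraicClosure K) a)) := fun a => rfl
  refine simply_connected (k := AlgebraicClosure K) hj ht _ ⟨?_, ?_⟩ ?_ ?_
  · exact subset_adjoin K _ (Set.mem_insert _ _)
  · exact subset_adjoin K _ (Set.mem_insert _ _)
  · intro e he ha
    exact hconst e he.1 ha
  · intro c ψ hψ e he
    refine adjoin_mem_range hj ψ ?_ he.2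
    rintro b (rfl | hb)
    · exact ⟨_, hψ.symm⟩
    · exact const_mem_range hj (hb.algHom ψ)

variable {O : Type*} [CommRing O] [IsDomain O] [Algebra O K] [IsFractionRing O K]

variable (K) in
/-- evaluation of integral polynomials at the parameter -/
noncomputable def evO (O : Type*) [CommRing O] [Algebra O K] (t : Ω) : O[X] →+* Ω :=
  eval₂RingHom ((algebraMap K Ω).comp (algebraMap O K)) t

theorem evO_eq (t : Ω) (a : O[X]) : evO K O t a = aeval t (a.map (algebraMap O K)) := by
  rw [evO, coe_eval₂RingHom, aeval_def, eval₂_map]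

theorem evO_ne {t : Ω} (ht : Transcendental K t) {a : O[X]} (ha : a ≠ 0) : evO K O t a ≠ 0 := by
  rw [evO_eq]
  intro h
  have h1 := (transcendental_iff.1 ht) _ h
  exact ha ((Polynomial.map_eq_zero_iff (IsFractionRing.injective O K)).1 h1)

theorem exists_evO_K (t : Ω) (r : K[X]) : ∃ N : O, N ≠ 0 ∧ ∃ a : O[X],
    evO K O t a = algebraMap K Ω (algebraMap O K N) * aeval t r := by
  obtain ⟨b, hb, h⟩ := IsLocalization.integerNormalization_spec (nonZeroDivisors O) r
  refine ⟨b, nonZeroDivisors.ne_zero hb, IsLocalization.integerNormalization (nonZeroDivisors O) r, ?_⟩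
  rw [evO_eq, h, ← algebraMap_smul K b r, map_smul, Algebra.smul_def]

theorem evO_C (t : Ω) (N : O) : evO K O t (C N) = algebraMap K Ω (algebraMap O K N) := by
  simp [evO]

theorem exists_evO (t : Ω) {z : Ω} (hz : z ∈ K⟮t⟯) : ∃ g : O[X], g ≠ 0 ∧ ∃ a : O[X],
    evO K O t a = evO K O t g * z := by
  by_cases h0 : z = 0
  · exact ⟨1, one_ne_zero, 0, by simp [h0]⟩
  obtain ⟨r, s, rfl⟩ := (mem_adjoin_simple_iff K z).1 hz
  have hs : aeval t s ≠ 0 := fun h => h0 (by rw [h, div_zero])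
  obtain ⟨N, hN, a, ha⟩ := exists_evO_K (O := O) t r
  obtain ⟨M, hM, b, hb⟩ := exists_evO_K (O := O) t s
  have hM' : algebraMap K Ω (algebraMap O K M) ≠ 0 := by
    rw [Ne, map_eq_zero, map_eq_zero_iff _ (IsFractionRing.injective O K)]; exact hM
  have hb0 : b ≠ 0 := by
    rintro rfl
    rw [map_zero] at hb
    exact mul_ne_zero hM' hs hb.symm
  refine ⟨C N * b, mul_ne_zero (C_ne_zero.2 hN) hb0, C M * a, ?_⟩
  rw [map_mul, map_mul, evO_C, evO_C, ha, hb]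
  field_simp

theorem exists_ev2_poly (t θ : Ω) (r : (K⟮t⟯)[X]) : ∃ g : O[X], g ≠ 0 ∧ ∃ s : O[X][X],
    eval₂ (evO K O t) θ s = evO K O t g * aeval θ r := by
  induction r using Polynomial.induction_on' with
  | add P Q hP hQ =>
    obtain ⟨g, hg, s, hs⟩ := hP
    obtain ⟨g', hg', s', hs'⟩ := hQ
    refine ⟨g * g', mul_ne_zero hg hg', C g' * s + C g * s', ?_⟩
    simp only [eval₂_add, eval₂_mul, eval₂_C, hs, hs', map_mul, map_add]
    ring
  | monomial n a =>
    obtain ⟨g, hg, s, hs⟩ := exists_evO (O := O) t a.2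
    refine ⟨g, hg, monomial n s, ?_⟩
    rw [eval₂_monomial, hs, aeval_monomial, mul_assoc]
    rfl

theorem exists_ev2 {t θ : Ω} (ht : Gen K t) {z : Ω} (hz : z ∈ adjoin K⟮t⟯ {θ}) : ∃ g : O[X], g ≠ 0 ∧ ∃ s : O[X][X],
    eval₂ (evO K O t) θ s = evO K O t g * z := by
  have hal : IsAlgebraic K⟮t⟯ θ := ht.alg.isAlgebraic θ
  have h1 : z ∈ (adjoin K⟮t⟯ {θ}).toSubalgebra := hz
  rw [adjoin_simple_toSubalgebra_of_isAlgebraic hal, Algebra.adjoin_singleton_eq_range_aeval] at h1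
  obtain ⟨r, rfl⟩ := h1
  exact exists_ev2_poly t θ r

theorem exists_ev2_set {t θ : Ω} (ht : Gen K t) {S : Set Ω} (hS : S.Finite) (h : ∀ z ∈ S, z ∈ adjoin K⟮t⟯ {θ}) :
    ∃ g : O[X], g ≠ 0 ∧ ∀ z ∈ S, ∃ s : O[X][X], eval₂ (evO K O t) θ s = evO K O t g * z := by
  induction S, hS using Set.Finite.induction_on with
  | empty => exact ⟨1, one_ne_zero, by simp⟩
  | @insert y S _ _ ih =>
    obtain ⟨g, hg, h1⟩ := ih (fun z hz => h z (Or.inr hz))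
    obtain ⟨g', hg', s, hs⟩ := exists_ev2 (O := O) ht (h y (Or.inl rfl))
    refine ⟨g * g', mul_ne_zero hg hg', ?_⟩
    rintro z (rfl | hz)
    · exact ⟨C g * s, by rw [eval₂_mul, eval₂_C, hs, map_mul, mul_assoc]⟩
    · obtain ⟨s', hs'⟩ := h1 z hz
      exact ⟨C g' * s', by rw [eval₂_mul, eval₂_C, hs', map_mul]; ring⟩

theorem exists_evO_set (t : Ω) {S : Set Ω} (hS : S.Finite) (h : ∀ z ∈ S, z ∈ K⟮t⟯) :
    ∃ g : O[X], g ≠ 0 ∧ ∀ z ∈ S, ∃ a : O[X], evO K O t a = evO K O t g * z := by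
  induction S, hS using Set.Finite.induction_on with
  | empty => exact ⟨1, one_ne_zero, by simp⟩
  | @insert y S _ _ ih =>
    obtain ⟨g, hg, h1⟩ := ih (fun z hz => h z (Or.inr hz))
    obtain ⟨g', hg', s, hs⟩ := exists_evO (O := O) t (h y (Or.inl rfl))
    refine ⟨g * g', mul_ne_zero hg hg', ?_⟩
    rintro z (rfl | hz)
    · exact ⟨g * s, by rw [map_mul, hs, map_mul, mul_assoc]⟩
    · obtain ⟨s', hs'⟩ := h1 z hz
      exact ⟨g' * s', by rw [map_mul, hs', map_mul]; ring⟩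

end T3
end PerProp
end ModT3

section ModT3b
open Polynomial IntermediateField

namespace PerProp
section T3
variable {K Ω : Type*} [Field K] [Field Ω] [Algebra K Ω]
variable {O : Type*} [CommRing O] [IsDomain O] [Algebra O K] [IsFractionRing O K]

/-- orbit under automorphisms fixing `t` -/
def Orb (K : Type*) {Ω : Type*} [Field K] [Field Ω] [Algebra K Ω] (t θ : Ω) : Set Ω :=
  {z | ∃ σ : Ω ≃ₐ[K] Ω, σ t = t ∧ σ θ = z}

theorem Orb_finite {t : Ω} (ht : Gen K t) (θ : Ω) : (Orb K t θ).Finite := by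
  have hal : IsIntegral K⟮t⟯ θ := (ht.alg.isAlgebraic θ).isIntegral
  refine Set.Finite.subset ((minpoly K⟮t⟯ θ).rootSet_finite Ω) ?_
  rintro z ⟨σ, h1, rfl⟩
  rw [mem_rootSet_of_ne (minpoly.ne_zero hal)]
  have h2 := congrArg σ (minpoly.aeval K⟮t⟯ θ)
  rw [map_zero, aeval_def, ← AlgEquiv.coe_ringEquiv, ← RingEquiv.coe_toRingHom, Polynomial.hom_eval₂] at h2
  have h3 : ((σ : Ω ≃+* Ω) : Ω →+* Ω).comp (algebraMap K⟮t⟯ Ω) = algebraMap K⟮t⟯ Ω := by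
    ext a
    exact fixed_of_mem_adjoin a.2 σ (by simpa using h1)
  rw [h3] at h2
  exact h2

theorem prim [CharZero K] {t : Ω} (ht : Gen K t) {T : Set Ω} (hTf : T.Finite) :
    ∃ θ : Ω, adjoin K⟮t⟯ {θ} = adjoin K⟮t⟯ T := by
  haveI := ht.alg
  haveI : FiniteDimensional K⟮t⟯ (adjoin K⟮t⟯ T) := by
    haveI := hTf.to_subtype
    exact finiteDimensional_adjoin (fun x _ => (ht.alg.isAlgebraic x).isIntegral)
  obtain ⟨α, hα⟩ := Field.exists_primitive_element K⟮t⟯ (adjoin K⟮t⟯ T)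
  refine ⟨α.1, ?_⟩
  have := congrArg (IntermediateField.map (adjoin K⟮t⟯ T).val) hα
  rw [adjoin_map, Set.image_singleton] at this
  rw [show (α : Ω) = (adjoin K⟮t⟯ T).val α from rfl, this]
  ext z; simp [IntermediateField.mem_map]

theorem orb_poly [CharZero K] [IsAlgClosed Ω] {t : Ω} (ht : Gen K t) (θ : Ω) (i : ℕ) :
    (∏ z ∈ (Orb_finite ht θ).toFinset, (X - C z)).coeff i ∈ K⟮t⟯ := by
  classical
  have h0 := mem_adjoin_of_fixed ht (∅ : Set Ω) (z := (∏ z ∈ (Orb_finite ht θ).toFinset, (X - C z)).coeff i) ?_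
  · simpa using h0
  intro τ hτ _
  have h1 : (∏ z ∈ (Orb_finite ht θ).toFinset, (X - C z)).map (τ : Ω →+* Ω) = ∏ z ∈ (Orb_finite ht θ).toFinset, (X - C z) := by
    rw [Polynomial.map_prod]
    refine Finset.prod_bij (fun z _ => τ z) ?_ ?_ ?_ ?_
    · intro z hz
      simp only [Set.Finite.mem_toFinset] at hz ⊢
      obtain ⟨σ, h1, rfl⟩ := hz
      exact ⟨σ.trans τ, by simp [h1, hτ], rfl⟩
    · intro z _ z' _ h; exact τ.injective h
    · intro z hz
      simp only [Set.Finite.mem_toFinset] at hz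
      obtain ⟨σ, h1, rfl⟩ := hz
      refine ⟨τ.symm (σ θ), ?_, by simp⟩
      simp only [Set.Finite.mem_toFinset]
      exact ⟨σ.trans τ.symm, by simp [h1, AlgEquiv.symm_apply_eq, hτ], rfl⟩
    · intro z hz; simp
  conv_rhs => rw [← h1]
  rw [coeff_map]; rfl

theorem prod_scaleRoots (S : Finset Ω) (γ : Ω) :
    (∏ z ∈ S, (X - C z)).scaleRoots γ = ∏ z ∈ S, (X - C (γ * z)) := by
  classical
  induction S using Finset.induction_on with
  | empty => simp
  | insert a S ha ih =>
    rw [Finset.prod_insert ha, Finset.prod_insert ha, mul_scaleRoots_of_noZeroDivisors, ih, X_sub_C_scaleRoots, mul_comm a]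

/-- all the data attached to a finite Galois-stable set -/
structure GalData (K : Type*) {Ω : Type*} [Field K] [Field Ω] [Algebra K Ω] (O : Type*) [CommRing O] [Algebra O K]
    (t : Ω) (T : Set Ω) where
  θ : Ω
  F : O[X][X]
  g : O[X]
  orb : Finset Ω
  mem_orb : ∀ z, z ∈ orb ↔ ∃ σ : Ω ≃ₐ[K] Ω, σ t = t ∧ σ θ = z
  hF : F.Monic
  F_map : F.map (evO K O t) = ∏ z ∈ orb, (X - C z)
  hθ : ∀ σ τ : Ω ≃ₐ[K] Ω, σ t = t → τ t = t → (σ θ = τ θ ↔ ∀ u ∈ T, σ u = τ u)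
  hg : g ≠ 0
  s : (Ω ≃ₐ[K] Ω) → O[X][X]
  hs : ∀ σ : Ω ≃ₐ[K] Ω, σ t = t → eval₂ (evO K O t) θ (s σ) = evO K O t g * σ θ
  w : Ω → O[X][X]
  hw : ∀ u ∈ T, eval₂ (evO K O t) θ (w u) = evO K O t g * u
  s_cong : ∀ σ τ : Ω ≃ₐ[K] Ω, σ θ = τ θ → s σ = s τ

theorem exists_galData [CharZero K] [IsAlgClosed Ω] {t : Ω} (ht : Gen K t) {T : Set Ω} (hTf : T.Finite)
    (hst : ∀ τ : Ω ≃ₐ[K] Ω, τ t = t → ∀ u ∈ T, τ u ∈ T) : Nonempty (GalData K O t T) := by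
  classical
  obtain ⟨θ', hθ'⟩ := prim ht hTf
  obtain ⟨g1, hg1, hg1'⟩ := exists_evO_set (O := O) t
    (S := (fun i => (∏ z ∈ (Orb_finite ht θ').toFinset, (X - C z)).coeff i) '' (Finset.range ((Orb_finite ht θ').toFinset.card + 1)))
    (Set.Finite.image _ (Finset.finite_toSet _)) (by rintro _ ⟨i, _, rfl⟩; exact orb_poly ht θ' i)
  have hg1Ω := evO_ne (K := K) (Ω := Ω) ht.tr hg1
  set γ := evO K O t g1 with hγ
  have hγt : ∀ σ : Ω ≃ₐ[K] Ω, σ t = t → σ γ = γ := by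
    intro σ hσ
    rw [hγ, evO_eq, ← AlgEquiv.coe_algHom, ← aeval_algHom_apply, AlgEquiv.coe_algHom, hσ]
  have hγK : γ ∈ K⟮t⟯ := by
    rw [hγ, evO_eq]
    exact (mem_adjoin_simple_iff K _).2 ⟨_, 1, by simp; rfl⟩
  let θ := γ * θ'
  have hadj : adjoin K⟮t⟯ {θ} = adjoin K⟮t⟯ T := by
    rw [← hθ']
    apply le_antisymm
    · rw [adjoin_simple_le_iff]
      exact mul_mem ((adjoin K⟮t⟯ {θ'}).algebraMap_mem ⟨γ, hγK⟩) (mem_adjoin_simple_self _ _)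
    · rw [adjoin_simple_le_iff]
      have : θ' = γ⁻¹ * θ := by simp only [θ]; field_simp
      rw [this]
      exact mul_mem (inv_mem ((adjoin K⟮t⟯ {θ}).algebraMap_mem ⟨γ, hγK⟩)) (mem_adjoin_simple_self _ _)
  have hmemθ : ∀ z, z ∈ adjoin K⟮t⟯ {θ} ↔ z ∈ adjoin K {t, θ} := fun z => mem_adjoin_adjoin
  have horb : (Orb_finite ht θ).toFinset = (Orb_finite ht θ').toFinset.image (fun z => γ * z) := by
    ext z
    simp only [Set.Finite.mem_toFinset, Finset.mem_image]
    constructor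
    · rintro ⟨σ, h1, rfl⟩
      exact ⟨σ θ', ⟨σ, h1, rfl⟩, by simp [θ, hγt σ h1]⟩
    · rintro ⟨_, ⟨σ, h1, rfl⟩, rfl⟩
      exact ⟨σ, h1, by simp [θ, hγt σ h1]⟩
  let P := ∏ z ∈ (Orb_finite ht θ).toFinset, (X - C z)
  let P' := ∏ z ∈ (Orb_finite ht θ').toFinset, (X - C z)
  have hPm : P.Monic := monic_prod_X_sub_C _ _
  have hP'm : P'.Monic := monic_prod_X_sub_C _ _
  have hP'd : P'.natDegree = (Orb_finite ht θ').toFinset.card := natDegree_finset_prod_X_sub_C_eq_card _ _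
  have hPP : P = P'.scaleRoots γ := by
    simp only [P, P']
    rw [horb, Finset.prod_image (fun a _ b _ h => mul_left_cancel₀ hg1Ω h), prod_scaleRoots]
  have hlift : P ∈ lifts (evO K O t) := by
    rw [lifts_iff_coeff_lifts]
    intro i
    rw [hPP, coeff_scaleRoots]
    rcases lt_trichotomy i P'.natDegree with h | h | h
    · obtain ⟨a, ha⟩ := hg1' (P'.coeff i) ⟨i, by simp; omega, rfl⟩
      refine ⟨a * g1 ^ (P'.natDegree - i - 1), ?_⟩
      rw [map_mul, map_pow, ha, ← hγ]
      rw [show P'.natDegree - i = (P'.natDegree - i - 1) + 1 by omega, pow_succ]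
      simp only [Nat.add_sub_cancel]
      ring
    · rw [h, hP'm.coeff_natDegree]; exact ⟨1, by simp⟩
    · rw [coeff_eq_zero_of_natDegree_lt h]; exact ⟨0, by simp⟩
  obtain ⟨F, hFP, -, hFm⟩ := lifts_and_natDegree_eq_and_monic hlift hPm
  have hθin : θ ∈ adjoin K (insert t T) := by
    rw [← mem_adjoin_adjoin, ← hadj]; exact mem_adjoin_simple_self _ _
  have hTin : ∀ u ∈ T, u ∈ adjoin K⟮t⟯ {θ} := fun u hu => by
    rw [hadj]; exact subset_adjoin _ _ hu
  have hθiff : ∀ σ τ : Ω ≃ₐ[K] Ω, σ t = t → τ t = t → (σ θ = τ θ ↔ ∀ u ∈ T, σ u = τ u) := by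
    intro σ τ hσ hτ
    constructor
    · intro h u hu
      refine eqOn_adjoin ((hmemθ u).1 (hTin u hu)) σ τ ?_
      rintro b (rfl | rfl)
      · rw [hσ, hτ]
      · exact h
    · intro h
      refine eqOn_adjoin hθin σ τ ?_
      rintro b (rfl | hb)
      · rw [hσ, hτ]
      · exact h b hb
  have hσin : ∀ σ : Ω ≃ₐ[K] Ω, σ t = t → σ θ ∈ adjoin K⟮t⟯ {θ} := by
    intro σ hσ
    rw [hadj, mem_adjoin_adjoin]
    have : adjoin K (insert t T) ≤ (adjoin K (insert t T)).comap (σ : Ω →ₐ[K] Ω) := by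
      rw [adjoin_le_iff]
      rintro b (rfl | hb)
      · change σ b ∈ adjoin K (insert b T)
        rw [hσ]; exact subset_adjoin _ _ (Or.inl rfl)
      · change σ b ∈ adjoin K (insert t T)
        exact subset_adjoin _ _ (Or.inr (hst σ hσ b hb))
    exact this hθin
  obtain ⟨g, hg, hgs⟩ := exists_ev2_set (O := O) ht (S := Orb K t θ ∪ T) ((Orb_finite ht θ).union hTf) (by
    rintro z (⟨σ, h1, rfl⟩ | hz)
    · exact hσin σ h1
    · exact hTin z hz)
  choose! w hw using hgs
  exact ⟨{ θ := θ, F := F, g := g, orb := (Orb_finite ht θ).toFinset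
           mem_orb := fun z => by simp [Orb]
           hF := hFm, F_map := hFP, hθ := hθiff, hg := hg
           s := fun σ => w (σ θ), hs := fun σ hσ => hw _ (Or.inl ⟨σ, hσ, rfl⟩)
           w := w, hw := fun u hu => hw u (Or.inr hu)
           s_cong := fun σ τ h => by rw [h] }⟩


theorem galData_irr [CharZero K] [IsAlgClosed Ω] {t : Ω} (ht : Gen K t) {T : Set Ω} (hTf : T.Finite)
    (hst : ∀ τ : Ω ≃ₐ[K] Ω, τ t = t → ∀ u ∈ T, τ u ∈ T)
    (hconst : ∀ e ∈ adjoin K (insert t T), IsAlgebraic K e → e ∈ (⊥ : IntermediateField K Ω))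
    (G : GalData K O t T) :
    Irreducible (G.F.map (mapRingHom ((algebraMap K (algebraicClosure K Ω)).comp (algebraMap O K)))) := by
  classical
  let kb := algebraicClosure K Ω
  let e : kb[X] →+* Ω := eval₂RingHom (algebraMap kb Ω) t
  have he : e.comp (mapRingHom ((algebraMap K kb).comp (algebraMap O K))) = evO K O t := by
    ext a
    · simp only [e, evO, RingHom.comp_apply, coe_eval₂RingHom, coe_mapRingHom, Polynomial.map_C, eval₂_C]
      rfl
    · simp [e, evO]
  have hmem1 : G.θ ∈ G.orb := (G.mem_orb _).2 ⟨AlgEquiv.refl, rfl, rfl⟩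
  have hdeg : G.F.natDegree = G.orb.card := by
    have := congrArg natDegree G.F_map
    rwa [G.hF.natDegree_map, natDegree_finset_prod_X_sub_C_eq_card] at this
  have hpos : 0 < G.orb.card := Finset.card_pos.2 ⟨_, hmem1⟩
  have hFm : (G.F.map (mapRingHom ((algebraMap K kb).comp (algebraMap O K)))).Monic := G.hF.map _
  have hFd : (G.F.map (mapRingHom ((algebraMap K kb).comp (algebraMap O K)))).natDegree = G.orb.card := by
    rw [G.hF.natDegree_map, hdeg]
  have key : ∀ A B : kb[X][X], A.Monic → B.Monic →
      A * B = G.F.map (mapRingHom ((algebraMap K kb).comp (algebraMap O K))) →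
      eval₂ e G.θ A = 0 → B.natDegree = 0 := by
    intro A B hA hB hAB h0
    have hroot : ∀ z ∈ G.orb, (A.map e).IsRoot z := by
      intro z hz
      obtain ⟨σ, hσ, rfl⟩ := (G.mem_orb z).1 hz
      obtain ⟨τ, hτ, hτc, hτT⟩ := lift_const ht hTf hst hconst σ hσ
      have h1 : τ G.θ = σ G.θ := (G.hθ τ σ hτ hσ).2 hτT
      rw [← h1, IsRoot.def, eval_map]
      have h2 := congrArg ((τ : Ω ≃+* Ω) : Ω →+* Ω) h0
      rw [map_zero, Polynomial.hom_eval₂] at h2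
      have h3 : (((τ : Ω ≃+* Ω) : Ω →+* Ω)).comp e = e := by
        apply Polynomial.ringHom_ext
        · intro a
          simp only [e, RingHom.comp_apply, coe_eval₂RingHom, eval₂_C]
          exact hτc _ (mem_algebraicClosure_iff.1 a.2)
        · simp only [e, RingHom.comp_apply, coe_eval₂RingHom, eval₂_X]
          exact hτ
      rw [h3] at h2
      exact h2
    have h4 : G.orb.card ≤ (A.map e).natDegree :=
      card_le_degree_of_subset_roots (fun z hz => (mem_roots (hA.map e).ne_zero).2 (hroot z hz))
    rw [hA.natDegree_map] at h4
    have h5 : A.natDegree + B.natDegree = G.orb.card := by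
      rw [← hFd, ← hAB, hA.natDegree_mul hB]
    omega
  rw [hFm.irreducible_iff_natDegree]
  refine ⟨fun h => ?_, fun A B hA hB hAB => ?_⟩
  · rw [h, natDegree_one] at hFd; omega
  · have h1 : eval₂ e G.θ A * eval₂ e G.θ B = 0 := by
      rw [← eval₂_mul, hAB, eval₂_map, he, ← eval_map, G.F_map, eval_prod]
      exact Finset.prod_eq_zero hmem1 (by simp)
    rcases mul_eq_zero.1 h1 with h | h
    · exact Or.inr (key A B hA hB hAB h)
    · exact Or.inl (key B A hB hA (by rw [mul_comm, hAB]) h)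

end T3
end PerProp
end ModT3b

section ModT4
open Polynomial IntermediateField

namespace PerProp
section T4
variable {K Ω : Type*} [Field K] [Field Ω] [Algebra K Ω]
variable {O : Type*} [CommRing O] [IsDomain O] [Algebra O K] [IsFractionRing O K]

theorem pen_factor [CharZero K] [IsAlgClosed Ω] {p q : K[X]} {d : ℕ} (h : RatData p q d) {x : Ω} (hx : Gen K x) :
    pen p q x = C (algebraMap K Ω (p.coeff d) - x * algebraMap K Ω (q.coeff d)) *
      ∏ u ∈ (TT_finite h 1 hx).toFinset, (X - C u) := by
  classical
  have h1 : (TT_finite h 1 hx).toFinset = (pen p q x).roots.toFinset := by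
    ext u
    simp only [Set.Finite.mem_toFinset, Multiset.mem_toFinset, mem_roots (pen_ne h hx.tr), mem_TT_one h hx.tr]
  have hnd : (pen p q x).roots.Nodup := by
    rw [Multiset.nodup_iff_count_le_one]
    intro u
    rw [count_roots]
    by_contra hcon
    push Not at hcon
    have := (one_lt_rootMultiplicity_iff_isRoot (pen_ne h hx.tr)).1 hcon
    exact pen_simple h hx this.1 this.2
  have h2 := (IsAlgClosed.splits (pen p q x)).eq_prod_roots
  have h3 : (pen p q x).leadingCoeff = algebraMap K Ω (p.coeff d) - x * algebraMap K Ω (q.coeff d) := by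
    rw [leadingCoeff, pen_natDegree h hx.tr]; simp [pen]
  rw [h3] at h2
  conv_lhs => rw [h2]
  rw [h1, Finset.prod_eq_multiset_prod, Multiset.toFinset_val, hnd.dedup]

/-- the evaluation map into a subring -/
noncomputable def evR (t : Ω) (R : Subring Ω) (hR : ∀ a : O[X], evO K O t a ∈ R) : O[X] →+* R :=
  (evO K O t).codRestrict R hR

theorem coe_evR (t : Ω) (R : Subring Ω) (hR : ∀ a : O[X], evO K O t a ∈ R) (a : O[X]) :
    (evR t R hR a : Ω) = evO K O t a := rfl

theorem chain_step [CharZero K] [IsAlgClosed Ω] {P Q : O[X]} {d : ℕ}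
    (h : RatData (P.map (algebraMap O K)) (Q.map (algebraMap O K)) d)
    {t : Ω} {R : Subring Ω} (hR : ∀ a : O[X], evO K O t a ∈ R)
    {v : Ω} (hv : Gen K v) (hvR : v ∈ R)
    (hpre : ∀ u ∈ TT (P.map (algebraMap O K)) (Q.map (algebraMap O K)) 1 v, u ∈ R)
    (hinv : (algebraMap K Ω (algebraMap O K (P.coeff d)) - v * algebraMap K Ω (algebraMap O K (Q.coeff d)))⁻¹ ∈ R)
    {k : Type*} [Field k] (χ : R →+* k) (a0 : k)
    (ha : (P.map ((χ.comp (evR t R hR)).comp C)).eval a0 = χ ⟨v, hvR⟩ * (Q.map ((χ.comp (evR t R hR)).comp C)).eval a0) :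
    ∃ (u : Ω) (hu : u ∈ TT (P.map (algebraMap O K)) (Q.map (algebraMap O K)) 1 v), χ ⟨u, hpre u hu⟩ = a0 := by
  classical
  set S := (TT_finite h 1 hv).toFinset with hS
  have hSR : ∀ u : S, u.1 ∈ R := fun u => hpre _ ((Set.Finite.mem_toFinset _).1 u.2)
  let c : Ω := algebraMap K Ω (algebraMap O K (P.coeff d)) - v * algebraMap K Ω (algebraMap O K (Q.coeff d))
  have hc0 : c ≠ 0 := by simpa using pencil_ne h hv.tr
  have hPR : ∀ o : O, algebraMap K Ω (algebraMap O K o) = (evR t R hR (C o) : R) := fun o => by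
    rw [coe_evR, evO_C]
  have hcR : c ∈ R := by
    refine R.sub_mem ?_ (R.mul_mem hvR ?_) <;> rw [hPR] <;> exact Subtype.prop _
  have hfac : P.map ((evR t R hR).comp C) - C (⟨v, hvR⟩ : R) * Q.map ((evR t R hR).comp C)
      = C (⟨c, hcR⟩ : R) * ∏ u : S, (X - C (⟨u.1, hSR u⟩ : R)) := by
    apply Polynomial.map_injective R.subtype Subtype.coe_injective
    have hcomp : R.subtype.comp ((evR t R hR).comp C) = (algebraMap K Ω).comp (algebraMap O K) := by
      ext o
      exact (hPR o).symm
    simp only [Polynomial.map_sub, Polynomial.map_mul, Polynomial.map_map, hcomp, Polynomial.map_C,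
      Polynomial.map_prod, Polynomial.map_X, Subring.subtype_apply]
    have := pen_factor h hv
    rw [pen, Polynomial.map_map, Polynomial.map_map] at this
    rw [this]
    simp only [coeff_map]
    congr 1
    rw [← hS, ← Finset.prod_coe_sort]
  have h2 := congrArg (fun A => (A.map χ).eval a0) hfac
  simp only [Polynomial.map_sub, Polynomial.map_mul, Polynomial.map_map, Polynomial.map_C,
      Polynomial.map_prod, Polynomial.map_X, eval_sub, eval_mul, eval_C, eval_prod, eval_X] at h2
  have h3 : χ ⟨c, hcR⟩ ≠ 0 := by
    have : (⟨c, hcR⟩ : R) * ⟨c⁻¹, hinv⟩ = 1 := Subtype.ext (mul_inv_cancel₀ hc0)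
    have := congrArg χ this
    rw [map_mul, map_one] at this
    exact left_ne_zero_of_mul_eq_one this
  rw [← RingHom.comp_assoc, ha, sub_self] at h2
  obtain ⟨u, -, hu⟩ := Finset.prod_eq_zero_iff.1 ((mul_eq_zero.1 h2.symm).resolve_left h3)
  exact ⟨u.1, (Set.Finite.mem_toFinset _).1 u.2, (sub_eq_zero.1 hu).symm⟩

theorem chain_lift [CharZero K] [IsAlgClosed Ω] {P Q : O[X]} {d : ℕ}
    (h : RatData (P.map (algebraMap O K)) (Q.map (algebraMap O K)) d)
    {t : Ω} (ht : Gen K t) {R : Subring Ω} (hR : ∀ a : O[X], evO K O t a ∈ R) (n : ℕ)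
    (hpre : ∀ m ≤ n, ∀ u ∈ TT (P.map (algebraMap O K)) (Q.map (algebraMap O K)) m t, u ∈ R)
    (hinv : ∀ m ≤ n, ∀ v ∈ TT (P.map (algebraMap O K)) (Q.map (algebraMap O K)) m t,
      (algebraMap K Ω (algebraMap O K (P.coeff d)) - v * algebraMap K Ω (algebraMap O K (Q.coeff d)))⁻¹ ∈ R)
    {k : Type*} [Field k] (χ : R →+* k) (f : O →+* k) (hf : (χ.comp (evR t R hR)).comp C = f)
    (u : ℕ → k) (hun : u n = χ (evR t R hR X))
    (hu : ∀ i < n, (P.map f).eval (u i) = u (i + 1) * (Q.map f).eval (u i)) :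
    ∃ (v : Ω) (hv : v ∈ TT (P.map (algebraMap O K)) (Q.map (algebraMap O K)) n t), χ ⟨v, hpre n le_rfl v hv⟩ = u 0 := by
  have key : ∀ m (hm : m ≤ n), ∃ (v : Ω) (hv : v ∈ TT (P.map (algebraMap O K)) (Q.map (algebraMap O K)) m t),
      χ ⟨v, hpre m hm v hv⟩ = u (n - m) := by
    intro m
    induction m with
    | zero =>
      intro hm
      refine ⟨t, rfl, ?_⟩
      rw [Nat.sub_zero, hun]
      congr 1
      exact Subtype.ext (by simp [coe_evR, evO])
    | succ m ih =>
      intro hm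
      obtain ⟨v, hv, hχ⟩ := ih (by omega)
      have hsub : ∀ w ∈ TT (P.map (algebraMap O K)) (Q.map (algebraMap O K)) 1 v,
          w ∈ TT (P.map (algebraMap O K)) (Q.map (algebraMap O K)) (m + 1) t := by
        intro w hw
        change (fm _ _)^[m + 1] w = t
        rw [Function.iterate_succ_apply]
        rw [show fm _ _ w = v from hw]
        exact hv
      obtain ⟨w, hw, hχw⟩ := chain_step h hR (ht.pre hv) (hpre m (by omega) v hv)
        (fun w hw => hpre (m + 1) hm w (hsub w hw)) (hinv m (by omega) v hv) χ (u (n - (m + 1))) (by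
          rw [hf, hχ, hu _ (by omega)]
          congr 2; omega)
      exact ⟨w, hsub w hw, hχw⟩
  obtain ⟨v, hv, hχ⟩ := key n le_rfl
  exact ⟨v, hv, by rw [hχ, Nat.sub_self]⟩

end T4
end PerProp
end ModT4

section ModT4b
open Polynomial IntermediateField

namespace PerProp
section T4
variable {K Ω : Type*} [Field K] [Field Ω] [Algebra K Ω]
variable {O : Type*} [CommRing O] [IsDomain O] [Algebra O K] [IsFractionRing O K]

theorem coe_eval₂_evR (t : Ω) (R : Subring Ω) (hR : ∀ a : O[X], evO K O t a ∈ R) (x : R) (s : O[X][X]) :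
    ((eval₂ (evR t R hR) x s : R) : Ω) = eval₂ (evO K O t) (x : Ω) s := by
  have := Polynomial.hom_eval₂ s (evR t R hR) R.subtype x
  exact this

theorem fix_evO {t : Ω} (σ : Ω ≃ₐ[K] Ω) (hσ : σ t = t) (a : O[X]) : σ (evO K O t a) = evO K O t a := by
  rw [evO_eq, ← AlgEquiv.coe_algHom, ← aeval_algHom_apply, AlgEquiv.coe_algHom, hσ]

theorem F_evR {t : Ω} {T : Set Ω} (G : GalData K O t T) {R : Subring Ω} (hR : ∀ a : O[X], evO K O t a ∈ R)
    (horb : ∀ z ∈ G.orb, z ∈ R) : G.F.map (evR t R hR) = ∏ z : G.orb, (X - C (⟨z.1, horb z.1 z.2⟩ : R)) := by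
  apply Polynomial.map_injective R.subtype Subtype.coe_injective
  rw [Polynomial.map_map, show R.subtype.comp (evR t R hR) = evO K O t from rfl, G.F_map, ← Finset.prod_coe_sort]
  simp [Polynomial.map_prod]

theorem sub_unit {R : Subring Ω} {x y : Ω} (hx : x ∈ R) (hy : y ∈ R) (hxy : x ≠ y) (hi : (x - y)⁻¹ ∈ R) {k : Type*}
    [Field k] (χ : R →+* k) : χ ⟨x, hx⟩ ≠ χ ⟨y, hy⟩ := by
  intro h
  have h1 : ((⟨x, hx⟩ : R) - ⟨y, hy⟩) * ⟨(x - y)⁻¹, hi⟩ = 1 :=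
    Subtype.ext (mul_inv_cancel₀ (sub_ne_zero.2 hxy))
  have h2 := congrArg χ h1
  rw [map_mul, map_sub, h, sub_self, zero_mul, map_one] at h2
  exact zero_ne_one h2

theorem frob {t : Ω} {T : Set Ω} (G : GalData K O t T) {R : Subring Ω} (hR : ∀ a : O[X], evO K O t a ∈ R)
    (hst : ∀ σ : Ω ≃ₐ[K] Ω, σ t = t → ∀ r ∈ R, σ r ∈ R)
    (horb : ∀ z ∈ G.orb, z ∈ R) (hθR : G.θ ∈ R) (hT : ∀ u ∈ T, u ∈ R) {k : Type*} [Field k] (χ : R →+* k)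
    (hg : χ (evR t R hR G.g) ≠ 0)
    (p e : ℕ) [Fact p.Prime] [CharP k p] (hχ : ∀ a : O[X], χ (evR t R hR a) ^ (p ^ e) = χ (evR t R hR a)) :
    ∃ (τ : Ω ≃ₐ[K] Ω) (hτ : τ t = t), χ ⟨G.θ, hθR⟩ ^ (p ^ e) = χ ⟨τ G.θ, hst τ hτ _ hθR⟩ ∧
      ∀ u (hu : u ∈ T), χ ⟨u, hT u hu⟩ ^ (p ^ e) = χ ⟨τ u, hst τ hτ _ (hT u hu)⟩ := by
  classical
  set φ : O[X] →+* k := χ.comp (evR t R hR) with hφ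
  have hfr : (iterateFrobenius k p e).comp φ = φ := by
    apply RingHom.ext
    intro a
    exact hχ a
  have hmem1 : G.θ ∈ G.orb := (G.mem_orb _).2 ⟨AlgEquiv.refl, rfl, rfl⟩
  have hFφ : G.F.map φ = ∏ z : G.orb, (X - C (χ ⟨z.1, horb z.1 z.2⟩)) := by
    rw [hφ, ← Polynomial.map_map, F_evR G hR horb]
    simp [Polynomial.map_prod]
  have h0 : eval₂ φ (χ ⟨G.θ, hθR⟩) G.F = 0 := by
    rw [← eval_map, hFφ, eval_prod]
    exact Finset.prod_eq_zero (Finset.mem_univ ⟨G.θ, hmem1⟩) (by simp)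
  have h1 := congrArg (iterateFrobenius k p e) h0
  rw [Polynomial.hom_eval₂, hfr, map_zero, ← eval_map, hFφ, eval_prod] at h1
  obtain ⟨z, -, hz⟩ := Finset.prod_eq_zero_iff.1 h1
  simp only [eval_sub, eval_X, eval_C, sub_eq_zero] at hz
  obtain ⟨τ, hτ, hτz⟩ := (G.mem_orb z.1).1 z.2
  have hA : χ ⟨G.θ, hθR⟩ ^ (p ^ e) = χ ⟨τ G.θ, hst τ hτ _ hθR⟩ := by
    rw [iterateFrobenius_def] at hz
    rw [hz]; congr 1; exact Subtype.ext hτz.symm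
  refine ⟨τ, hτ, hA, ?_⟩
  intro u hu
  have e1 : eval₂ (evR t R hR) (⟨G.θ, hθR⟩ : R) (G.w u) = evR t R hR G.g * ⟨u, hT u hu⟩ := by
    apply Subtype.ext
    rw [coe_eval₂_evR, G.hw u hu]; rfl
  have e2 : eval₂ (evR t R hR) (⟨τ G.θ, hst τ hτ _ hθR⟩ : R) (G.w u) = evR t R hR G.g * ⟨τ u, hst τ hτ _ (hT u hu)⟩ := by
    apply Subtype.ext
    rw [coe_eval₂_evR]
    have h3 := congrArg ((τ : Ω ≃+* Ω) : Ω →+* Ω) (G.hw u hu)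
    rw [Polynomial.hom_eval₂, map_mul] at h3
    have h4 : ((τ : Ω ≃+* Ω) : Ω →+* Ω).comp (evO K O t) = evO K O t := by
      apply RingHom.ext
      intro a
      exact fix_evO τ hτ a
    rw [h4] at h3
    rw [show ((⟨τ G.θ, hst τ hτ _ hθR⟩ : R) : Ω) = ((τ : Ω ≃+* Ω) : Ω →+* Ω) G.θ from rfl, h3]
    rw [show ((τ : Ω ≃+* Ω) : Ω →+* Ω) (evO K O t G.g) = evO K O t G.g from fix_evO τ hτ _]
    rfl
  have f1 := congrArg (iterateFrobenius k p e) (congrArg χ e1)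
  rw [Polynomial.hom_eval₂, Polynomial.hom_eval₂, ← hφ, hfr, map_mul, map_mul] at f1
  have f2 := congrArg χ e2
  rw [Polynomial.hom_eval₂, ← hφ, map_mul, ← hA] at f2
  rw [iterateFrobenius_def, iterateFrobenius_def, iterateFrobenius_def, f2, hχ] at f1
  exact (mul_left_cancel₀ hg f1).symm

end T4
end PerProp
end ModT4b

section ModT4c
open Polynomial IntermediateField

namespace PerProp
section T4
variable {K Ω : Type*} [Field K] [Field Ω] [Algebra K Ω]
variable {O : Type*} [CommRing O] [IsDomain O] [Algebra O K] [IsFractionRing O K]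

theorem evalEval_mapRH {O k : Type*} [CommRing O] [CommRing k] (f : O →+* k) (H : O[X][X]) (x y : k) :
    (H.map (mapRingHom f)).evalEval x y = eval₂ (eval₂RingHom f x) y H := by
  have h1 : (evalRingHom x).comp (mapRingHom f) = eval₂RingHom f x := by
    apply RingHom.ext
    intro a
    simp [eval_map]
  have h2 := Polynomial.hom_eval₂ H (mapRingHom f) (evalRingHom x) (C y)
  rw [h1] at h2
  rw [evalEval, eval_map]
  simpa using h2

theorem pt_main [CharZero K] [IsAlgClosed Ω] {P Q : O[X]} {d : ℕ}
    (h : RatData (P.map (algebraMap O K)) (Q.map (algebraMap O K)) d) {t : Ω} (ht : Gen K t) (n : ℕ)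
    (G : GalData K O t (TT (P.map (algebraMap O K)) (Q.map (algebraMap O K)) n t))
    {R : Subring Ω} (hR : ∀ a : O[X], evO K O t a ∈ R)
    (hst : ∀ σ : Ω ≃ₐ[K] Ω, σ t = t → ∀ r ∈ R, σ r ∈ R)
    (horb : ∀ z ∈ G.orb, z ∈ R)
    (hpre : ∀ m ≤ n, ∀ u ∈ TT (P.map (algebraMap O K)) (Q.map (algebraMap O K)) m t, u ∈ R)
    (hinv : ∀ m ≤ n, ∀ v ∈ TT (P.map (algebraMap O K)) (Q.map (algebraMap O K)) m t,
      (algebraMap K Ω (algebraMap O K (P.coeff d)) - v * algebraMap K Ω (algebraMap O K (Q.coeff d)))⁻¹ ∈ R)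
    (hTd : ∀ u ∈ TT (P.map (algebraMap O K)) (Q.map (algebraMap O K)) n t,
      ∀ v ∈ TT (P.map (algebraMap O K)) (Q.map (algebraMap O K)) n t, (u - v)⁻¹ ∈ R)
    (hod : ∀ u ∈ G.orb, ∀ v ∈ G.orb, (u - v)⁻¹ ∈ R)
    (hgi : (evO K O t G.g)⁻¹ ∈ R)
    {k : Type*} [Field k] (χ0 : R →+* k) (p e : ℕ) [Fact p.Prime] [CharP k p] (f : O →+* k) (t0 : k)
    (hχ0 : ∀ a, χ0 (evR t R hR a) = eval₂ f t0 a) (ht0 : t0 ^ (p ^ e) = t0) (hf : ∀ a, f a ^ (p ^ e) = f a)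
    (u : ℕ → k) (hun : u n = t0)
    (hu : ∀ i < n, (P.map f).eval (u i) = u (i+1) * (Q.map f).eval (u i)) (hu0 : u 0 ^ (p ^ e) = u 0)
    (z : Ω) (hz : z ∈ G.orb) :
    (G.F.map (mapRingHom f)).evalEval t0 (χ0 ⟨z, horb z hz⟩) = 0 ∧
    (derivative (G.F.map (mapRingHom f))).evalEval t0 (χ0 ⟨z, horb z hz⟩) ≠ 0 ∧
    (G.g.map f).eval t0 ≠ 0 ∧
    ∃ τ : Ω ≃ₐ[K] Ω, τ t = t ∧
      (∃ v ∈ TT (P.map (algebraMap O K)) (Q.map (algebraMap O K)) n t, τ v = v) ∧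
      χ0 ⟨z, horb z hz⟩ ^ (p ^ e) * (G.g.map f).eval t0 =
        ((G.s τ).map (mapRingHom f)).evalEval t0 (χ0 ⟨z, horb z hz⟩) := by
  classical
  have hφ0 : χ0.comp (evR t R hR) = eval₂RingHom f t0 := RingHom.ext hχ0
  have hgz : (G.g.map f).eval t0 ≠ 0 := by
    rw [eval_map, ← hχ0]
    intro h0
    have h1 : (evR t R hR G.g) * ⟨_, hgi⟩ = 1 := by
      apply Subtype.ext
      exact mul_inv_cancel₀ (evO_ne ht.tr G.hg)
    have h2 := congrArg χ0 h1
    rw [map_mul, h0, zero_mul, map_one] at h2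
    exact zero_ne_one h2
  have hFφ : G.F.map (eval₂RingHom f t0) = ∏ z : G.orb, (X - C (χ0 ⟨z.1, horb z.1 z.2⟩)) := by
    rw [← hφ0, ← Polynomial.map_map, F_evR G hR horb]
    simp [Polynomial.map_prod]
  have hinj : Function.Injective (fun z : G.orb => χ0 ⟨z.1, horb z.1 z.2⟩) := by
    intro a b hab
    by_contra hne
    exact sub_unit (horb _ a.2) (horb _ b.2) (fun h => hne (Subtype.ext h)) (hod _ a.2 _ b.2) χ0 hab
  have hroot : eval₂ (eval₂RingHom f t0) (χ0 ⟨z, horb z hz⟩) G.F = 0 := by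
    rw [← eval_map, hFφ, eval_prod]
    exact Finset.prod_eq_zero (Finset.mem_univ ⟨z, hz⟩) (by simp)
  refine ⟨?_, ?_, hgz, ?_⟩
  · rw [evalEval_mapRH, hroot]
  · rw [derivative_map, evalEval_mapRH, ← eval_map, ← derivative_map]
    have hsep : (G.F.map (eval₂RingHom f t0)).Separable := by
      rw [hFφ]
      exact separable_prod_X_sub_C_iff.2 hinj
    have := hsep.eval₂_derivative_ne_zero (RingHom.id k) (x := χ0 ⟨z, horb z hz⟩) (by
      rw [eval₂_id, eval_map]; exact hroot)
    rwa [eval₂_id] at this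
  · obtain ⟨π, hπ, hπz⟩ := (G.mem_orb z).1 hz
    let ρ : R →+* R := (((π : Ω ≃+* Ω) : Ω →+* Ω).comp R.subtype).codRestrict R (fun r => hst π hπ r r.2)
    have hρ : ∀ x (hx : x ∈ R), ρ ⟨x, hx⟩ = ⟨π x, hst π hπ x hx⟩ := fun x hx => rfl
    have hρe : ∀ a, ρ (evR t R hR a) = evR t R hR a := fun a => Subtype.ext (fix_evO π hπ a)
    let χ : R →+* k := χ0.comp ρ
    have hχe : ∀ a, χ (evR t R hR a) = eval₂ f t0 a := fun a => by
      rw [RingHom.comp_apply, hρe, hχ0]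
    have hfr : (iterateFrobenius k p e).comp (eval₂RingHom f t0) = eval₂RingHom f t0 := by
      apply Polynomial.ringHom_ext
      · intro a; simpa [iterateFrobenius_def] using hf a
      · simpa [iterateFrobenius_def] using ht0
    have hθ : G.θ ∈ R := horb _ ((G.mem_orb _).2 ⟨AlgEquiv.refl, rfl, rfl⟩)
    have hθz : χ ⟨G.θ, hθ⟩ = χ0 ⟨z, horb z hz⟩ := by
      rw [RingHom.comp_apply, hρ]; congr 1; exact Subtype.ext hπz
    obtain ⟨τ, hτ, hτθ, hτT⟩ := frob G hR hst horb hθ (hpre n le_rfl) χ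
      (by rw [hχe, ← eval_map]; exact hgz) p e (fun a => by
        rw [hχe]; exact RingHom.congr_fun hfr a)
    obtain ⟨v, hv, hvu⟩ := chain_lift h ht hR n hpre hinv χ f
      (by apply RingHom.ext; intro a; simp [hχe]) u (by rw [hχe, hun]; simp) hu
    refine ⟨τ, hτ, ⟨v, hv, ?_⟩, ?_⟩
    · by_contra hne
      have hτv : τ v ∈ TT (P.map (algebraMap O K)) (Q.map (algebraMap O K)) n t := TT_stab n t τ hτ v hv
      apply sub_unit (hpre n le_rfl _ hτv) (hpre n le_rfl v hv) hne (hTd _ hτv _ hv) χ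
      rw [← hτT v hv, hvu, hu0]
    · have e1 : eval₂ (evR t R hR) (⟨G.θ, hθ⟩ : R) (G.s τ) = evR t R hR G.g * ⟨τ G.θ, hst τ hτ _ hθ⟩ := by
        apply Subtype.ext
        rw [coe_eval₂_evR, G.hs τ hτ]; rfl
      have e2 := congrArg χ e1
      rw [Polynomial.hom_eval₂, map_mul, hχe, ← hτθ, hθz,
        show χ.comp (evR t R hR) = eval₂RingHom f t0 from RingHom.ext hχe] at e2
      rw [evalEval_mapRH, e2, eval_map, mul_comm]

end T4
end PerProp
end ModT4c

section ModT5
open Polynomial IntermediateField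

namespace PerProp
section T5
universe w
variable {K Ω : Type*} [Field K] [Field Ω] [Algebra K Ω]
variable {O : Type*} [CommRing O] [IsDomain O] [Algebra O K] [IsFractionRing O K]

theorem count_comb {k ι : Type*} (Zg : Finset k) (D : ℕ) (Φ : Finset ι) (B : ℕ) (prop : ι → k → k → Prop)
    (hval : ∀ t0 ∈ Zg, ∃ S : Finset k, S.card = D ∧ ∀ y ∈ S, ∃ i ∈ Φ, prop i t0 y)
    (hB : ∀ i ∈ Φ, ∀ Z : Finset (k × k), (∀ z ∈ Z, prop i z.1 z.2) → Z.card ≤ B) :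
    D * Zg.card ≤ Φ.card * B := by
  classical
  have hval' : ∀ t0 : k, ∃ S : Finset k, t0 ∈ Zg → (S.card = D ∧ ∀ y ∈ S, ∃ i ∈ Φ, prop i t0 y) := by
    intro t0
    by_cases ht : t0 ∈ Zg
    · obtain ⟨S, hS⟩ := hval t0 ht
      exact ⟨S, fun _ => hS⟩
    · exact ⟨∅, fun h => absurd h ht⟩
  choose S hS using hval'
  let I : Finset (k × k) := (Zg.sigma S).map (Equiv.sigmaEquivProd k k).toEmbedding
  have hI : I.card = D * Zg.card := by
    rw [Finset.card_map, Finset.card_sigma, Finset.sum_congr rfl (fun t ht => (hS t ht).1), Finset.sum_const,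
      smul_eq_mul, mul_comm]
  have hIsub : I ⊆ Φ.biUnion (fun i => I.filter (fun z => prop i z.1 z.2)) := by
    intro z hz
    have hz0 := hz
    simp only [I, Finset.mem_map, Finset.mem_sigma] at hz
    obtain ⟨⟨a, b⟩, ⟨ha, hb⟩, rfl⟩ := hz
    obtain ⟨i, hi, hp⟩ := (hS a ha).2 b hb
    exact Finset.mem_biUnion.2 ⟨i, hi, Finset.mem_filter.2 ⟨hz0, hp⟩⟩
  rw [← hI]
  refine (Finset.card_le_card hIsub).trans (Finset.card_biUnion_le.trans ?_)
  rw [← smul_eq_mul, ← Finset.sum_const]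
  exact Finset.sum_le_sum fun i hi => hB i hi _ (fun z hz => (Finset.mem_filter.1 hz).2)

theorem alg_evO {t : Ω} (ht : Gen K t) :
    letI := (evO K O t).toAlgebra
    FaithfulSMul O[X] Ω ∧ Algebra.IsAlgebraic O[X] Ω := by
  letI := (evO K O t).toAlgebra
  have hinj : Function.Injective (algebraMap O[X] Ω) := by
    rw [injective_iff_map_eq_zero]
    intro a ha
    by_contra h0
    exact evO_ne ht.tr h0 ha
  have hmem : ∀ a : O[X], evO K O t a ∈ K⟮t⟯ := by
    intro a
    rw [evO_eq, aeval_eq_sum_range]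
    exact sum_mem fun i _ => Subalgebra.smul_mem _ (pow_mem (mem_adjoin_simple_self K t) i) _
  letI a2 : Algebra O[X] K⟮t⟯ := ((evO K O t).codRestrict K⟮t⟯.toSubfield hmem).toAlgebra
  haveI : IsScalarTower O[X] K⟮t⟯ Ω := IsScalarTower.of_algebraMap_eq fun a => rfl
  haveI : Algebra.IsAlgebraic O[X] K⟮t⟯ := by
    constructor
    intro z
    obtain ⟨g, hg, a, ha⟩ := exists_evO (O := O) t z.2
    refine ⟨C g * X - C a, ?_, ?_⟩
    · intro h0
      have := congrArg (fun q => q.coeff 1) h0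
      simp [coeff_C] at this
      exact hg this
    · apply Subtype.ext
      simp only [map_sub, map_mul, aeval_C, aeval_X]
      change evO K O t g * z.1 - evO K O t a = 0
      rw [ha, sub_self]
  haveI := ht.alg
  exact ⟨(faithfulSMul_iff_algebraMap_injective _ _).2 hinj, Algebra.IsAlgebraic.trans O[X] K⟮t⟯ Ω⟩

theorem exists_bd {O : Type*} [CommRing O] (H : O[X][X]) : ∃ c : ℕ, ∀ a b, (c < a ∨ c < b) → (H.coeff b).coeff a = 0 := by
  refine ⟨H.natDegree + H.support.sup (fun b => (H.coeff b).natDegree), ?_⟩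
  rintro a b (h | h)
  · by_cases hb : b ∈ H.support
    · apply coeff_eq_zero_of_natDegree_lt
      have := Finset.le_sup (f := fun b => (H.coeff b).natDegree) hb
      omega
    · rw [notMem_support_iff.1 hb, coeff_zero]
  · rw [coeff_eq_zero_of_natDegree_lt (by omega : H.natDegree < b), coeff_zero]

theorem exists_bd_set {O ι : Type*} [CommRing O] (S : Finset ι) (H : ι → O[X][X]) :
    ∃ c : ℕ, ∀ i ∈ S, ∀ a b, (c < a ∨ c < b) → ((H i).coeff b).coeff a = 0 := by
  choose c hc using fun i => exists_bd (H i)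
  refine ⟨S.sup c, fun i hi a b h => hc i a b ?_⟩
  have := Finset.le_sup (f := c) hi
  omega

end T5
end PerProp
end ModT5

section ModT5b
open Polynomial IntermediateField

namespace PerProp
section T5
universe w
variable {K Ω : Type*} [Field K] [Field Ω] [Algebra K Ω]
variable {O : Type*} [CommRing O] [IsDomain O] [Algebra O K] [IsFractionRing O K]

theorem ncard_rel {Γ A B : Type*} [Nonempty B] (f : Γ → A) (g : Γ → B) (h : ∀ σ τ, f σ = f τ ↔ g σ = g τ) (E : Set Γ) :
    (f '' E).ncard = (g '' E).ncard := by
  let F : A → B := Function.extend f g (fun _ => Classical.arbitrary B)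
  have hF : ∀ σ, F (f σ) = g σ := fun σ =>
    Function.FactorsThrough.extend_apply (fun a b hab => (h a b).1 hab) _ σ
  have h1 : g '' E = F '' (f '' E) := by
    rw [Set.image_image]; simp only [hF]
  rw [h1, Set.ncard_image_of_injOn (f := F)]
  rintro _ ⟨a, -, rfl⟩ _ ⟨b, -, rfl⟩ hab
  rw [hF, hF] at hab
  exact (h a b).2 hab

/-- the orbit elements coming from automorphisms with a fixed point -/
noncomputable def GalData.Phi {t : Ω} {T : Set Ω} (G : GalData K O t T) : Finset Ω :=
  open Classical in G.orb.filter (fun z => ∃ σ : Ω ≃ₐ[K] Ω, σ t = t ∧ σ G.θ = z ∧ ∃ u ∈ T, σ u = u)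

theorem an_eq {P Q : K[X]} {t : Ω} {n : ℕ} (G : GalData K O t (TT P Q n t)) :
    an P Q n t = (G.Phi.card : ℚ) / G.orb.card := by
  classical
  unfold an dens
  have hrel : ∀ σ τ : Gx K t, act (Gx K t) (TT P Q n t) (TT_stab n t) σ = act (Gx K t) (TT P Q n t) (TT_stab n t) τ ↔
      σ.1 G.θ = τ.1 G.θ := fun σ τ => by
    rw [act_eq_iff, G.hθ σ.1 τ.1 σ.2 τ.2]
  have h1 := ncard_rel _ (fun σ : Gx K t => σ.1 G.θ) hrel (FixS (Gx K t) (TT P Q n t))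
  have h2 := ncard_rel _ (fun σ : Gx K t => σ.1 G.θ) hrel Set.univ
  rw [Set.image_univ] at h2
  have e1 : (fun σ : Gx K t => σ.1 G.θ) '' (FixS (Gx K t) (TT P Q n t)) = (G.Phi : Set Ω) := by
    ext z
    simp only [GalData.Phi, FixS, Set.mem_image, Set.mem_setOf_eq, Finset.coe_filter]
    constructor
    · rintro ⟨σ, hσ, rfl⟩
      exact ⟨(G.mem_orb _).2 ⟨σ.1, σ.2, rfl⟩, σ.1, σ.2, rfl, hσ⟩
    · rintro ⟨-, σ, h1, h2, h3⟩
      exact ⟨⟨σ, h1⟩, h3, h2⟩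
  have e2 : (fun σ : Gx K t => σ.1 G.θ) '' Set.univ = (G.orb : Set Ω) := by
    ext z
    simp only [Set.image_univ, Set.mem_range, Finset.mem_coe, G.mem_orb]
    constructor
    · rintro ⟨σ, rfl⟩
      exact ⟨σ.1, σ.2, rfl⟩
    · rintro ⟨σ, h1, h2⟩
      exact ⟨⟨σ, h1⟩, h2⟩
  rw [h1, h2, e1, e2, Set.ncard_coe_finset, Set.ncard_coe_finset]

theorem F_natDegree {t : Ω} {T : Set Ω} (G : GalData K O t T) : G.F.natDegree = G.orb.card := by
  rw [← G.hF.natDegree_map (evO K O t), G.F_map, natDegree_finset_prod_X_sub_C_eq_card]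

theorem orb_pos {t : Ω} {T : Set Ω} (G : GalData K O t T) : 0 < G.orb.card :=
  Finset.card_pos.2 ⟨G.θ, (G.mem_orb _).2 ⟨AlgEquiv.refl, rfl, rfl⟩⟩

theorem bideg_map {O k : Type*} [CommRing O] [Field k] (f : O →+* k) {H : O[X][X]} {c c' : ℕ}
    (hH : ∀ a b, (c < a ∨ c' < b) → (H.coeff b).coeff a = 0) : H.map (mapRingHom f) ∈ bideg k c c' := by
  rw [mem_bideg]
  intro a b h
  rw [coeff_map, coe_mapRingHom, coeff_map, hH a b h, map_zero]

theorem count [CharZero K] [IsAlgClosed Ω] {P Q : O[X]} {d : ℕ}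
    (h : RatData (P.map (algebraMap O K)) (Q.map (algebraMap O K)) d) {t : Ω} (ht : Gen K t) (n : ℕ)
    (hP : PConst (P.map (algebraMap O K)) (Q.map (algebraMap O K)) n t) :
    ∃ N : O, N ≠ 0 ∧ ∃ B : ℕ, ∀ (k : Type w) [Field k] [IsAlgClosed k] (p e : ℕ) [Fact p.Prime] [CharP k p]
      (f : O →+* k), 1 ≤ e → f N ≠ 0 → (∀ a, f a ^ (p ^ e) = f a) → ∀ Z : Finset k,
      (∀ t0 ∈ Z, t0 ^ (p ^ e) = t0 ∧ ∃ u : ℕ → k, u n = t0 ∧ u 0 ^ (p ^ e) = u 0 ∧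
        ∀ i < n, (P.map f).eval (u i) = u (i+1) * (Q.map f).eval (u i)) →
      (Z.card : ℚ) ≤ 3 * an (P.map (algebraMap O K)) (Q.map (algebraMap O K)) n t * p ^ e + B := by
  classical
  set T : ℕ → Set Ω := fun m => TT (P.map (algebraMap O K)) (Q.map (algebraMap O K)) m t with hT
  have hTf : ∀ m, (T m).Finite := fun m => TT_finite h m ht
  have hTst : ∀ σ : Ω ≃ₐ[K] Ω, σ t = t → ∀ u ∈ T n, σ u ∈ T n := fun σ hσ u hu => TT_stab n t σ hσ u hu
  obtain ⟨G⟩ := exists_galData (O := O) ht (hTf n) hTst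
  have hirr := galData_irr ht (hTf n) hTst hP G
  haveI : IsAlgClosed (algebraicClosure K Ω) := (algebraicClosure.isAlgClosure K Ω).isAlgClosed
  obtain ⟨N1, hN1, hprime⟩ := irr_transfer.{w} G.hF hirr
  letI := (evO K O t).toAlgebra
  obtain ⟨i1, i2⟩ := alg_evO (O := O) ht
  set cv : Ω → Ω := fun v => (algebraMap K Ω (algebraMap O K (P.coeff d)) -
    v * algebraMap K Ω (algebraMap O K (Q.coeff d)))⁻¹ with hcv
  set U : Set Ω := ⋃ m ∈ Set.Iic n, T m with hU
  have hUf : U.Finite := (Set.finite_Iic n).biUnion fun m _ => hTf m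
  set Y : Set Ω := (G.orb : Set Ω) ∪ U ∪ cv '' U ∪ Set.image2 (fun u v => (u - v)⁻¹) (T n) (T n) ∪
    Set.image2 (fun u v => (u - v)⁻¹) (G.orb : Set Ω) (G.orb : Set Ω) ∪ {(evO K O t G.g)⁻¹} with hY
  have hYf : Y.Finite :=
    (((((G.orb.finite_toSet.union hUf).union (hUf.image _)).union ((hTf n).image2 _ (hTf n))).union
      (G.orb.finite_toSet.image2 _ G.orb.finite_toSet))).union (Set.finite_singleton _)
  obtain ⟨g0, hg0, R, hR, hYR, hRst, hspec⟩ := spec.{w} (A := O[X]) Y hYf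
  have hUmem : ∀ m ≤ n, ∀ u ∈ T m, u ∈ U := fun m hm u hu => Set.mem_biUnion (Set.mem_Iic.2 hm) hu
  have horb : ∀ z ∈ G.orb, z ∈ R := fun z hz => hYR (Or.inl (Or.inl (Or.inl (Or.inl (Or.inl hz)))))
  have hpre : ∀ m ≤ n, ∀ u ∈ T m, u ∈ R := fun m hm u hu =>
    hYR (Or.inl (Or.inl (Or.inl (Or.inl (Or.inr (hUmem m hm u hu))))))
  have hinv : ∀ m ≤ n, ∀ u ∈ T m, cv u ∈ R := fun m hm u hu =>
    hYR (Or.inl (Or.inl (Or.inl (Or.inr ⟨u, hUmem m hm u hu, rfl⟩))))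
  have hTd : ∀ u ∈ T n, ∀ v ∈ T n, (u - v)⁻¹ ∈ R := fun u hu v hv =>
    hYR (Or.inl (Or.inl (Or.inr ⟨u, hu, v, hv, rfl⟩)))
  have hod : ∀ u ∈ G.orb, ∀ v ∈ G.orb, (u - v)⁻¹ ∈ R := fun u hu v hv =>
    hYR (Or.inl (Or.inr ⟨u, hu, v, hv, rfl⟩))
  have hgi : (evO K O t G.g)⁻¹ ∈ R := hYR (Or.inr rfl)
  have hst : ∀ σ : Ω ≃ₐ[K] Ω, σ t = t → ∀ r ∈ R, σ r ∈ R := fun σ hσ r hr =>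
    hRst ((σ : Ω ≃+* Ω) : Ω →+* Ω) (fun a => fix_evO σ hσ a) r hr
  -- degree bounds
  obtain ⟨c1, hc1⟩ := exists_bd G.F
  have hsel : ∀ y : Ω, ∃ σ : Ω ≃ₐ[K] Ω, y ∈ G.orb → σ G.θ = y := by
    intro y
    by_cases hy : y ∈ G.orb
    · obtain ⟨σ, -, h2⟩ := (G.mem_orb y).1 hy
      exact ⟨σ, fun _ => h2⟩
    · exact ⟨AlgEquiv.refl, fun h => absurd h hy⟩
  choose sel hsel using hsel
  obtain ⟨c2, hc2⟩ := exists_bd_set G.orb (fun y => G.s (sel y))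
  set c := c1 + c2 + G.g.natDegree with hc
  obtain ⟨δ, hδ⟩ : ∃ δ, G.orb.card = δ + 1 := ⟨G.orb.card - 1, by have := orb_pos G; omega⟩
  haveI : CharZero O := (algebraMap O K).charZero_iff (IsFractionRing.injective O K) |>.2 inferInstance
  refine ⟨N1 * g0.leadingCoeff * ((stQ c δ).factorial : O), ?_, g0.natDegree, ?_⟩
  · exact mul_ne_zero (mul_ne_zero hN1 (leadingCoeff_ne_zero.2 hg0)) (Nat.cast_ne_zero.2 (Nat.factorial_ne_zero _))
  intro k _ _ p e _ _ f he hfN hfq Z hZ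
  rw [map_mul, map_mul, map_natCast] at hfN
  have hn1 : f N1 ≠ 0 := fun h => hfN (by rw [h]; simp)
  have hn2 : f g0.leadingCoeff ≠ 0 := fun h => hfN (by rw [h]; simp)
  have hn3 : ((stQ c δ).factorial : k) ≠ 0 := fun h => hfN (by rw [h]; simp)
  have hpQ : stQ c δ ≤ p := by
    by_contra hlt
    push Not at hlt
    exact hn3 ((CharP.cast_eq_zero_iff k p _).2 (Nat.dvd_factorial (Fact.out : p.Prime).pos hlt.le))
  have hg0f : g0.map f ≠ 0 := by
    intro h0
    have := congrArg (fun r => r.coeff g0.natDegree) h0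
    simp only [coeff_map, coeff_zero] at this
    exact hn2 this
  set Zg := Z.filter (fun t0 => (g0.map f).eval t0 ≠ 0) with hZg
  have hbad : (Z.filter (fun t0 => ¬ (g0.map f).eval t0 ≠ 0)).card ≤ g0.natDegree := by
    refine le_trans (Finset.card_le_card (t := (g0.map f).roots.toFinset) ?_)
      ((Multiset.toFinset_card_le _).trans ((card_roots' _).trans natDegree_map_le))
    intro x hx
    rw [Finset.mem_filter, not_not] at hx
    rw [Multiset.mem_toFinset, mem_roots hg0f]
    exact hx.2
  have hcard : Z.card = Zg.card + (Z.filter (fun t0 => ¬ (g0.map f).eval t0 ≠ 0)).card :=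
    (Finset.card_filter_add_card_filter_not _).symm
  have hmain : G.orb.card * Zg.card ≤ G.Phi.card * (3 * p ^ e) := by
    apply count_comb Zg G.orb.card G.Phi (3 * p ^ e) (fun y t0 θ0 => t0 ^ (p ^ e) = t0 ∧
      (G.F.map (mapRingHom f)).evalEval t0 θ0 = 0 ∧ (derivative (G.F.map (mapRingHom f))).evalEval t0 θ0 ≠ 0 ∧
      (G.g.map f).eval t0 ≠ 0 ∧ θ0 ^ (p ^ e) * (G.g.map f).eval t0 =
        ((G.s (sel y)).map (mapRingHom f)).evalEval t0 θ0)
    · intro t0 ht0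
      obtain ⟨htZ, htg⟩ := Finset.mem_filter.1 ht0
      obtain ⟨htq, u, hun, hu0, hu⟩ := hZ t0 htZ
      obtain ⟨χ0, hχ0⟩ := hspec k (eval₂RingHom f t0) (by simpa [eval_map] using htg)
      have hinj : Function.Injective (fun z : G.orb => χ0 ⟨z.1, horb z.1 z.2⟩) := by
        intro a b hab
        by_contra hne
        exact sub_unit (horb _ a.2) (horb _ b.2) (fun h => hne (Subtype.ext h)) (hod _ a.2 _ b.2) χ0 hab
      refine ⟨Finset.univ.map ⟨_, hinj⟩, by rw [Finset.card_map, Finset.card_univ, Fintype.card_coe], ?_⟩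
      intro y hy
      obtain ⟨z, -, rfl⟩ := Finset.mem_map.1 hy
      obtain ⟨q1, q2, q3, τ, hτ, hτv, q4⟩ := pt_main h ht n G hR hst horb hpre hinv hTd hod hgi χ0 p e f t0
        hχ0 htq hfq u hun hu hu0 z.1 z.2
      have hτo : τ G.θ ∈ G.orb := (G.mem_orb _).2 ⟨τ, hτ, rfl⟩
      refine ⟨τ G.θ, Finset.mem_filter.2 ⟨hτo, τ, hτ, rfl, hτv⟩, htq, q1, q2, q3, ?_⟩
      rw [G.s_cong _ _ (hsel _ hτo)]
      exact q4
    · intro y hy Z' hZ'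
      have hyo : y ∈ G.orb := (Finset.mem_filter.1 hy).1
      have hdeg : (G.F.map (mapRingHom f)).natDegree = δ + 1 := by
        rw [G.hF.natDegree_map, F_natDegree, hδ]
      refine stepanov p e he (c := c) (δ := δ) hpQ (G.hF.map _) (hprime k f hn1) hdeg ?_
        (s := (G.s (sel y)).map (mapRingHom f)) ?_ (g := G.g.map f) (natDegree_map_le.trans (by omega)) Z' hZ'
      · apply bideg_map
        rintro a b (h' | h')
        · exact hc1 a b (Or.inl (by omega))
        · rw [coeff_eq_zero_of_natDegree_lt (p := G.F) (n := b) (by rw [F_natDegree]; omega), coeff_zero]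
      · exact bideg_map f fun a b h' => hc2 y hyo a b (by omega)
  have hD : (0 : ℚ) < G.orb.card := by exact_mod_cast orb_pos G
  rw [an_eq G, hcard]
  push_cast
  have h1 : (Zg.card : ℚ) ≤ 3 * (G.Phi.card / G.orb.card) * p ^ e := by
    rw [show (3 * (G.Phi.card / G.orb.card) * p ^ e : ℚ) = (G.Phi.card * (3 * p ^ e)) / G.orb.card by ring,
      le_div_iff₀ hD, mul_comm]
    exact_mod_cast hmain
  have h2 : ((Z.filter (fun t0 => ¬ (g0.map f).eval t0 ≠ 0)).card : ℚ) ≤ g0.natDegree := by exact_mod_cast hbad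
  linarith

end T5
end PerProp
end ModT5b

section ModV1
open Polynomial IntermediateField

namespace PerProp
section V1
universe w
variable {κ : Type*} [Field κ] {p q : κ[X]} {d : ℕ}

theorem phih_some (hp : p.natDegree ≤ d) (hq : q.natDegree ≤ d) {c c' : κ}
    (h : phih p q d (some c) = some c') : p.eval c = c' * q.eval c := by
  rw [phih, homEval2_one hp, homEval2_one hq] at h
  by_cases h0 : q.eval c = 0
  · rw [h0, prj_zero] at h; cases h
  · rw [prj_ne h0, Option.some.injEq] at h
    rw [← h, div_mul_cancel₀ _ h0]

theorem per_chain (hp : p.natDegree ≤ d) (hq : q.natDegree ≤ d) (n : ℕ) {x : Option κ} {m : ℕ} (hm : 0 < m)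
    (hx : (phih p q d)^[m] x = x) (hb : ∀ i ≤ n, (phih p q d)^[i] none ≠ x) :
    ∃ c : ℕ → κ, x = some (c n) ∧ ∀ i < n, p.eval (c i) = c (i+1) * q.eval (c i) := by
  set φ := phih p q d with hφ
  have hx' : ∀ j, φ^[m * j] x = x := by
    intro j
    rw [Function.iterate_mul]
    exact Function.iterate_fixed hx j
  have hmn : n ≤ m * n := Nat.le_mul_of_pos_left n hm
  have hu : ∀ i ≤ n, φ^[n - i] (φ^[m * n - n + i] x) = x := by
    intro i hi
    rw [← Function.iterate_add_apply, show n - i + (m * n - n + i) = m * n by omega, hx']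
  have hc : ∀ i, ∃ c : κ, i ≤ n → φ^[m * n - n + i] x = some c := by
    intro i
    by_cases hi : i ≤ n
    · rcases hz : φ^[m * n - n + i] x with _ | c
      · exfalso
        have := hu i hi
        rw [hz] at this
        exact hb (n - i) (by omega) this
      · exact ⟨c, fun _ => rfl⟩
    · exact ⟨0, fun h => absurd h hi⟩
  choose c hc using hc
  refine ⟨c, ?_, ?_⟩
  · rw [← hc n le_rfl, show m * n - n + n = m * n by omega, hx']
  · intro i hi
    apply phih_some hp hq
    rw [← hc i hi.le, ← hc (i+1) hi, ← add_assoc, Function.iterate_succ_apply']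

theorem per_card [Finite κ] (hp : p.natDegree ≤ d) (hq : q.natDegree ≤ d) (n : ℕ) :
    {x : Option κ | ∃ m, 0 < m ∧ (phih p q d)^[m] x = x}.ncard ≤ (n + 1) +
      {t0 : κ | ∃ c : ℕ → κ, c n = t0 ∧ ∀ i < n, p.eval (c i) = c (i+1) * q.eval (c i)}.ncard := by
  classical
  set Z := {t0 : κ | ∃ c : ℕ → κ, c n = t0 ∧ ∀ i < n, p.eval (c i) = c (i+1) * q.eval (c i)}
  set B : Finset (Option κ) := (Finset.range (n+1)).image (fun i => (phih p q d)^[i] none) with hB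
  have hsub : {x : Option κ | ∃ m, 0 < m ∧ (phih p q d)^[m] x = x} ⊆ (B : Set (Option κ)) ∪ some '' Z := by
    rintro x ⟨m, hm, hx⟩
    by_cases hb : ∃ i ≤ n, (phih p q d)^[i] none = x
    · obtain ⟨i, hi, rfl⟩ := hb
      left
      exact Finset.mem_coe.2 (Finset.mem_image.2 ⟨i, Finset.mem_range.2 (by omega), rfl⟩)
    · push Not at hb
      obtain ⟨c, h1, h2⟩ := per_chain hp hq n hm hx hb
      right
      exact ⟨c n, ⟨c, rfl, h2⟩, h1.symm⟩
  refine (Set.ncard_le_ncard hsub (Set.toFinite _)).trans ((Set.ncard_union_le _ _).trans (add_le_add ?_ ?_))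
  · rw [Set.ncard_coe_finset]
    exact Finset.card_image_le.trans (by simp)
  · exact Set.ncard_image_le (Set.toFinite _)

/-- the coordinate map -/
noncomputable def hmap (p q : κ[X]) (d : ℕ) (w : κ × κ) : κ × κ := (homEval2 p d w.1 w.2, homEval2 q d w.1 w.2)

theorem hmap_iter (hN : NoZ p q d) {v : κ × κ} (hv : v.1 ≠ 0 ∨ v.2 ≠ 0) (m : ℕ) :
    (((hmap p q d)^[m] v).1 ≠ 0 ∨ ((hmap p q d)^[m] v).2 ≠ 0) ∧
    (phih p q d)^[m] (prj v.1 v.2) = prj ((hmap p q d)^[m] v).1 ((hmap p q d)^[m] v).2 := by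
  induction m with
  | zero => exact ⟨hv, rfl⟩
  | succ m ih =>
    rw [Function.iterate_succ_apply', Function.iterate_succ_apply', ih.2, phih_prj p q d ih.1]
    exact ⟨hN _ _ ih.1, rfl⟩

/-- from coordinates to projectivization -/
noncomputable def toP : Option κ → Projectivization κ (κ × κ)
  | some a => Projectivization.mk κ (a, 1) (by simp)
  | none => Projectivization.mk κ (1, 0) (by simp)

theorem toP_prj (v : κ × κ) (hv : v ≠ 0) : toP (prj v.1 v.2) = Projectivization.mk κ v hv := by
  by_cases h0 : v.2 = 0
  · have h1 : v.1 ≠ 0 := fun h => hv (Prod.ext h h0)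
    rw [h0, prj_zero, toP, Projectivization.mk_eq_mk_iff']
    exact ⟨v.1⁻¹, Prod.ext (by simp [h1]) (by simp [h0])⟩
  · rw [prj_ne h0, toP, Projectivization.mk_eq_mk_iff']
    exact ⟨v.2⁻¹, Prod.ext (by simp [div_eq_inv_mul]) (by simp [h0])⟩

theorem proj_card [Finite κ] (hN : NoZ p q d) :
    {x : Projectivization κ (κ × κ) | ∃ (v : κ × κ) (hv : v ≠ 0), Projectivization.mk κ v hv = x ∧
      ∃ m : ℕ, 0 < m ∧ ∃ c : κ, c ≠ 0 ∧ (fun w : κ × κ => (homEval2 p d w.1 w.2, homEval2 q d w.1 w.2))^[m] v = c • v}.ncard ≤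
    {x : Option κ | ∃ m, 0 < m ∧ (phih p q d)^[m] x = x}.ncard := by
  refine le_trans (Set.ncard_le_ncard (t := toP '' {x : Option κ | ∃ m, 0 < m ∧ (phih p q d)^[m] x = x}) ?_ (Set.toFinite _))
    (Set.ncard_image_le (Set.toFinite _))
  rintro x ⟨v, hv, rfl, m, hm, c, hc, hcv⟩
  refine ⟨prj v.1 v.2, ⟨m, hm, ?_⟩, toP_prj v hv⟩
  have hv' : v.1 ≠ 0 ∨ v.2 ≠ 0 := by
    by_contra hcon
    push Not at hcon
    exact hv (Prod.ext hcon.1 hcon.2)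
  rw [(hmap_iter hN hv' m).2]
  change prj (((fun w : κ × κ => (homEval2 p d w.1 w.2, homEval2 q d w.1 w.2))^[m] v).1) (((fun w : κ × κ => (homEval2 p d w.1 w.2, homEval2 q d w.1 w.2))^[m] v).2) = _
  rw [hcv]
  exact prj_smul hc _ _

theorem per_bound {K Ω : Type*} [Field K] [Field Ω] [Algebra K Ω]
    {O : Type*} [CommRing O] [IsDomain O] [Algebra O K] [IsFractionRing O K]
    [CharZero K] [IsAlgClosed Ω] {P Q : O[X]} {d : ℕ} (hPd : P.natDegree ≤ d) (hQd : Q.natDegree ≤ d)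
    (h : RatData (P.map (algebraMap O K)) (Q.map (algebraMap O K)) d) {t : Ω} (ht : Gen K t) (n : ℕ)
    (hP : PConst (P.map (algebraMap O K)) (Q.map (algebraMap O K)) n t) :
    ∃ N : O, N ≠ 0 ∧ ∃ B : ℕ, ∀ (κ : Type w) [Field κ] [Finite κ] (f : O →+* κ), f N ≠ 0 →
      NoZ (P.map f) (Q.map f) d →
      ({x : Projectivization κ (κ × κ) | ∃ (v : κ × κ) (hv : v ≠ 0), Projectivization.mk κ v hv = x ∧
      ∃ m : ℕ, 0 < m ∧ ∃ c : κ, c ≠ 0 ∧ (fun w : κ × κ => (homEval2 (P.map f) d w.1 w.2, homEval2 (Q.map f) d w.1 w.2))^[m] v = c • v}.ncard : ℚ)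
      ≤ 3 * an (P.map (algebraMap O K)) (Q.map (algebraMap O K)) n t * Nat.card κ + B := by
  classical
  obtain ⟨N, hN, B, hB⟩ := count.{w} h ht n hP
  refine ⟨N, hN, B + (n + 1), ?_⟩
  intro κ _ _ f hf hNo
  letI := Fintype.ofFinite κ
  obtain ⟨p, hp⟩ := CharP.exists κ
  haveI : Fact p.Prime := ⟨CharP.char_is_prime κ p⟩
  obtain ⟨e, -, he⟩ := FiniteField.card κ p
  haveI : CharP (AlgebraicClosure κ) p := charP_of_injective_algebraMap (algebraMap κ (AlgebraicClosure κ)).injective p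
  have hcard : Nat.card κ = p ^ (e : ℕ) := by rw [Nat.card_eq_fintype_card, he]
  have hfr : ∀ a : κ, a ^ (p ^ (e : ℕ)) = a := fun a => by rw [← he]; exact FiniteField.pow_card a
  have h1 := (proj_card hNo).trans (per_card (natDegree_map_le.trans hPd) (natDegree_map_le.trans hQd) n)
  set ι := algebraMap κ (AlgebraicClosure κ) with hι
  set Z := {t0 : κ | ∃ c : ℕ → κ, c n = t0 ∧ ∀ i < n, (P.map f).eval (c i) = c (i+1) * (Q.map f).eval (c i)} with hZ
  have h2 := hB (AlgebraicClosure κ) p e (ι.comp f) e.2 (by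
    rw [RingHom.comp_apply]; exact (map_ne_zero_iff ι ι.injective).2 hf) (fun a => by
    rw [RingHom.comp_apply, ← map_pow, hfr]) (Z.toFinset.map ⟨ι, ι.injective⟩) (by
      intro t0 ht0
      obtain ⟨a, ha, rfl⟩ := Finset.mem_map.1 ht0
      obtain ⟨c, hc1, hc2⟩ := Set.mem_toFinset.1 ha
      refine ⟨by simp only [Function.Embedding.coeFn_mk]; rw [← map_pow, hfr], fun i => ι (c i), by simp [hc1], by rw [← map_pow, hfr], ?_⟩
      intro i hi
      rw [← Polynomial.map_map, ← Polynomial.map_map, eval_map_apply, eval_map_apply, hc2 i hi, map_mul])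
  rw [Finset.card_map, ← Set.ncard_eq_toFinset_card'] at h2
  have h3 : (_ : ℚ) ≤ ((n + 1 + Z.ncard : ℕ) : ℚ) := Nat.cast_le.2 h1
  refine h3.trans ?_
  rw [hcard]
  push_cast
  linarith

end V1
end PerProp
end ModV1

section ModW1
open Polynomial IntermediateField

namespace PerProp
section W1
variable {K : Type*} [Field K]

/-- the generic point -/
noncomputable def tgen (K : Type*) [Field K] : AlgebraicClosure (RatFunc K) :=
  algebraMap (RatFunc K) (AlgebraicClosure (RatFunc K)) RatFunc.X

theorem gen_tgen : Gen K (tgen K) := by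
  have hmem : ∀ x : RatFunc K, algebraMap (RatFunc K) (AlgebraicClosure (RatFunc K)) x ∈ K⟮tgen K⟯ := by
    intro x
    have hpol : ∀ r : K[X], algebraMap (RatFunc K) (AlgebraicClosure (RatFunc K)) (algebraMap K[X] (RatFunc K) r) ∈ K⟮tgen K⟯ := by
      intro r
      induction r using Polynomial.induction_on' with
      | add a b ha hb => rw [map_add, map_add]; exact add_mem ha hb
      | monomial n a =>
        rw [← C_mul_X_pow_eq_monomial, map_mul, map_mul, map_pow, map_pow, RatFunc.algebraMap_C, RatFunc.algebraMap_X]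
        refine mul_mem ?_ (pow_mem (mem_adjoin_simple_self K _) n)
        have : algebraMap (RatFunc K) (AlgebraicClosure (RatFunc K)) (RatFunc.C a) = algebraMap K (AlgebraicClosure (RatFunc K)) a := by
          rw [IsScalarTower.algebraMap_apply K (RatFunc K) (AlgebraicClosure (RatFunc K))]; rfl
        rw [this]
        exact IntermediateField.algebraMap_mem _ a
    obtain ⟨a, b, hb, rfl⟩ := IsFractionRing.div_surjective (A := K[X]) x
    rw [map_div₀]
    exact div_mem (hpol a) (hpol b)
  refine ⟨?_, ?_⟩
  · exact (transcendental_algebraMap_iff (algebraMap (RatFunc K) (AlgebraicClosure (RatFunc K))).injective).2 RatFunc.transcendental_X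
  · letI : Algebra (RatFunc K) K⟮tgen K⟯ := ((algebraMap (RatFunc K) (AlgebraicClosure (RatFunc K))).codRestrict K⟮tgen K⟯.toSubfield hmem).toAlgebra
    haveI : IsScalarTower (RatFunc K) K⟮tgen K⟯ (AlgebraicClosure (RatFunc K)) := IsScalarTower.of_algebraMap_eq fun a => rfl
    exact Algebra.IsAlgebraic.tower_top (K := RatFunc K) K⟮tgen K⟯

theorem pconst_one {p q : K[X]} {d : ℕ} (h : RatData p q d)
    (h2 : ∀ x : (phiMinusT p q).SplittingField,
      (∃ g : Polynomial K, g ≠ 0 ∧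
        Polynomial.eval₂ ((algebraMap (RatFunc K) (phiMinusT p q).SplittingField).comp
            (algebraMap K (RatFunc K))) x g = 0) →
      x ∈ Set.range ((algebraMap (RatFunc K) (phiMinusT p q).SplittingField).comp
        (algebraMap K (RatFunc K)))) : PConst p q 1 (tgen K) := by
  let ψ : (phiMinusT p q).SplittingField →ₐ[RatFunc K] AlgebraicClosure (RatFunc K) := IsAlgClosed.lift
  have hcomp : (ψ : (phiMinusT p q).SplittingField →+* AlgebraicClosure (RatFunc K)).comp
      ((algebraMap (RatFunc K) (phiMinusT p q).SplittingField).comp (algebraMap K (RatFunc K))) =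
      algebraMap K (AlgebraicClosure (RatFunc K)) := by
    apply RingHom.ext
    intro a
    rw [RingHom.comp_apply, RingHom.comp_apply, IsScalarTower.algebraMap_apply K (RatFunc K) (AlgebraicClosure (RatFunc K))]
    exact ψ.commutes _
  have hpen : (phiMinusT p q).map (algebraMap (RatFunc K) (AlgebraicClosure (RatFunc K))) = pen p q (tgen K) := by
    unfold phiMinusT pen tgen
    rw [Polynomial.map_sub, Polynomial.map_mul, map_C, Polynomial.map_map, Polynomial.map_map,
      ← IsScalarTower.algebraMap_eq]
  have hne : phiMinusT p q ≠ 0 := by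
    intro h0
    rw [h0, Polynomial.map_zero] at hpen
    exact pen_ne h gen_tgen.tr hpen.symm
  have hle : adjoin K (insert (tgen K) (TT p q 1 (tgen K))) ≤ ψ.fieldRange.restrictScalars K := by
    rw [adjoin_le_iff]
    intro u hu
    rw [SetLike.mem_coe, IntermediateField.mem_restrictScalars]
    rcases hu with rfl | hu
    · exact ⟨algebraMap _ _ RatFunc.X, ψ.commutes _⟩
    · rw [mem_TT_one h gen_tgen.tr, ← hpen] at hu
      have hs := (SplittingField.splits (phiMinusT p q))
      have hmm : ((phiMinusT p q).map (algebraMap (RatFunc K) (phiMinusT p q).SplittingField)).map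
        (ψ : (phiMinusT p q).SplittingField →+* AlgebraicClosure (RatFunc K)) =
          (phiMinusT p q).map (algebraMap (RatFunc K) (AlgebraicClosure (RatFunc K))) := by
        rw [Polynomial.map_map]
        congr 1
        exact ψ.comp_algebraMap
      rw [← hmm] at hu
      have := hs.mem_range_of_isRoot ((Polynomial.map_ne_zero_iff (algebraMap (RatFunc K) (phiMinusT p q).SplittingField).injective).2 hne) hu
      exact this
  intro e he halg
  obtain ⟨x, rfl⟩ := hle he
  obtain ⟨g, hg, hge⟩ := halg
  obtain ⟨a, ha⟩ := h2 x ⟨g, hg, by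
    apply (ψ : (phiMinusT p q).SplittingField →+* AlgebraicClosure (RatFunc K)).injective
    rw [Polynomial.hom_eval₂, hcomp, map_zero]
    exact hge⟩
  rw [IntermediateField.mem_bot]
  exact ⟨a, by rw [← hcomp, ← ha]; rfl⟩

theorem ratData_of {O : Type*} [CommRing O] [Algebra O K] (hinj : Function.Injective (algebraMap O K)) {p q : O[X]} {d : ℕ} (hd : 2 ≤ d)
    (hcop : IsCoprime (p.map (algebraMap O K)) (q.map (algebraMap O K)))
    (hdeg : max p.natDegree q.natDegree = d)
    (hW : (derivative p * q - p * derivative q).degree = ((2 * d - 2 : ℕ) : WithBot ℕ)) :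
    RatData (p.map (algebraMap O K)) (q.map (algebraMap O K)) d where
  hd := hd
  cop := hcop
  hp := natDegree_map_le.trans (hdeg ▸ le_max_left _ _)
  hq := natDegree_map_le.trans (hdeg ▸ le_max_right _ _)
  top := by
    have key : ∀ r : O[X], r.natDegree = d → (r.map (algebraMap O K)).coeff d ≠ 0 := by
      intro r hr
      rw [coeff_map, ← hr]
      intro h0
      have := (map_eq_zero_iff _ hinj).1 h0
      rw [coeff_natDegree, leadingCoeff_eq_zero] at this
      rw [this, natDegree_zero] at hr
      omega
    rcases max_choice p.natDegree q.natDegree with h | h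
    · exact Or.inl (key p (h ▸ hdeg))
    · exact Or.inr (key q (h ▸ hdeg))
  hW := by
    rw [← hW, ← degree_map_eq_of_injective hinj, Polynomial.map_sub, Polynomial.map_mul, Polynomial.map_mul,
      derivative_map, derivative_map]

theorem eval_homEvalPoly {k : Type*} [CommRing k] (p A B : k[X]) (d : ℕ) (α : k) :
    (homEvalPoly p d A B).eval α = homEval2 p d (A.eval α) (B.eval α) := by
  unfold homEvalPoly homEval2
  simp [eval_finset_sum]

theorem iterPQ_eval {k : Type*} [Field k] (p q : k[X]) (d m : ℕ) (α : k) :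
    ((iterPQ p q d m).1.eval α, (iterPQ p q d m).2.eval α) = (hmap p q d)^[m] (α, 1) := by
  induction m with
  | zero => simp [iterPQ]
  | succ m ih =>
    rw [Function.iterate_succ_apply', ← ih, iterPQ, eval_homEvalPoly, eval_homEvalPoly]
    rfl

end W1
end PerProp
end ModW1

/-- Let `φ = p/q` of degree `d ≥ 2` over a number field `K`, all of
whose critical points are finite (the Wronskian `W = p′q − pq′` has degree exactly
`2d − 2`).  Assume (1) the orbits of distinct critical points never collide: for roots
`α₁, α₂` of `W` in `K̄` and `m, n ≥ 1`, `Φ^{∘m}([α₁:1]) = Φ^{∘n}([α₂:1])`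
(expressed via vanishing of the cross product of the nonzero coordinate vectors)
implies `m = n` and `α₁ = α₂`; and (2) `K` is algebraically closed in a splitting field
of `p(x) − t·q(x)` over `K(t)`.  Then for every `ε > 0` there is `M` such that every
prime `𝔭` of good reduction with `N(𝔭) > M` satisfies
`#Per(φ_𝔭) ≤ ε·(N(𝔭) + 1)`. -/
theorem per_proportion_small_of_noncolliding {K : Type*} [Field K] [NumberField K]
    (p q : Polynomial (𝓞 K)) (d : ℕ) (hd : 2 ≤ d)
    (hcop : IsCoprime (p.map (algebraMap (𝓞 K) K)) (q.map (algebraMap (𝓞 K) K)))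
    (hdeg : max p.natDegree q.natDegree = d)
    (hW : (derivative p * q - p * derivative q).degree = ((2 * d - 2 : ℕ) : WithBot ℕ))
    (h1 : ∀ α₁ α₂ : AlgebraicClosure K,
      ((derivative p * q - p * derivative q).map
        ((algebraMap K (AlgebraicClosure K)).comp (algebraMap (𝓞 K) K))).eval α₁ = 0 →
      ((derivative p * q - p * derivative q).map
        ((algebraMap K (AlgebraicClosure K)).comp (algebraMap (𝓞 K) K))).eval α₂ = 0 →
      ∀ m n : ℕ, 1 ≤ m → 1 ≤ n →
        ((iterPQ (p.map ((algebraMap K (AlgebraicClosure K)).comp (algebraMap (𝓞 K) K)))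
            (q.map ((algebraMap K (AlgebraicClosure K)).comp (algebraMap (𝓞 K) K)))
            d m).1.eval α₁ ≠ 0 ∨
         (iterPQ (p.map ((algebraMap K (AlgebraicClosure K)).comp (algebraMap (𝓞 K) K)))
            (q.map ((algebraMap K (AlgebraicClosure K)).comp (algebraMap (𝓞 K) K)))
            d m).2.eval α₁ ≠ 0) →
        ((iterPQ (p.map ((algebraMap K (AlgebraicClosure K)).comp (algebraMap (𝓞 K) K)))
            (q.map ((algebraMap K (AlgebraicClosure K)).comp (algebraMap (𝓞 K) K)))
            d n).1.eval α₂ ≠ 0 ∨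
         (iterPQ (p.map ((algebraMap K (AlgebraicClosure K)).comp (algebraMap (𝓞 K) K)))
            (q.map ((algebraMap K (AlgebraicClosure K)).comp (algebraMap (𝓞 K) K)))
            d n).2.eval α₂ ≠ 0) →
        (iterPQ (p.map ((algebraMap K (AlgebraicClosure K)).comp (algebraMap (𝓞 K) K)))
            (q.map ((algebraMap K (AlgebraicClosure K)).comp (algebraMap (𝓞 K) K)))
            d m).1.eval α₁ *
          (iterPQ (p.map ((algebraMap K (AlgebraicClosure K)).comp (algebraMap (𝓞 K) K)))
            (q.map ((algebraMap K (AlgebraicClosure K)).comp (algebraMap (𝓞 K) K)))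
            d n).2.eval α₂ =
        (iterPQ (p.map ((algebraMap K (AlgebraicClosure K)).comp (algebraMap (𝓞 K) K)))
            (q.map ((algebraMap K (AlgebraicClosure K)).comp (algebraMap (𝓞 K) K)))
            d n).1.eval α₂ *
          (iterPQ (p.map ((algebraMap K (AlgebraicClosure K)).comp (algebraMap (𝓞 K) K)))
            (q.map ((algebraMap K (AlgebraicClosure K)).comp (algebraMap (𝓞 K) K)))
            d m).2.eval α₁ →
        m = n ∧ α₁ = α₂)
    (h2 : ∀ x : (phiMinusT (p.map (algebraMap (𝓞 K) K))
        (q.map (algebraMap (𝓞 K) K))).SplittingField,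
      (∃ g : Polynomial K, g ≠ 0 ∧
        Polynomial.eval₂
          ((algebraMap (RatFunc K) (phiMinusT (p.map (algebraMap (𝓞 K) K))
              (q.map (algebraMap (𝓞 K) K))).SplittingField).comp
            (algebraMap K (RatFunc K))) x g = 0) →
      x ∈ Set.range ((algebraMap (RatFunc K) (phiMinusT (p.map (algebraMap (𝓞 K) K))
          (q.map (algebraMap (𝓞 K) K))).SplittingField).comp
        (algebraMap K (RatFunc K)))) :
    ∀ ε : ℝ, 0 < ε → ∃ M : ℝ,
      ∀ (𝔭 : Ideal (𝓞 K)) (hp : 𝔭.IsMaximal), goodReduction p q d 𝔭 hp →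
        M < (Ideal.absNorm 𝔭 : ℝ) →
        (projPerCount p q d 𝔭 hp : ℝ) ≤ ε * ((Ideal.absNorm 𝔭 : ℝ) + 1) := by
  intro ε hε
  have hinj : Function.Injective (algebraMap (𝓞 K) K) := IsFractionRing.injective (𝓞 K) K
  have hR := PerProp.ratData_of hinj hd hcop hdeg hW
  have hNC : PerProp.NonColl (p.map (algebraMap (𝓞 K) K)) (q.map (algebraMap (𝓞 K) K)) d := by
    intro α₁ α₂ ha1 ha2 m n hm hn heq
    have hWm : (derivative p * q - p * derivative q).map
        ((algebraMap K (AlgebraicClosure K)).comp (algebraMap (𝓞 K) K)) =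
        (derivative (p.map (algebraMap (𝓞 K) K)) * q.map (algebraMap (𝓞 K) K) -
          p.map (algebraMap (𝓞 K) K) * derivative (q.map (algebraMap (𝓞 K) K))).map
            (algebraMap K (AlgebraicClosure K)) := by
      rw [← Polynomial.map_map, Polynomial.map_sub, Polynomial.map_mul, Polynomial.map_mul,
        derivative_map, derivative_map]
    have hNo := (PerProp.RatData.map (k := AlgebraicClosure K) hR).noZ
    rw [Polynomial.map_map, Polynomial.map_map] at heq hNo
    set P := p.map ((algebraMap K (AlgebraicClosure K)).comp (algebraMap (𝓞 K) K)) with hP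
    set Q := q.map ((algebraMap K (AlgebraicClosure K)).comp (algebraMap (𝓞 K) K)) with hQ
    have hp1 : ∀ α : AlgebraicClosure K, PerProp.prj α 1 = some α := fun α => by
      rw [PerProp.prj_ne one_ne_zero, div_one]
    have k1 := PerProp.hmap_iter hNo (v := (α₁, 1)) (Or.inr one_ne_zero) m
    have k2 := PerProp.hmap_iter hNo (v := (α₂, 1)) (Or.inr one_ne_zero) n
    rw [← PerProp.iterPQ_eval] at k1 k2
    simp only [hp1] at k1 k2
    refine h1 α₁ α₂ (by rw [hWm]; exact ha1) (by rw [hWm]; exact ha2) m n hm hn k1.1 k2.1 ?_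
    rw [k1.2, k2.2] at heq
    exact (PerProp.prj_eq k1.1 k2.1).1 heq
  have ht := PerProp.gen_tgen (K := K)
  have hP1 := PerProp.pconst_one hR h2
  obtain ⟨ε', hε'0, hε'⟩ := exists_rat_btwn (show (0:ℝ) < ε / 6 by positivity)
  obtain ⟨n, hn⟩ := PerProp.an_small hR hNC ht hP1 (ε := ε') (by exact_mod_cast hε'0)
  obtain ⟨N, hN, B, hB⟩ := PerProp.per_bound (hdeg ▸ le_max_left _ _) (hdeg ▸ le_max_right _ _) hR ht n
    (PerProp.PConst_all hR hNC ht hP1 n ht)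
  refine ⟨max (Ideal.absNorm (Ideal.span {N}) : ℝ) (2 * B / ε), ?_⟩
  intro 𝔭 hp hgood hM
  have hM1 := lt_of_le_of_lt (le_max_left _ _) hM
  have hM2 := lt_of_le_of_lt (le_max_right _ _) hM
  have hN𝔭 : N ∉ 𝔭 := by
    intro hmem
    have hdvd := Ideal.absNorm_dvd_absNorm_of_le ((Ideal.span_singleton_le_iff_mem 𝔭).2 hmem)
    have hne : Ideal.absNorm (Ideal.span {N}) ≠ 0 := by
      rw [Ne, Ideal.absNorm_eq_zero_iff, Ideal.span_singleton_eq_bot]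
      exact hN
    have hle := Nat.le_of_dvd (Nat.pos_of_ne_zero hne) hdvd
    have : (Ideal.absNorm (Ideal.span {N})) < Ideal.absNorm 𝔭 := by exact_mod_cast hM1
    omega
  have hcard : Ideal.absNorm 𝔭 = Nat.card (𝓞 K ⧸ 𝔭) := by
    rw [Ideal.absNorm_apply, Submodule.cardQuot_apply]
  have hpos : 0 < Nat.card (𝓞 K ⧸ 𝔭) := by
    rw [← hcard]
    have : (0 : ℝ) < Ideal.absNorm 𝔭 := lt_of_le_of_lt (Nat.cast_nonneg _) hM1
    exact_mod_cast this
  letI := hp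
  letI := Ideal.Quotient.field 𝔭
  haveI : Finite (𝓞 K ⧸ 𝔭) := (Nat.card_pos_iff.1 hpos).2
  have hNo : PerProp.NoZ (p.map (Ideal.Quotient.mk 𝔭)) (q.map (Ideal.Quotient.mk 𝔭)) d := by
    intro a b hab
    by_contra hcon
    push Not at hcon
    have hi := (algebraMap (𝓞 K ⧸ 𝔭) (AlgebraicClosure (𝓞 K ⧸ 𝔭))).injective
    refine hgood (algebraMap _ _ a) (algebraMap _ _ b) ?_ ⟨?_, ?_⟩
    · rintro ⟨e1, e2⟩
      have e1' := (map_eq_zero_iff _ hi).1 e1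
      have e2' := (map_eq_zero_iff _ hi).1 e2
      exact hab.elim (fun h => h e1') (fun h => h e2')
    · have := PerProp.homEval2_map (algebraMap (𝓞 K ⧸ 𝔭) (AlgebraicClosure (𝓞 K ⧸ 𝔭))) (p.map (Ideal.Quotient.mk 𝔭)) d a b
      rw [hcon.1, map_zero, Polynomial.map_map] at this
      exact this
    · have := PerProp.homEval2_map (algebraMap (𝓞 K ⧸ 𝔭) (AlgebraicClosure (𝓞 K ⧸ 𝔭))) (q.map (Ideal.Quotient.mk 𝔭)) d a b
      rw [hcon.2, map_zero, Polynomial.map_map] at this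
      exact this
  have hfin := hB (𝓞 K ⧸ 𝔭) (Ideal.Quotient.mk 𝔭) (fun h => hN𝔭 (Ideal.Quotient.eq_zero_iff_mem.1 h)) hNo
  have hfin' : (projPerCount p q d 𝔭 hp : ℚ) ≤ _ := hfin
  rw [← hcard] at hfin'
  have hfinR : (projPerCount p q d 𝔭 hp : ℝ) ≤ 3 * (PerProp.an (p.map (algebraMap (𝓞 K) K))
      (q.map (algebraMap (𝓞 K) K)) n (PerProp.tgen K) : ℚ) * (Ideal.absNorm 𝔭 : ℝ) + B := by
    exact_mod_cast hfin'
  have hnR : ((PerProp.an (p.map (algebraMap (𝓞 K) K))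
      (q.map (algebraMap (𝓞 K) K)) n (PerProp.tgen K) : ℚ) : ℝ) ≤ ε / 6 :=
    le_trans (by exact_mod_cast hn.le) hε'.le
  rw [div_lt_iff₀ hε] at hM2
  have hA : (0 : ℝ) ≤ Ideal.absNorm 𝔭 := Nat.cast_nonneg _
  nlinarith [mul_le_mul_of_nonneg_right hnR hA]
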